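/- Let K, L ⊊ H² be proper closed convex sets with nonempty interior, and consider all orientation-preserving congruences φ, ψ of H² with int((φK) ∩ (ψL)) ≠ ∅. Consider the conditions: (1) for each such φ, ψ the set (φK) ∩ (ψL) admits some non-trivial congruence; (2) for each such φ, ψ the set (φK) ∩ (ψL) is axially symmetric; (3) the pair K, L falls into one of the cases (A), (B), (C), (D), (E). Then (3) ⟹ (2) ⟹ (1). Moreover, if all connected components of the boundaries of both K and L are hypercycles or straight lines and their total number is finite, then (1), (2) and (3) are equivalent. -/

import Mathlib

open Metric Set Filter

namespace BallChar

/-- `X` is (isometric to) the `d`-dimensional round sphere of radius 1,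
with the intrinsic (great-circle) metric. -/
def IsSphereSpace (X : Type*) [MetricSpace X] (d : ℕ) : Prop :=
  ∃ e : X → EuclideanSpace ℝ (Fin (d + 1)),
    Function.Injective e ∧
    Set.range e = Metric.sphere (0 : EuclideanSpace ℝ (Fin (d + 1))) 1 ∧
    ∀ x y : X, dist x y = Real.arccos (@inner ℝ _ _ (e x) (e y))

/-- `X` is (isometric to) the `d`-dimensional Euclidean space. -/
def IsEuclideanSpaceForm (X : Type*) [MetricSpace X] (d : ℕ) : Prop :=
  Nonempty (X ≃ᵢ EuclideanSpace ℝ (Fin d))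

/-- The Minkowski bilinear form on `ℝ^d × ℝ`. -/
noncomputable def mink (d : ℕ) (u v : EuclideanSpace ℝ (Fin d) × ℝ) : ℝ :=
  @inner ℝ _ _ u.1 v.1 - u.2 * v.2

/-- `X` is (isometric to) the `d`-dimensional hyperbolic space of curvature `-1`
(the hyperboloid model). -/
def IsHyperbolicSpace (X : Type*) [MetricSpace X] (d : ℕ) : Prop :=
  ∃ e : X → EuclideanSpace ℝ (Fin d) × ℝ,
    Function.Injective e ∧
    Set.range e = {u | mink d u u = -1 ∧ 0 < u.2} ∧
    ∀ x y : X, Real.cosh (dist x y) = - mink d (e x) (e y)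

/-- `X` is `S^d`, `ℝ^d` or `H^d`. -/
def IsSpaceForm (X : Type*) [MetricSpace X] (d : ℕ) : Prop :=
  IsSphereSpace X d ∨ IsEuclideanSpaceForm X d ∨ IsHyperbolicSpace X d

variable {X : Type*} [MetricSpace X]

/-- Metric betweenness: `z` lies on a shortest geodesic from `x` to `y`. -/
def Btw (x z y : X) : Prop := dist x z + dist z y = dist x y

/-- `z` is the unique point between `x` and `y` at its distance from `x`. -/
def UniqueBtwPt (x z y : X) : Prop :=
  Btw x z y ∧ ∀ w, Btw x w y → dist x w = dist x z → w = z

/-- Geodesic convexity (for two antipodal points of a sphere no condition is imposed). -/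
def GConvex (K : Set X) : Prop :=
  ∀ x ∈ K, ∀ y ∈ K, ∀ z, UniqueBtwPt x z y → z ∈ K

/-- `p` is a (metric) midpoint of `x` and `y`. -/
def IsMidpoint (p x y : X) : Prop := Btw x p y ∧ dist x p = dist p y

/-- A reflection in a hyperplane: a non-trivial involutive isometry whose
non-fixed locus is disconnected (by the mirror hyperplane). -/
def IsReflection (σ : X ≃ᵢ X) : Prop :=
  σ.trans σ = IsometryEquiv.refl X ∧ σ ≠ IsometryEquiv.refl X ∧
    ¬ IsPreconnected {x : X | σ x ≠ x}

/-- An orientation preserving congruence: a product of an even number of reflections. -/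
def OrientationPreserving (f : X ≃ᵢ X) : Prop :=
  ∃ l : List (X ≃ᵢ X), (∀ σ ∈ l, IsReflection σ) ∧ Even l.length ∧
    f = l.foldr IsometryEquiv.trans (IsometryEquiv.refl X)

/-- Two subsets are congruent if some isometry of the space maps one onto the other. -/
def Congruent (A B : Set X) : Prop := ∃ f : X ≃ᵢ X, ⇑f '' A = B

/-- `S` admits some non-trivial congruence. -/
def AdmitsNontrivialCongruence (S : Set X) : Prop :=
  ∃ f : X ≃ᵢ X, f ≠ IsometryEquiv.refl X ∧ ⇑f '' S = S

/-- `S` is axially symmetric (symmetric with respect to some reflection). -/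
def AxiallySymmetric (S : Set X) : Prop :=
  ∃ σ : X ≃ᵢ X, IsReflection σ ∧ ⇑σ '' S = S

/-- `S` is centrally symmetric: some involutive isometry fixing a point `p`
maps `S` onto itself, `p` being a midpoint of every pair `x`, `σ x` of `S`. -/
def CentrallySymmetric (S : Set X) : Prop :=
  ∃ (σ : X ≃ᵢ X) (p : X), Function.Involutive ⇑σ ∧ σ p = p ∧ ⇑σ '' S = S ∧
    ∀ x ∈ S, IsMidpoint p x (σ x)

/-- `S` is symmetric with respect to the orthogonal bisector hyperplane of
the segment `[a, b]`, i.e. invariant under the reflection interchanging `a` and `b`. -/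
def SymmetricWrtPerpBisector (S : Set X) (a b : X) : Prop :=
  ∃ σ : X ≃ᵢ X, IsReflection σ ∧ σ a = b ∧ ⇑σ '' S = S

/-- A closed half-space: one of the two closed sides of the mirror of a reflection. -/
def IsHalfspace (P : Set X) : Prop :=
  ∃ σ : X ≃ᵢ X, IsReflection σ ∧ IsClosed P ∧
    P ∪ ⇑σ '' P = univ ∧ P ∩ ⇑σ '' P = {x | σ x = x}

/-- A hyperplane: the mirror (fixed point set) of a reflection. -/
def IsHyperplane (B : Set X) : Prop :=
  ∃ σ : X ≃ᵢ X, IsReflection σ ∧ B = {x | σ x = x}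

/-- A paraball (horoball): a sublevel set of a Busemann function. -/
def IsParaball (K : Set X) : Prop :=
  ∃ γ : ℝ → X, Isometry γ ∧
    K = {x | ∃ b ≤ 0, Tendsto (fun t => dist x (γ t) - t) atTop (nhds b)}

/-- A parasphere (horosphere): the boundary of a paraball. -/
def IsParasphere (C : Set X) : Prop := ∃ K : Set X, IsParaball K ∧ C = frontier K

/-- A hypersphere at distance `lam > 0` from its base hyperplane
(degeneration to a hyperplane excluded). -/
def IsHypersphere (C : Set X) (lam : ℝ) : Prop :=
  0 < lam ∧ (∃ P : Set X, IsHalfspace P ∧ C = frontier {x | infDist x P ≤ lam}) ∧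
    ¬ IsHyperplane C

/-- The family of connected components of the boundary of `K`. -/
def bdryComponents (K : Set X) : Set (Set X) :=
  (connectedComponentIn (frontier K)) '' (frontier K)

/-- `closedBall p r` is an inball of `M` (a ball of maximal radius contained in `M`). -/
def IsInball (M : Set X) (p : X) (r : ℝ) : Prop :=
  0 ≤ r ∧ closedBall p r ⊆ M ∧ ∀ (q : X) (s : ℝ), closedBall q s ⊆ M → s ≤ r

/-- `closedBall p r` is the unique inball of `M`. -/
def HasUniqueInball (M : Set X) (p : X) (r : ℝ) : Prop :=
  IsInball M p r ∧ ∀ (q : X) (s : ℝ), IsInball M q s → q = p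

/-- The (geodesic) convex hull of a set. -/
def gconvexHull (Y : Set X) : Set X := ⋂₀ {C : Set X | GConvex C ∧ Y ⊆ C}

/-- `z` lies on the complete geodesic line through `a` and `b`. -/
def OnLine (a b z : X) : Prop := Btw a z b ∨ Btw z a b ∨ Btw a b z

/-- The closed `(d-1)`-ball of radius `ε` centred at `a` in the hyperplane through `a`
orthogonal to the segment `[a, b]`. -/
def perpDisc (a b : X) (ε : ℝ) : Set X :=
  {x | (∀ z, OnLine a b z → dist x a ≤ dist x z) ∧ dist x a ≤ ε}

/-- The set `D(ε)` associated to the segment `D = [a, b]`: the convex hull of the two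
`(d-1)`-balls of radius `ε` orthogonal to `D` at its endpoints. -/
def segCyl (a b : X) (ε : ℝ) : Set X :=
  gconvexHull (perpDisc a b ε ∪ perpDisc b a ε)

/-- `[a, b]` is the unique diametral segment of `M`. -/
def UniqueDiametral (M : Set X) (a b : X) : Prop :=
  a ∈ M ∧ b ∈ M ∧ a ≠ b ∧ dist a b = diam M ∧
    ∀ a' ∈ M, ∀ b' ∈ M, dist a' b' = diam M → (a' = a ∧ b' = b) ∨ (a' = b ∧ b' = a)

/-- Condition (**): at every boundary point, `K` contains a ball having this point
on its boundary. -/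
def CondBallInside (K : Set X) : Prop :=
  ∀ x ∈ frontier K, ∃ ε > 0, ∃ p : X, closedBall p ε ⊆ K ∧ x ∈ sphere p ε

/-- `K` has an extreme point. -/
def HasExtremePoint (K : Set X) : Prop :=
  ∃ x ∈ K, ∀ y ∈ K, ∀ z ∈ K, Btw y x z → x = y ∨ x = z

/-- Condition (***): near every boundary point, `K` is contained in a ball
(resp. in a convex set bounded by a hypersphere, for hyperbolic space) whose boundary
has sectional curvatures bounded below and passes through the given point. -/
def CondCurvBound (d : ℕ) (K : Set X) : Prop :=
  ∀ x ∈ frontier K, ∃ ε > 0, ∃ B : Set X,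
    {y | y ∈ K ∧ dist y x ≤ ε} ⊆ B ∧ x ∈ frontier B ∧
    (IsSphereSpace X d → ∃ (q : X) (R : ℝ), 0 < R ∧ R < Real.pi / 2 ∧
        ε ≤ Real.cos R / Real.sin R ∧ B = closedBall q R) ∧
    (IsEuclideanSpaceForm X d → ∃ (q : X) (R : ℝ), 0 < R ∧ ε ≤ 1 / R ∧ B = closedBall q R) ∧
    (IsHyperbolicSpace X d → ∃ (P : Set X) (lam : ℝ), IsHalfspace P ∧ 0 < lam ∧
        ε ≤ Real.tanh lam ∧ B = {y | infDist y P ≤ lam})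

/-- `K` has a supporting sphere at each of its boundary points
(for the sphere, of radius less than `π/2`). -/
def SupportingSpheres (d : ℕ) (K : Set X) : Prop :=
  ∀ x ∈ frontier K, ∃ (p : X) (R : ℝ), 0 < R ∧ K ⊆ closedBall p R ∧ x ∈ sphere p R ∧
    (IsSphereSpace X d → R < Real.pi / 2)

/-- `K` is `C¹` (smooth): at each boundary point there is a unique supporting half-space. -/
def SmoothBody (K : Set X) : Prop :=
  ∀ x ∈ frontier K, ∃! P : Set X, IsHalfspace P ∧ K ⊆ P ∧ x ∈ frontier P

/-- A complete geodesic (straight line). -/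
def IsGeodesicLine (B : Set X) : Prop := ∃ γ : ℝ → X, Isometry γ ∧ B = Set.range γ

/-- A circle (closed disc) of positive radius. -/
def IsDisc (K : Set X) : Prop := ∃ (p : X) (r : ℝ), 0 < r ∧ K = closedBall p r

/-- The parallel domain of `B` at distance `l`. -/
def parallelDomain (B : Set X) (l : ℝ) : Set X := {x | infDist x B ≤ l}

/-- `K` is the parallel domain of some straight line, at some distance `l > 0`. -/
def IsParallelDomain (K : Set X) : Prop :=
  ∃ (B : Set X) (l : ℝ), IsGeodesicLine B ∧ 0 < l ∧ K = parallelDomain B l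

/-- A convex domain bounded by a (proper) hypercycle. -/
def IsHypercycleDomain (K : Set X) : Prop :=
  ∃ (P : Set X) (l : ℝ), IsHalfspace P ∧ 0 < l ∧ K = {x | infDist x P ≤ l}

/-- `C` is a hypercycle or a straight line (a curve at constant distance `l ≥ 0`
from its base line). -/
def IsHypercycleOrLine (C : Set X) : Prop :=
  ∃ (P : Set X) (l : ℝ), IsHalfspace P ∧ 0 ≤ l ∧ C = frontier {x | infDist x P ≤ l}

/-- `C` is a hypercycle (or straight line) with base line `B`. -/
def HypercycleWithBase (C B : Set X) : Prop :=
  ∃ (P : Set X) (l : ℝ), IsHalfspace P ∧ 0 ≤ l ∧ frontier P = B ∧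
    C = frontier {x | infDist x P ≤ l}


/-! Cases (A)-(E) of Theorem 5 (hyperbolic plane). -/

/-- One of the basic bodies of case (A). -/
def CaseABody (K : Set X) : Prop :=
  IsDisc K ∨ IsParaball K ∨ IsHypercycleDomain K ∨ IsHalfspace K

/-- Case (A) of Theorem 5. -/
def CaseA (K L : Set X) : Prop :=
  CaseABody K ∧ CaseABody L ∧
    ((IsHypercycleDomain K ∨ IsHalfspace K) → IsDisc L ∨ Congruent K L) ∧
    ((IsHypercycleDomain L ∨ IsHalfspace L) → IsDisc K ∨ Congruent L K)

/-- `M` is bounded either by two hypercycles whose base lines coincide, or by a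
hypercycle and its base line. -/
def TwoHypSameBase (M : Set X) : Prop :=
  ∃ (B C₁ C₂ : Set X), IsGeodesicLine B ∧ C₁ ≠ C₂ ∧
    HypercycleWithBase C₁ B ∧ HypercycleWithBase C₂ B ∧ frontier M = C₁ ∪ C₂

/-- Case (B) of Theorem 5. -/
def CaseB (K L : Set X) : Prop :=
  (IsDisc K ∧ TwoHypSameBase L) ∨ (IsDisc L ∧ TwoHypSameBase K)

/-- `M` is bounded by at least two hypercycles or straight lines, with all base lines
different, whose mutual distances are at least `2r`. -/
def MultiHypFarApart (M : Set X) (r : ℝ) : Prop :=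
  (∀ x ∈ frontier M, IsHypercycleOrLine (connectedComponentIn (frontier M) x)) ∧
  (∃ x ∈ frontier M, ∃ y ∈ frontier M,
      connectedComponentIn (frontier M) x ≠ connectedComponentIn (frontier M) y) ∧
  (∀ x ∈ frontier M, ∀ y ∈ frontier M,
      connectedComponentIn (frontier M) x ≠ connectedComponentIn (frontier M) y →
        2 * r ≤ dist x y ∧
        ∀ B₁ B₂ : Set X, HypercycleWithBase (connectedComponentIn (frontier M) x) B₁ →
          HypercycleWithBase (connectedComponentIn (frontier M) y) B₂ → B₁ ≠ B₂)

/-- Case (C) of Theorem 5. -/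
def CaseC (K L : Set X) : Prop :=
  (∃ (p : X) (r : ℝ), 0 < r ∧ K = closedBall p r ∧ MultiHypFarApart L r) ∨
  (∃ (p : X) (r : ℝ), 0 < r ∧ L = closedBall p r ∧ MultiHypFarApart K r)

/-- Case (D) of Theorem 5. -/
def CaseD (K L : Set X) : Prop :=
  (IsParaball K ∧ IsParallelDomain L) ∨ (IsParaball L ∧ IsParallelDomain K)

/-- Case (E) of Theorem 5. -/
def CaseE (K L : Set X) : Prop :=
  Congruent K L ∧ IsParallelDomain K ∧ IsParallelDomain L

/-- All cases of (3) of Theorem 5 together. -/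
def Theorem5Cases (K L : Set X) : Prop :=
  CaseA K L ∨ CaseB K L ∨ CaseC K L ∨ CaseD K L ∨ CaseE K L

/-- Condition (1) of Theorem 5: every intersection of congruent copies admits some
non-trivial congruence. -/
def T5Cond1 (K L : Set X) : Prop :=
  ∀ φ ψ : X ≃ᵢ X, OrientationPreserving φ → OrientationPreserving ψ →
    (interior ((⇑φ '' K) ∩ (⇑ψ '' L))).Nonempty →
    AdmitsNontrivialCongruence ((⇑φ '' K) ∩ (⇑ψ '' L))

/-- Condition (2) of Theorem 5: every intersection of congruent copies is axially
symmetric. -/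
def T5Cond2 (K L : Set X) : Prop :=
  ∀ φ ψ : X ≃ᵢ X, OrientationPreserving φ → OrientationPreserving ψ →
    (interior ((⇑φ '' K) ∩ (⇑ψ '' L))).Nonempty →
    AxiallySymmetric ((⇑φ '' K) ∩ (⇑ψ '' L))

/-- All connected components of the boundary of `K` are hypercycles or straight lines. -/
def BdryHypOrLine (K : Set X) : Prop :=
  ∀ x ∈ frontier K, IsHypercycleOrLine (connectedComponentIn (frontier K) x)

/-- The boundary of `K` has at least two connected components. -/
def AtLeastTwoComponents (K : Set X) : Prop :=
  ∃ x ∈ frontier K, ∃ y ∈ frontier K,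
    connectedComponentIn (frontier K) x ≠ connectedComponentIn (frontier K) y

/-- The boundary of `K` is nonempty and has a single connected component. -/
def SingleComponent (K : Set X) : Prop :=
  (frontier K).Nonempty ∧ ∀ x ∈ frontier K, ∀ y ∈ frontier K,
    connectedComponentIn (frontier K) x = connectedComponentIn (frontier K) y

/-- The associated graph of `K` contains two edges with at least one common endpoint:
`K` has two distinct boundary components which are asymptotic (come arbitrarily close). -/
def TwoAsymptoticComponents (K : Set X) : Prop :=
  ∃ x ∈ frontier K, ∃ y ∈ frontier K,
    connectedComponentIn (frontier K) x ≠ connectedComponentIn (frontier K) y ∧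
    ∀ δ > (0 : ℝ), ∃ p ∈ connectedComponentIn (frontier K) x,
      ∃ q ∈ connectedComponentIn (frontier K) y, dist p q < δ

/-- The associated graph of `K` has only pairwise vertex-disjoint edges: distinct
boundary components of `K` stay at positive distance from each other. -/
def VertexDisjointEdges (K : Set X) : Prop :=
  ∀ x ∈ frontier K, ∀ y ∈ frontier K,
    connectedComponentIn (frontier K) x ≠ connectedComponentIn (frontier K) y →
      ∃ δ > (0 : ℝ), ∀ p ∈ connectedComponentIn (frontier K) x,
        ∀ q ∈ connectedComponentIn (frontier K) y, δ ≤ dist p q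

/-! Conditions of Theorem 6. -/

/-- Condition (1) of Theorem 6. -/
def T6Cond1 (K L : Set X) : Prop :=
  ∃ ε > (0 : ℝ), ∀ φ ψ : X ≃ᵢ X, OrientationPreserving φ → OrientationPreserving ψ →
    (interior ((⇑φ '' K) ∩ (⇑ψ '' L))).Nonempty →
    diam ((⇑φ '' K) ∩ (⇑ψ '' L)) < ε →
    CentrallySymmetric ((⇑φ '' K) ∩ (⇑ψ '' L))

/-- Condition (2) of Theorem 6. -/
def T6Cond2 (K L : Set X) : Prop :=
  ∀ x ∈ frontier K, ∀ y ∈ frontier L, ∃ ε > (0 : ℝ),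
    ∀ φ ψ : X ≃ᵢ X, OrientationPreserving φ → OrientationPreserving ψ →
      (interior ((⇑φ '' K) ∩ (⇑ψ '' L))).Nonempty →
      diam ((⇑φ '' K) ∩ (⇑ψ '' L)) < ε →
      ∀ (p : X) (r : ℝ), HasUniqueInball ((⇑φ '' K) ∩ (⇑ψ '' L)) p r →
        frontier ((⇑φ '' K) ∩ (⇑ψ '' L)) ∩ sphere p r = {φ x, ψ y} →
        φ x ∈ interior (⇑ψ '' L) → ψ y ∈ interior (⇑φ '' K) →
        IsMidpoint p (φ x) (ψ y) →
        CentrallySymmetric ((⇑φ '' K) ∩ (⇑ψ '' L))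

/-- Condition (3) of Theorem 6. -/
def T6Cond3 (K L : Set X) : Prop :=
  ∀ x ∈ frontier K, ∀ y ∈ frontier L, ∃ ε > (0 : ℝ),
    ∀ φ ψ : X ≃ᵢ X, OrientationPreserving φ → OrientationPreserving ψ →
      (interior ((⇑φ '' K) ∩ (⇑ψ '' L))).Nonempty →
      diam ((⇑φ '' K) ∩ (⇑ψ '' L)) < ε →
      ∀ (p : X) (r : ℝ), HasUniqueInball ((⇑φ '' K) ∩ (⇑ψ '' L)) p r →
        frontier ((⇑φ '' K) ∩ (⇑ψ '' L)) ∩ sphere p r = {φ x, ψ y} →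
        φ x ∈ interior (⇑ψ '' L) → ψ y ∈ interior (⇑φ '' K) →
        IsMidpoint p (φ x) (ψ y) →
        SymmetricWrtPerpBisector ((⇑φ '' K) ∩ (⇑ψ '' L)) (φ x) (ψ y)

/-- Condition (4) of Theorem 6. -/
def T6Cond4 (d : ℕ) (K L : Set X) : Prop :=
  (∃ r > (0 : ℝ), (IsSphereSpace X d → r ≤ Real.pi / 2) ∧
      (∀ C ∈ bdryComponents K ∪ bdryComponents L, ∃ p : X, C = sphere p r) ∧
      (∃ p : X, K = closedBall p r) ∧ ∃ q : X, L = closedBall q r) ∨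
  ((∀ C ∈ bdryComponents K ∪ bdryComponents L, IsParasphere C) ∧
      IsParaball K ∧ IsParaball L) ∨
  (∃ lam > (0 : ℝ), ∀ C ∈ bdryComponents K ∪ bdryComponents L, IsHypersphere C lam)

/-! Conditions of Theorems 7 and 8. -/

/-- The pair `φ, ψ` is admissible for hypothesis (****): both are orientation
preserving, and for the sphere `(φ K) ∪ (ψ L)` lies in an open hemisphere. -/
def GoodPair (d : ℕ) (K L : Set X) (φ ψ : X ≃ᵢ X) : Prop :=
  OrientationPreserving φ ∧ OrientationPreserving ψ ∧
    (IsSphereSpace X d → ∃ s : X, (⇑φ '' K) ∪ (⇑ψ '' L) ⊆ ball s (Real.pi / 2))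

/-- The convex hull of the union of the two congruent copies. -/
def hullUnion (K L : Set X) (φ ψ : X ≃ᵢ X) : Set X := gconvexHull ((⇑φ '' K) ∪ (⇑ψ '' L))

/-- Condition (A) of (3) of Theorem 7: the diameter of `M` is sufficiently close to `π`
(sphere), resp. sufficiently large (Euclidean, hyperbolic), as measured by `δ`. -/
def BigDiam (d : ℕ) (X : Type*) [MetricSpace X] (M : Set X) (δ : ℝ) : Prop :=
  (IsSphereSpace X d → Real.pi - δ < diam M) ∧ (¬ IsSphereSpace X d → 1 / δ < diam M)

/-- Condition (1) of Theorem 7. -/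
def T7Cond1 (d : ℕ) (K L : Set X) : Prop :=
  ∀ φ ψ : X ≃ᵢ X, GoodPair d K L φ ψ → CentrallySymmetric (hullUnion K L φ ψ)

/-- Condition (2) of Theorem 7. -/
def T7Cond2 (d : ℕ) (K L : Set X) : Prop :=
  ∀ φ ψ : X ≃ᵢ X, GoodPair d K L φ ψ → ∀ a b : X, UniqueDiametral (hullUnion K L φ ψ) a b →
    SymmetricWrtPerpBisector (hullUnion K L φ ψ) a b

/-- Condition (3) of Theorem 7. -/
def T7Cond3 (d : ℕ) (K L : Set X) : Prop :=
  ∃ δ > (0 : ℝ), ∀ φ ψ : X ≃ᵢ X, GoodPair d K L φ ψ →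
    ∀ x ∈ frontier K, ∀ y ∈ frontier L,
      BigDiam d X (hullUnion K L φ ψ) δ →
      UniqueDiametral (hullUnion K L φ ψ) (φ x) (ψ y) →
      CentrallySymmetric (hullUnion K L φ ψ)

/-- Condition (4) of Theorem 7. -/
def T7Cond4 (d : ℕ) (K L : Set X) : Prop :=
  ∃ δ > (0 : ℝ), ∀ φ ψ : X ≃ᵢ X, GoodPair d K L φ ψ →
    ∀ x ∈ frontier K, ∀ y ∈ frontier L,
      BigDiam d X (hullUnion K L φ ψ) δ →
      UniqueDiametral (hullUnion K L φ ψ) (φ x) (ψ y) →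
      SymmetricWrtPerpBisector (hullUnion K L φ ψ) (φ x) (ψ y)

/-- Condition (5) of Theorem 7. -/
def T7Cond5 (d : ℕ) (K L : Set X) : Prop :=
  ∃ δ > (0 : ℝ), ∀ φ ψ : X ≃ᵢ X, GoodPair d K L φ ψ →
    ∀ x ∈ frontier K, ∀ y ∈ frontier L,
      BigDiam d X (hullUnion K L φ ψ) δ →
      UniqueDiametral (hullUnion K L φ ψ) (φ x) (ψ y) →
      ∃ ε₀ > (0 : ℝ), ∀ ε : ℝ, 0 < ε → ε < ε₀ →
        (IsSphereSpace X d → ∃ s : X, (⇑φ '' K) ∪ (⇑ψ '' L) ⊆ ball s (Real.pi / 2) ∧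
            segCyl (φ x) (ψ y) ε ⊆ ball s (Real.pi / 2)) ∧
        CentrallySymmetric (hullUnion K L φ ψ ∩ segCyl (φ x) (ψ y) ε)

/-- Condition (6) of Theorem 7. -/
def T7Cond6 (d : ℕ) (K L : Set X) : Prop :=
  ∃ δ > (0 : ℝ), ∀ φ ψ : X ≃ᵢ X, GoodPair d K L φ ψ →
    ∀ x ∈ frontier K, ∀ y ∈ frontier L,
      BigDiam d X (hullUnion K L φ ψ) δ →
      UniqueDiametral (hullUnion K L φ ψ) (φ x) (ψ y) →
      ∃ ε₀ > (0 : ℝ), ∀ ε : ℝ, 0 < ε → ε < ε₀ →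
        (IsSphereSpace X d → ∃ s : X, (⇑φ '' K) ∪ (⇑ψ '' L) ⊆ ball s (Real.pi / 2) ∧
            segCyl (φ x) (ψ y) ε ⊆ ball s (Real.pi / 2)) ∧
        SymmetricWrtPerpBisector (hullUnion K L φ ψ ∩ segCyl (φ x) (ψ y) ε) (φ x) (ψ y)

/-- Condition (7) of Theorem 7: `K` and `L` are congruent balls. -/
def T7Cond7 (d : ℕ) (K L : Set X) : Prop :=
  ∃ r > (0 : ℝ), (IsSphereSpace X d → r < Real.pi / 2) ∧
    (∃ p : X, K = closedBall p r) ∧ ∃ q : X, L = closedBall q r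

/-- Condition (1) of Theorem 8. -/
def T8Cond1 (K L : Set X) : Prop :=
  ∀ φ ψ : X ≃ᵢ X, GoodPair 2 K L φ ψ → AxiallySymmetric (hullUnion K L φ ψ)

/-- Condition (2) of Theorem 8. -/
def T8Cond2 (K L : Set X) : Prop :=
  ∀ φ ψ : X ≃ᵢ X, GoodPair 2 K L φ ψ → AdmitsNontrivialCongruence (hullUnion K L φ ψ)

/-- Condition (3) of Theorem 8. -/
def T8Cond3 (K L : Set X) : Prop :=
  ∃ δ > (0 : ℝ), ∀ φ ψ : X ≃ᵢ X, GoodPair 2 K L φ ψ →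
    ∀ x ∈ frontier K, ∀ y ∈ frontier L,
      BigDiam 2 X (hullUnion K L φ ψ) δ →
      UniqueDiametral (hullUnion K L φ ψ) (φ x) (ψ y) →
      AxiallySymmetric (hullUnion K L φ ψ)

/-- Condition (4) of Theorem 8. -/
def T8Cond4 (K L : Set X) : Prop :=
  ∃ δ > (0 : ℝ), ∀ φ ψ : X ≃ᵢ X, GoodPair 2 K L φ ψ →
    ∀ x ∈ frontier K, ∀ y ∈ frontier L,
      BigDiam 2 X (hullUnion K L φ ψ) δ →
      UniqueDiametral (hullUnion K L φ ψ) (φ x) (ψ y) →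
      AdmitsNontrivialCongruence (hullUnion K L φ ψ)

/-- Condition (5) of Theorem 8. -/
def T8Cond5 (K L : Set X) : Prop :=
  ∃ δ > (0 : ℝ), ∀ φ ψ : X ≃ᵢ X, GoodPair 2 K L φ ψ →
    ∀ x ∈ frontier K, ∀ y ∈ frontier L,
      BigDiam 2 X (hullUnion K L φ ψ) δ →
      UniqueDiametral (hullUnion K L φ ψ) (φ x) (ψ y) →
      ∃ ε₀ > (0 : ℝ), ∀ ε : ℝ, 0 < ε → ε < ε₀ →
        (IsSphereSpace X 2 → ∃ s : X, (⇑φ '' K) ∪ (⇑ψ '' L) ⊆ ball s (Real.pi / 2) ∧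
            segCyl (φ x) (ψ y) ε ⊆ ball s (Real.pi / 2)) ∧
        AxiallySymmetric (hullUnion K L φ ψ ∩ segCyl (φ x) (ψ y) ε)

/-- Condition (6) of Theorem 8. -/
def T8Cond6 (K L : Set X) : Prop :=
  ∃ δ > (0 : ℝ), ∀ φ ψ : X ≃ᵢ X, GoodPair 2 K L φ ψ →
    ∀ x ∈ frontier K, ∀ y ∈ frontier L,
      BigDiam 2 X (hullUnion K L φ ψ) δ →
      UniqueDiametral (hullUnion K L φ ψ) (φ x) (ψ y) →
      ∃ ε₀ > (0 : ℝ), ∀ ε : ℝ, 0 < ε → ε < ε₀ →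
        (IsSphereSpace X 2 → ∃ s : X, (⇑φ '' K) ∪ (⇑ψ '' L) ⊆ ball s (Real.pi / 2) ∧
            segCyl (φ x) (ψ y) ε ⊆ ball s (Real.pi / 2)) ∧
        AdmitsNontrivialCongruence (hullUnion K L φ ψ ∩ segCyl (φ x) (ψ y) ε)

/-- Condition (7) of Theorem 8: `K` and `L` are (in general incongruent) circles. -/
def T8Cond7 (K L : Set X) : Prop :=
  ∃ (p q : X) (r s : ℝ), 0 < r ∧ 0 < s ∧
    (IsSphereSpace X 2 → r < Real.pi / 2 ∧ s < Real.pi / 2) ∧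
    K = closedBall p r ∧ L = closedBall q s


/-! ### Lorentzian linear algebra in dimension three -/

/-- The Lorentzian vector space in which the hyperboloid model lives. -/
abbrev LVec := ℝ × ℝ × ℝ

/-- The Lorentzian bilinear form of signature `(2, 1)`. -/
def lform (u v : LVec) : ℝ := u.1 * v.1 + u.2.1 * v.2.1 - u.2.2 * v.2.2

/-- The Lorentzian cross product. -/
def lcross (u v : LVec) : LVec :=
  (u.2.1 * v.2.2 - u.2.2 * v.2.1, u.2.2 * v.1 - u.1 * v.2.2, -(u.1 * v.2.1 - u.2.1 * v.1))

/-- The upper sheet of the hyperboloid. -/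
def hyperboloid : Set LVec := {v | lform v v = -1 ∧ 0 < v.2.2}

theorem lform_comm (u v : LVec) : lform u v = lform v u := by simp only [lform]; ring

theorem lform_add_left (u v w : LVec) : lform (u + v) w = lform u w + lform v w := by
  simp only [lform, Prod.fst_add, Prod.snd_add]; ring

theorem lform_add_right (u v w : LVec) : lform u (v + w) = lform u v + lform u w := by
  simp only [lform, Prod.fst_add, Prod.snd_add]; ring

theorem lform_sub_left (u v w : LVec) : lform (u - v) w = lform u w - lform v w := by
  simp only [lform, Prod.fst_sub, Prod.snd_sub]; ring

theorem lform_sub_right (u v w : LVec) : lform u (v - w) = lform u v - lform u w := by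
  simp only [lform, Prod.fst_sub, Prod.snd_sub]; ring

theorem lform_neg_left (u v : LVec) : lform (-u) v = -lform u v := by
  simp only [lform, Prod.fst_neg, Prod.snd_neg]; ring

theorem lform_neg_right (u v : LVec) : lform u (-v) = -lform u v := by
  simp only [lform, Prod.fst_neg, Prod.snd_neg]; ring

theorem lform_smul_left (c : ℝ) (u v : LVec) : lform (c • u) v = c * lform u v := by
  simp only [lform, Prod.smul_fst, Prod.smul_snd, smul_eq_mul]; ring

theorem lform_smul_right (c : ℝ) (u v : LVec) : lform u (c • v) = c * lform u v := by
  simp only [lform, Prod.smul_fst, Prod.smul_snd, smul_eq_mul]; ring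

theorem lform_zero_left (u : LVec) : lform 0 u = 0 := by simp [lform]

theorem lform_zero_right (u : LVec) : lform u 0 = 0 := by simp [lform]

theorem continuous_lform : Continuous fun p : LVec × LVec => lform p.1 p.2 := by
  unfold lform; fun_prop

theorem eq_zero_of_forall_lform_eq_zero {v : LVec} (h : ∀ w, lform v w = 0) : v = 0 := by
  have h1 := h (1, 0, 0)
  have h2 := h (0, 1, 0)
  have h3 := h (0, 0, 1)
  simp [lform] at h1 h2 h3
  ext <;> simp [h1, h2, h3]

theorem lform_lcross_lcross (u v : LVec) :
    lform (lcross u v) (lcross u v) = lform u v ^ 2 - lform u u * lform v v := by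
  simp only [lform, lcross]; ring

theorem lform_lcross_left (u v : LVec) : lform (lcross u v) u = 0 := by
  simp only [lform, lcross]; ring

theorem lform_lcross_right (u v : LVec) : lform (lcross u v) v = 0 := by
  simp only [lform, lcross]; ring

theorem lform_lcross_swap (u v w : LVec) :
    lform (lcross u v) w = -lform (lcross u w) v := by
  simp only [lform, lcross]; ring

theorem lform_lcross_smul_eq (a b c w : LVec) :
    lform (lcross a b) c • w =
      lform w a • lcross b c + lform w b • lcross c a + lform w c • lcross a b := by
  ext <;> simp [lform, lcross] <;> ring

theorem eq_zero_of_lform_eq_zero {a b c w : LVec} (h : lform (lcross a b) c ≠ 0)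
    (ha : lform w a = 0) (hb : lform w b = 0) (hc : lform w c = 0) : w = 0 := by
  have := lform_lcross_smul_eq a b c w
  rw [ha, hb, hc] at this
  simpa [h] using this

theorem lform_mul_eq (a b w : LVec) :
    lform (lcross a b) (lcross a b) • w = lform w (lcross a b) • lcross a b
      + (lform a b * lform w b - lform b b * lform w a) • a
      + (lform a b * lform w a - lform a a * lform w b) • b := by
  ext <;> simp [lform, lcross] <;> ring

theorem lform_self_pos {p w : LVec} (hp : p ∈ hyperboloid) (h : lform p w = 0) (hw : w ≠ 0) :
    0 < lform w w := by
  obtain ⟨p1, p2, t⟩ := p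
  obtain ⟨w1, w2, r⟩ := w
  obtain ⟨hp1, hp2⟩ := hp
  simp only [lform] at *
  have hn : 0 < w1 ^ 2 + w2 ^ 2 := by
    by_contra hcon
    have h1 : w1 = 0 := by nlinarith [sq_nonneg w1, sq_nonneg w2]
    have h2 : w2 = 0 := by nlinarith [sq_nonneg w1, sq_nonneg w2]
    subst h1 h2
    have : t * r = 0 := by linarith
    have h3 : r = 0 := by simpa [hp2.ne'] using this
    subst h3
    exact hw rfl
  have key : (t * r) ^ 2 ≤ (t ^ 2 - 1) * (w1 ^ 2 + w2 ^ 2) := by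
    have e1 : t * r = p1 * w1 + p2 * w2 := by linarith
    have e2 : t ^ 2 - 1 = p1 ^ 2 + p2 ^ 2 := by linarith
    rw [e1, e2]; nlinarith [sq_nonneg (p1 * w2 - p2 * w1)]
  have : 0 < t ^ 2 * (w1 * w1 + w2 * w2 - r * r) := by nlinarith
  exact pos_of_mul_pos_right this (by positivity)

theorem lform_self_nonneg {p w : LVec} (hp : p ∈ hyperboloid) (h : lform p w = 0) :
    0 ≤ lform w w := by
  by_cases hw : w = 0
  · simp [hw, lform_zero_left]
  · exact (lform_self_pos hp h hw).le

theorem ne_zero_of_mem_hyperboloid {p : LVec} (hp : p ∈ hyperboloid) : p ≠ 0 := by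
  rintro rfl; simpa using hp.2

theorem ne_zero_of_lform_self_ne {p : LVec} (hp : lform p p ≠ 0) : p ≠ 0 := by
  rintro rfl; exact hp (lform_zero_left 0)

theorem lform_ne_zero {p w : LVec} (hp : p ∈ hyperboloid) (h : lform w w ≤ 0) (hw : w ≠ 0) :
    lform p w ≠ 0 := fun h0 => absurd (lform_self_pos hp h0 hw) (not_lt.2 h)

/-- A point of the hyperboloid and a future causal vector have negative product. -/
theorem lform_neg_of_future {p w : LVec} (hp : p ∈ hyperboloid) (h : lform w w ≤ 0)
    (hw : 0 < w.2.2) : lform p w < 0 := by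
  obtain ⟨p1, p2, t⟩ := p
  obtain ⟨w1, w2, r⟩ := w
  obtain ⟨hp1, hp2⟩ := hp
  simp only [lform] at *
  by_contra hcon
  have h1 : t * r ≤ p1 * w1 + p2 * w2 := by linarith
  have h2 : (t * r) ^ 2 ≤ (p1 * w1 + p2 * w2) ^ 2 := by
    apply pow_le_pow_left₀ (by positivity) h1
  have h3 : (p1 * w1 + p2 * w2) ^ 2 ≤ (p1 ^ 2 + p2 ^ 2) * (w1 ^ 2 + w2 ^ 2) := by
    nlinarith [sq_nonneg (p1 * w2 - p2 * w1)]
  have h4 : p1 ^ 2 + p2 ^ 2 = t ^ 2 - 1 := by linarith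
  have h5 : (p1 ^ 2 + p2 ^ 2) * (w1 ^ 2 + w2 ^ 2) ≤ (t ^ 2 - 1) * r ^ 2 := by
    rw [h4]
    have : 0 ≤ t ^ 2 - 1 := by rw [← h4]; positivity
    nlinarith
  nlinarith [sq_pos_of_pos hw]

theorem lform_le_neg_one {p q : LVec} (hp : p ∈ hyperboloid) (hq : q ∈ hyperboloid) :
    lform p q ≤ -1 := by
  have hneg : lform p q < 0 := lform_neg_of_future hp (by rw [hq.1]; norm_num) hq.2
  have h0 : 0 ≤ lform (q + lform p q • p) (q + lform p q • p) := by
    apply lform_self_nonneg hp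
    rw [lform_add_right, lform_smul_right, hp.1]; ring
  simp only [lform_add_left, lform_add_right, lform_smul_left, lform_smul_right, hp.1, hq.1,
    lform_comm q p] at h0
  nlinarith

theorem eq_of_lform_eq_neg_one {p q : LVec} (hp : p ∈ hyperboloid) (hq : q ∈ hyperboloid)
    (h : lform p q = -1) : p = q := by
  by_contra hne
  have := lform_self_pos (w := p - q) hp (by rw [lform_sub_right, hp.1, h]; ring)
    (sub_ne_zero.2 hne)
  simp only [lform_sub_left, lform_sub_right, hp.1, hq.1, h, lform_comm q p] at this
  linarith

theorem mem_hyperboloid_of_lform_neg {p q : LVec} (hp : p ∈ hyperboloid) (hq : lform q q = -1)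
    (h : lform p q < 0) : q ∈ hyperboloid := by
  refine ⟨hq, ?_⟩
  by_contra hcon
  rcases (not_lt.1 hcon).lt_or_eq with h1 | h1
  · have := lform_neg_of_future (w := -q) hp
      (by rw [lform_neg_left, lform_neg_right, hq]; norm_num) (by simpa using h1)
    rw [lform_neg_right] at this
    linarith
  · simp only [lform, h1] at hq
    nlinarith [sq_nonneg q.1, sq_nonneg q.2.1]

/-- A timelike unit vector lies on the hyperboloid up to sign. -/
theorem mem_or_neg_mem_hyperboloid {q : LVec} (hq : lform q q = -1) :
    q ∈ hyperboloid ∨ -q ∈ hyperboloid := by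
  have ho : ((0, 0, 1) : LVec) ∈ hyperboloid := by simp [hyperboloid, lform]
  rcases lt_trichotomy (lform (0, 0, 1) q) 0 with h | h | h
  · exact .inl (mem_hyperboloid_of_lform_neg ho hq h)
  · exact absurd h (lform_ne_zero ho (by rw [hq]; norm_num)
      (ne_zero_of_lform_self_ne (by simp [hq])))
  · exact .inr (mem_hyperboloid_of_lform_neg ho (by rw [lform_neg_left, lform_neg_right, hq]; simp)
      (by rw [lform_neg_right]; linarith))

theorem origin_mem_hyperboloid : ((0, 0, 1) : LVec) ∈ hyperboloid := by simp [hyperboloid, lform]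

/-- The affine combination on a hyperbola: `cosh τ • p + sinh τ • w`. -/
theorem cosh_smul_add_sinh_smul_mem {p w : LVec} (hp : p ∈ hyperboloid) (hpw : lform p w = 0)
    (hw : lform w w = 1) (τ : ℝ) :
    Real.cosh τ • p + Real.sinh τ • w ∈ hyperboloid := by
  apply mem_hyperboloid_of_lform_neg hp
  · simp only [lform_add_left, lform_add_right, lform_smul_left, lform_smul_right, hp.1, hw, hpw,
      lform_comm w p]
    nlinarith [Real.cosh_sq τ]
  · simp only [lform_add_right, lform_smul_right, hp.1, hpw]
    nlinarith [Real.cosh_pos τ]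

/-- The linear reflection in the plane orthogonal to `a`. -/
noncomputable def lrefl (a : LVec) : LVec →ₗ[ℝ] LVec where
  toFun v := v - (2 * lform v a / lform a a) • a
  map_add' u v := by
    rw [lform_add_left]; module
  map_smul' c v := by
    rw [lform_smul_left, RingHom.id_apply, smul_sub, smul_smul]
    congr 2; ring

theorem lrefl_apply (a v : LVec) : lrefl a v = v - (2 * lform v a / lform a a) • a := rfl

theorem lform_lrefl {a : LVec} (ha : lform a a ≠ 0) (u v : LVec) :
    lform (lrefl a u) (lrefl a v) = lform u v := by
  simp only [lrefl_apply, lform_sub_left, lform_sub_right, lform_smul_left, lform_smul_right,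
    lform_comm a v]
  field_simp; ring

theorem lrefl_lrefl {a : LVec} (ha : lform a a ≠ 0) (v : LVec) : lrefl a (lrefl a v) = v := by
  simp only [lrefl_apply, lform_sub_left, lform_smul_left]
  have : 2 * (lform v a - 2 * lform v a / lform a a * lform a a) / lform a a
    = -(2 * lform v a / lform a a) := by field_simp; ring
  rw [this]; module

theorem lrefl_eq_self {a v : LVec} (h : lform v a = 0) : lrefl a v = v := by
  simp [lrefl_apply, h]

theorem lrefl_eq_self_iff {a v : LVec} (ha : lform a a ≠ 0) : lrefl a v = v ↔ lform v a = 0 := by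
  refine ⟨fun h => ?_, lrefl_eq_self⟩
  have h2 : (2 * lform v a / lform a a) • a = 0 := by
    rw [lrefl_apply, sub_eq_self] at h; exact h
  rcases smul_eq_zero.1 h2 with h3 | h3
  · field_simp at h3; linarith
  · exact absurd h3 (ne_zero_of_lform_self_ne ha)

theorem lrefl_mem_hyperboloid {a v : LVec} (ha : 0 < lform a a) (hv : v ∈ hyperboloid) :
    lrefl a v ∈ hyperboloid := by
  apply mem_hyperboloid_of_lform_neg hv
  · rw [lform_lrefl ha.ne', hv.1]
  · rw [lrefl_apply, lform_sub_right, lform_smul_right, hv.1]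
    have : 2 * lform v a / lform a a * lform v a = 2 * lform v a ^ 2 / lform a a := by ring
    rw [this]
    have : 0 ≤ 2 * lform v a ^ 2 / lform a a := by positivity
    linarith

/-- The reflection in the bisector of two vectors of equal norm interchanges them. -/
theorem lrefl_sub {u v : LVec} (h : lform u u = lform v v) (hne : lform (u - v) (u - v) ≠ 0) :
    lrefl (u - v) u = v := by
  have e : 2 * lform u (u - v) = lform (u - v) (u - v) := by
    simp only [lform_sub_left, lform_sub_right, lform_comm v u]; linarith
  rw [lrefl_apply, e, div_self hne]; module

theorem lrefl_sub' {u v : LVec} (h : lform u u = lform v v) (hne : lform (u - v) (u - v) ≠ 0) :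
    lrefl (u - v) v = u := by
  calc lrefl (u - v) v = lrefl (u - v) (lrefl (u - v) u) := by rw [lrefl_sub h hne]
    _ = u := lrefl_lrefl hne u

theorem lform_sub_self_pos {p q : LVec} (hp : p ∈ hyperboloid) (hq : q ∈ hyperboloid)
    (hne : p ≠ q) : 0 < lform (p - q) (p - q) := by
  have h1 := lform_le_neg_one hp hq
  have h2 : lform p q ≠ -1 := fun h => hne (eq_of_lform_eq_neg_one hp hq h)
  have h3 := lt_of_le_of_ne h1 h2
  simp only [lform_sub_left, lform_sub_right, hp.1, hq.1, lform_comm q p]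
  linarith

/-- Every point of the hyperboloid and every vector have a common spacelike normal. -/
theorem exists_spacelike_normal {p : LVec} (hp : p ∈ hyperboloid) (w : LVec) :
    ∃ a, 0 < lform a a ∧ lform p a = 0 ∧ lform w a = 0 := by
  by_cases h : lcross p w = 0
  · have hw : w = (-lform w p) • p := by
      by_contra hne
      have h3 := lform_self_pos (w := w + lform w p • p) hp
        (by rw [lform_add_right, lform_smul_right, hp.1, lform_comm]; ring)
        (by intro h4; apply hne; rw [neg_smul]; exact eq_neg_of_add_eq_zero_left h4)
      have h4 := lform_lcross_lcross p w
      rw [h, lform_zero_left, hp.1] at h4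
      simp only [lform_add_left, lform_add_right, lform_smul_left, lform_smul_right, hp.1,
        lform_comm w p] at h3
      nlinarith
    obtain ⟨a, ha, hpa⟩ : ∃ a : LVec, a ≠ 0 ∧ lform p a = 0 := by
      refine ⟨(p.2.2, 0, p.1), ?_, ?_⟩
      · intro h0
        have := congrArg Prod.fst h0
        exact hp.2.ne' this
      · simp only [lform]; ring
    exact ⟨a, lform_self_pos hp hpa ha, hpa, by rw [hw, lform_smul_left, hpa, mul_zero]⟩
  · exact ⟨lcross p w, lform_self_pos hp (by rw [lform_comm, lform_lcross_left]) h,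
      by rw [lform_comm, lform_lcross_left], by rw [lform_comm, lform_lcross_right]⟩

/-! ### The hyperboloid chart -/

/-- An identification of `X` with the upper sheet of the hyperboloid. -/
structure HypChart (X : Type*) [MetricSpace X] where
  /-- The underlying embedding. -/
  vec : X → LVec
  injective : Function.Injective vec
  range_eq : Set.range vec = hyperboloid
  cosh_dist : ∀ x y : X, Real.cosh (dist x y) = -lform (vec x) (vec y)

theorem IsHyperbolicSpace.nonempty_hypChart (h : IsHyperbolicSpace X 2) :
    Nonempty (HypChart X) := by
  obtain ⟨e, he, hr, hd⟩ := h
  let J : EuclideanSpace ℝ (Fin 2) × ℝ → LVec := fun u => (u.1 0, u.1 1, u.2)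
  have hJ : ∀ u v, lform (J u) (J v) = mink 2 u v := by
    intro u v
    simp [J, lform, mink, PiLp.inner_apply, Fin.sum_univ_two, mul_comm]
  have hJinj : Function.Injective J := by
    rintro ⟨u, s⟩ ⟨v, t⟩ h
    simp only [J, Prod.mk.injEq] at h
    obtain ⟨h0, h1, h2⟩ := h
    refine Prod.ext ?_ h2
    ext i; fin_cases i
    · exact h0
    · exact h1
  refine ⟨⟨J ∘ e, hJinj.comp he, ?_, fun x y => by simp [hd, hJ]⟩⟩
  ext v
  constructor
  · rintro ⟨x, rfl⟩
    have : e x ∈ Set.range e := ⟨x, rfl⟩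
    rw [hr] at this
    exact ⟨by rw [Function.comp, hJ]; exact this.1, this.2⟩
  · intro hv
    have : (!₂[v.1, v.2.1], v.2.2) ∈ Set.range e := by
      rw [hr]
      refine ⟨?_, hv.2⟩
      rw [← hJ]
      simpa [J] using hv.1
    obtain ⟨x, hx⟩ := this
    exact ⟨x, by simp [hx, J]⟩

namespace HypChart

variable (E : HypChart X)

theorem mem (x : X) : E.vec x ∈ hyperboloid := E.range_eq ▸ ⟨x, rfl⟩

theorem surj {v : LVec} (hv : v ∈ hyperboloid) : ∃ x, E.vec x = v := by
  rwa [← E.range_eq] at hv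

theorem lform_self (x : X) : lform (E.vec x) (E.vec x) = -1 := (E.mem x).1

theorem lform_eq (x y : X) : lform (E.vec x) (E.vec y) = -Real.cosh (dist x y) := by
  rw [E.cosh_dist]; ring

theorem dist_eq_iff {x y x' y' : X} :
    dist x y = dist x' y' ↔ lform (E.vec x) (E.vec y) = lform (E.vec x') (E.vec y') := by
  rw [E.lform_eq, E.lform_eq, neg_inj]
  refine ⟨fun h => by rw [h], fun h => ?_⟩
  exact Real.cosh_strictMonoOn.injOn (Set.mem_Ici.2 dist_nonneg) (Set.mem_Ici.2 dist_nonneg) h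

theorem dist_le_real_iff {x y : X} {r : ℝ} (hr : 0 ≤ r) :
    dist x y ≤ r ↔ -Real.cosh r ≤ lform (E.vec x) (E.vec y) := by
  rw [E.lform_eq, neg_le_neg_iff, Real.cosh_le_cosh, abs_of_nonneg dist_nonneg, abs_of_nonneg hr]

theorem dist_lt_real_iff {x y : X} {r : ℝ} (hr : 0 ≤ r) :
    dist x y < r ↔ -Real.cosh r < lform (E.vec x) (E.vec y) := by
  rw [E.lform_eq, neg_lt_neg_iff, Real.cosh_lt_cosh, abs_of_nonneg dist_nonneg, abs_of_nonneg hr]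

theorem continuous_lform_vec_vec (y : X) : Continuous fun x => lform (E.vec x) (E.vec y) := by
  simp_rw [E.lform_eq]
  exact (Real.continuous_cosh.comp (continuous_id.dist continuous_const)).neg

theorem continuous_lform_vec (w : LVec) : Continuous fun x => lform (E.vec x) w := by
  have h2 : √2 * √2 = 2 := by norm_num
  obtain ⟨o, ho⟩ := E.surj origin_mem_hyperboloid
  obtain ⟨p, hp⟩ := E.surj (v := (1, 0, √2)) ⟨by simp [lform]; norm_num, by simp⟩
  obtain ⟨q, hq⟩ := E.surj (v := (0, 1, √2)) ⟨by simp [lform]; norm_num, by simp⟩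
  have e : ∀ x, lform (E.vec x) w = w.1 * lform (E.vec x) (E.vec p)
      + w.2.1 * lform (E.vec x) (E.vec q)
      + (w.2.2 - √2 * (w.1 + w.2.1)) * lform (E.vec x) (E.vec o) := by
    intro x
    rw [hp, hq, ho]; simp only [lform]; ring
  simp_rw [e]
  have := E.continuous_lform_vec_vec p
  have := E.continuous_lform_vec_vec q
  have := E.continuous_lform_vec_vec o
  fun_prop

theorem continuous_vec : Continuous E.vec := by
  have h1 := E.continuous_lform_vec (1, 0, 0)
  have h2 := E.continuous_lform_vec (0, 1, 0)
  have h3 := E.continuous_lform_vec (0, 0, -1)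
  simp only [lform, mul_one, mul_zero, add_zero, sub_zero, zero_add, mul_neg, zero_sub,
    neg_neg] at h1 h2 h3
  exact h1.prodMk (h2.prodMk h3)

theorem isInducing_vec : Topology.IsInducing E.vec := by
  rw [Topology.isInducing_iff_nhds]
  intro x
  refine le_antisymm (E.continuous_vec.tendsto x).le_comap ?_
  intro s hs
  obtain ⟨ε, hε, hs⟩ := Metric.mem_nhds_iff.1 hs
  refine ⟨{v | -Real.cosh ε < lform v (E.vec x)}, ?_, ?_⟩
  · apply IsOpen.mem_nhds
    · exact isOpen_lt continuous_const
        (continuous_lform.comp (continuous_id.prodMk continuous_const))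
    · simp only [Set.mem_ofPred_eq, E.lform_self, neg_lt_neg_iff]
      exact Real.one_lt_cosh.2 hε.ne'
  · intro y hy
    exact hs ((E.dist_lt_real_iff hε.le).2 hy)

/-- The coordinates of the Klein disc model. -/
noncomputable def klein (x : X) : ℝ × ℝ :=
  ((E.vec x).1 / (E.vec x).2.2, (E.vec x).2.1 / (E.vec x).2.2)

theorem continuous_klein : Continuous E.klein := by
  have h := E.continuous_vec
  have hne : ∀ x, (E.vec x).2.2 ≠ 0 := fun x => (E.mem x).2.ne'
  unfold klein
  fun_prop (disch := exact hne)

/-- The inverse of the Klein chart, as a map to the hyperboloid. -/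
noncomputable def unklein (a : ℝ × ℝ) : LVec :=
  (√(1 - a.1 ^ 2 - a.2 ^ 2))⁻¹ • (a.1, a.2, 1)

theorem one_sub_klein (x : X) :
    1 - (E.klein x).1 ^ 2 - (E.klein x).2 ^ 2 = ((E.vec x).2.2⁻¹) ^ 2 := by
  have h := E.lform_self x
  have h2 := (E.mem x).2
  simp only [klein, lform] at *
  field_simp
  linarith

theorem unklein_klein (x : X) : unklein (E.klein x) = E.vec x := by
  have h2 := (E.mem x).2
  rw [unklein, E.one_sub_klein, Real.sqrt_sq (by positivity), inv_inv]
  have h3 := h2.ne'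
  ext <;> simp [klein] <;> field_simp

theorem continuousAt_unklein {a : ℝ × ℝ} (ha : 0 < 1 - a.1 ^ 2 - a.2 ^ 2) :
    ContinuousAt unklein a := by
  have : √(1 - a.1 ^ 2 - a.2 ^ 2) ≠ 0 := (Real.sqrt_pos.2 ha).ne'
  unfold unklein
  fun_prop (disch := assumption)

theorem unklein_mem {a : ℝ × ℝ} (ha : 0 < 1 - a.1 ^ 2 - a.2 ^ 2) :
    unklein a ∈ hyperboloid := by
  have h1 := Real.sqrt_pos.2 ha
  have h2 := Real.sq_sqrt ha.le
  constructor
  · simp only [unklein, lform_smul_left, lform_smul_right]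
    simp only [lform]
    field_simp
    linarith
  · simp only [unklein, Prod.smul_snd, smul_eq_mul]; positivity

theorem klein_eq_of_vec {x : X} {a : ℝ × ℝ} (ha : 0 < 1 - a.1 ^ 2 - a.2 ^ 2)
    (h : E.vec x = unklein a) : E.klein x = a := by
  have h1 := Real.sqrt_pos.2 ha
  simp only [klein, h, unklein]
  ext <;> simp <;> field_simp

theorem range_klein : Set.range E.klein = {a : ℝ × ℝ | 0 < 1 - a.1 ^ 2 - a.2 ^ 2} := by
  ext a
  constructor
  · rintro ⟨x, rfl⟩
    have := (E.mem x).2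
    simp only [Set.mem_ofPred_eq, E.one_sub_klein]
    positivity
  · intro ha
    obtain ⟨x, hx⟩ := E.surj (unklein_mem ha)
    exact ⟨x, E.klein_eq_of_vec ha hx⟩

theorem isOpenEmbedding_klein : Topology.IsOpenEmbedding E.klein := by
  refine ⟨⟨?_, ?_⟩, ?_⟩
  · rw [Topology.isInducing_iff_nhds]
    intro x
    refine le_antisymm (E.continuous_klein.tendsto x).le_comap ?_
    rw [E.isInducing_vec.nhds_eq_comap x]
    have hx : 0 < 1 - (E.klein x).1 ^ 2 - (E.klein x).2 ^ 2 := by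
      have : E.klein x ∈ Set.range E.klein := ⟨x, rfl⟩
      rwa [E.range_klein] at this
    have h1 : Tendsto unklein (nhds (E.klein x)) (nhds (E.vec x)) := by
      have := continuousAt_unklein hx
      rwa [ContinuousAt, E.unklein_klein] at this
    have h2 : E.vec = unklein ∘ E.klein := funext fun y => (E.unklein_klein y).symm
    conv_rhs => rw [h2]
    rw [← Filter.comap_comap]
    exact Filter.comap_mono (by rw [← h2]; exact h1.le_comap)
  · intro x y h
    apply E.injective
    rw [← E.unklein_klein, h, E.unklein_klein]
  · rw [E.range_klein]
    exact isOpen_lt continuous_const (by fun_prop)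

/-! ### Convexity in the chart -/

/-- Convexity expressed by nonnegative linear combinations in the hyperboloid model. -/
def ConeConvex (S : Set X) : Prop :=
  ∀ x ∈ S, ∀ y ∈ S, ∀ (z : X) (α β : ℝ), 0 ≤ α → 0 ≤ β →
    E.vec z = α • E.vec x + β • E.vec y → z ∈ S

theorem combo_sq {x y z : X} {α β : ℝ} (h : E.vec z = α • E.vec x + β • E.vec y) :
    1 = α ^ 2 + β ^ 2 + 2 * α * β * Real.cosh (dist x y) := by
  have := E.lform_self z
  rw [h] at this
  simp only [lform_add_left, lform_add_right, lform_smul_left, lform_smul_right, E.lform_self,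
    lform_comm (E.vec y) (E.vec x), E.lform_eq x y] at this
  linarith

theorem sinh_dist_left {x y z : X} {α β : ℝ} (hβ : 0 ≤ β)
    (h : E.vec z = α • E.vec x + β • E.vec y) :
    Real.cosh (dist x z) = α + β * Real.cosh (dist x y) ∧
      Real.sinh (dist x z) = β * Real.sinh (dist x y) := by
  have h1 : Real.cosh (dist x z) = α + β * Real.cosh (dist x y) := by
    rw [E.cosh_dist, h, lform_add_right, lform_smul_right, lform_smul_right, E.lform_self,
      E.lform_eq]
    ring
  refine ⟨h1, ?_⟩
  have h2 := E.combo_sq h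
  have h3 : Real.sinh (dist x z) ^ 2 = (β * Real.sinh (dist x y)) ^ 2 := by
    rw [mul_pow, Real.sinh_sq, Real.sinh_sq, h1]
    linarith
  exact (pow_left_inj₀ (Real.sinh_nonneg_iff.2 dist_nonneg)
    (mul_nonneg hβ (Real.sinh_nonneg_iff.2 dist_nonneg)) two_ne_zero).1 h3

theorem btw_of_combo {x y z : X} {α β : ℝ} (hα : 0 ≤ α) (hβ : 0 ≤ β)
    (h : E.vec z = α • E.vec x + β • E.vec y) : Btw x z y := by
  obtain ⟨c1, s1⟩ := E.sinh_dist_left hβ h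
  obtain ⟨c2, s2⟩ := E.sinh_dist_left (x := y) (y := x) (α := β) hα (by rw [h, add_comm])
  rw [dist_comm y z, dist_comm y x] at c2 s2
  have h2 := E.combo_sq h
  unfold Btw
  have hc : Real.cosh (dist x z + dist z y) = Real.cosh (dist x y) := by
    rw [Real.cosh_add, c1, c2, s1, s2]
    have := Real.sinh_sq (dist x y)
    linear_combination (α * β) * this - Real.cosh (dist x y) * h2
  exact Real.cosh_strictMonoOn.injOn (Set.mem_Ici.2 (by positivity)) (Set.mem_Ici.2 dist_nonneg) hc

theorem uniqueBtwPt_of_combo {x y z : X} {α β : ℝ} (hα : 0 ≤ α) (hβ : 0 ≤ β)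
    (h : E.vec z = α • E.vec x + β • E.vec y) : UniqueBtwPt x z y := by
  have hb := E.btw_of_combo hα hβ h
  refine ⟨hb, fun w hw hd => ?_⟩
  have hd2 : dist w y = dist z y := by unfold Btw at hb hw; linarith
  apply E.injective
  apply eq_of_lform_eq_neg_one (E.mem w) (E.mem z)
  have h1 := E.dist_eq_iff.1 hd
  have h2 := E.dist_eq_iff.1 hd2
  rw [← E.lform_self z]
  conv_lhs => rw [h]
  conv_rhs => rhs; rw [h]
  simp only [lform_add_right, lform_smul_right, h2, lform_comm _ (E.vec x), h1]

theorem _root_.BallChar.GConvex.coneConvex {S : Set X} (h : GConvex S) : E.ConeConvex S :=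
  fun x hx y hy z _ _ hα hβ hz => h x hx y hy z (E.uniqueBtwPt_of_combo hα hβ hz)

/-- Positive combinations of points of the hyperboloid can be normalized. -/
theorem exists_pt_combo (x y : X) {α β : ℝ} (hα : 0 ≤ α) (hβ : 0 ≤ β) (h : 0 < α + β) :
    ∃ (z : X) (c : ℝ), 0 < c ∧ E.vec z = (c * α) • E.vec x + (c * β) • E.vec y := by
  set N := α ^ 2 + β ^ 2 + 2 * α * β * Real.cosh (dist x y) with hN
  have hC := Real.cosh_pos (dist x y)
  have hpos : 0 < N := by
    have : 0 ≤ 2 * α * β * Real.cosh (dist x y) := by positivity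
    rcases hα.lt_or_eq with h0 | h0
    · have : 0 < α ^ 2 := by positivity
      nlinarith [sq_nonneg β]
    · have : 0 < β := by linarith
      have : 0 < β ^ 2 := by positivity
      nlinarith [sq_nonneg α]
  have hs := Real.sqrt_pos.2 hpos
  have hss := Real.sq_sqrt hpos.le
  obtain ⟨z, hz⟩ := E.surj (v := ((√N)⁻¹ * α) • E.vec x + ((√N)⁻¹ * β) • E.vec y) (by
    have hx := (E.mem x).2
    have hy := (E.mem y).2
    constructor
    · simp only [lform_add_left, lform_add_right, lform_smul_left, lform_smul_right, E.lform_self,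
        lform_comm (E.vec y) (E.vec x), E.lform_eq x y]
      field_simp
      rw [hss, hN]; ring
    · simp only [Prod.snd_add, Prod.smul_snd, smul_eq_mul]
      have : (√N)⁻¹ * α * (E.vec x).2.2 + (√N)⁻¹ * β * (E.vec y).2.2
        = (√N)⁻¹ * (α * (E.vec x).2.2 + β * (E.vec y).2.2) := by ring
      rw [this]
      refine mul_pos (by positivity) ?_
      rcases hα.lt_or_eq with h0 | h0
      · have := mul_pos h0 hx; have := mul_nonneg hβ hy.le; linarith
      · have := mul_nonneg hα hx.le
        have := mul_pos (show 0 < β by linarith) hy; linarith)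
  exact ⟨z, (√N)⁻¹, by positivity, hz⟩

theorem klein_combo {x y z : X} {α β : ℝ} (h : E.vec z = α • E.vec x + β • E.vec y) :
    E.klein z = (α * (E.vec x).2.2 / (E.vec z).2.2) • E.klein x
      + (β * (E.vec y).2.2 / (E.vec z).2.2) • E.klein y := by
  have hx := (E.mem x).2.ne'
  have hy := (E.mem y).2.ne'
  have hz := (E.mem z).2.ne'
  have h1 : (E.vec z).1 = α * (E.vec x).1 + β * (E.vec y).1 := by simp [h]
  have h2 : (E.vec z).2.1 = α * (E.vec x).2.1 + β * (E.vec y).2.1 := by simp [h]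
  ext
  · simp only [klein, h1, Prod.fst_add, Prod.smul_fst, smul_eq_mul]; field_simp
  · simp only [klein, h2, Prod.snd_add, Prod.smul_snd, smul_eq_mul]; field_simp

theorem ConeConvex.convex_klein {S : Set X} (h : E.ConeConvex S) : Convex ℝ (E.klein '' S) := by
  rintro _ ⟨x, hx, rfl⟩ _ ⟨y, hy, rfl⟩ a b ha hb hab
  have htx := (E.mem x).2
  have hty := (E.mem y).2
  obtain ⟨z, c, hc, hz⟩ := E.exists_pt_combo x y (α := a / (E.vec x).2.2)
    (β := b / (E.vec y).2.2) (by positivity) (by positivity) (by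
      rcases ha.lt_or_eq with h0 | h0
      · have := div_pos h0 htx; have := div_nonneg hb hty.le; linarith
      · have := div_nonneg ha htx.le
        have := div_pos (show 0 < b by linarith) hty; linarith)
  refine ⟨z, h x hx y hy z _ _ (by positivity) (by positivity) hz, ?_⟩
  have htz : (E.vec z).2.2 = c := by
    rw [hz]; simp only [Prod.snd_add, Prod.smul_snd, smul_eq_mul]
    field_simp; linear_combination hab
  rw [E.klein_combo hz, htz]
  congr 2 <;> field_simp

theorem ConeConvex.isPreconnected {S : Set X} (h : E.ConeConvex S) : IsPreconnected S :=
  E.isOpenEmbedding_klein.isInducing.isPreconnected_image.1 (h.convex_klein).isPreconnected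

end HypChart

/-- Linear maps agreeing on the hyperboloid agree. -/
theorem linearMap_ext_hyperboloid {A C : LVec →ₗ[ℝ] LVec} (h : ∀ p ∈ hyperboloid, A p = C p) :
    A = C := by
  have h2 : √2 * √2 = 2 := by norm_num
  have ho := h _ origin_mem_hyperboloid
  have hp := h (1, 0, √2) ⟨by simp [lform]; norm_num, by simp⟩
  have hq := h (0, 1, √2) ⟨by simp [lform]; norm_num, by simp⟩
  refine LinearMap.ext fun v => ?_
  have e : v = v.1 • ((1, 0, √2) : LVec) + v.2.1 • ((0, 1, √2) : LVec)
      + (v.2.2 - √2 * (v.1 + v.2.1)) • ((0, 0, 1) : LVec) := by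
    ext <;> simp; ring
  rw [e]; simp only [map_add, map_smul, ho, hp, hq]

/-- A linear Lorentz transformation fixing two vectors that span a nondegenerate plane. -/
theorem eq_id_or_eq_lrefl {A : LVec →ₗ[ℝ] LVec} (hA : ∀ u v, lform (A u) (A v) = lform u v)
    {a b : LVec} (ha : A a = a) (hb : A b = b)
    (hd : lform (lcross a b) (lcross a b) ≠ 0) :
    A = LinearMap.id ∨ A = lrefl (lcross a b) := by
  set d := lcross a b with hdef
  have h1 : lform (A d) a = 0 := by rw [← ha, hA, lform_lcross_left]
  have h2 : lform (A d) b = 0 := by rw [← hb, hA, lform_lcross_right]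
  have h3 := lform_mul_eq a b (A d)
  rw [h1, h2, ← hdef] at h3
  simp only [mul_zero, sub_zero, zero_smul, add_zero] at h3
  set μ := lform (A d) d / lform d d with hμ
  have h4 : A d = μ • d := by
    have : (lform d d)⁻¹ • lform d d • A d = (lform d d)⁻¹ • lform (A d) d • d := by rw [h3]
    rw [smul_smul, inv_mul_cancel₀ hd, one_smul, smul_smul] at this
    rw [this, hμ]; congr 1; field_simp
  have h5 : μ ^ 2 = 1 := by
    have := hA d d
    rw [h4, lform_smul_left, lform_smul_right] at this
    apply mul_right_cancel₀ hd; linarith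
  have h6 : ∀ w, A w = w + ((μ - 1) * (lform w d / lform d d)) • d := by
    intro w
    have e := lform_mul_eq a b w
    rw [← hdef] at e
    have e2 := congrArg A e
    simp only [map_add, map_smul, ha, hb, h4] at e2
    have e3 : lform d d • A w = lform d d • (w + ((μ - 1) * (lform w d / lform d d)) • d) := by
      rw [smul_add, e, e2, smul_smul _ _ d, smul_smul _ _ d]
      have : lform d d * ((μ - 1) * (lform w d / lform d d)) = (μ - 1) * lform w d := by
        field_simp
      rw [this]; module
    exact smul_right_injective _ hd e3
  have h7 : μ = 1 ∨ μ = -1 := by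
    rcases mul_eq_zero.1 (show (μ - 1) * (μ + 1) = 0 by linarith) with h | h
    · left; linarith
    · right; linarith
  rcases h7 with h | h
  · left; refine LinearMap.ext fun w => ?_; rw [h6, h]; simp
  · right; refine LinearMap.ext fun w => ?_; rw [h6, h, lrefl_apply]; module

namespace HypChart

variable (E : HypChart X)

theorem exists_lin (f : X ≃ᵢ X) : ∃ A : LVec ≃ₗ[ℝ] LVec,
    (∀ u v, lform (A u) (A v) = lform u v) ∧ ∀ x, E.vec (f x) = A (E.vec x) := by
  have h2 : √2 * √2 = 2 := by norm_num
  obtain ⟨o, ho⟩ := E.surj origin_mem_hyperboloid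
  obtain ⟨p, hp⟩ := E.surj (v := (1, 0, √2)) ⟨by simp [lform]; norm_num, by simp⟩
  obtain ⟨q, hq⟩ := E.surj (v := (0, 1, √2)) ⟨by simp [lform]; norm_num, by simp⟩
  have hinv : ∀ x y, lform (E.vec (f x)) (E.vec (f y)) = lform (E.vec x) (E.vec y) := fun x y =>
    E.dist_eq_iff.1 (f.dist_eq x y)
  let A : LVec →ₗ[ℝ] LVec :=
    { toFun := fun v => v.1 • E.vec (f p) + v.2.1 • E.vec (f q)
        + (v.2.2 - √2 * (v.1 + v.2.1)) • E.vec (f o)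
      map_add' := by intro u v; simp only [Prod.fst_add, Prod.snd_add]; module
      map_smul' := by
        intro c v; simp only [Prod.smul_fst, Prod.smul_snd, smul_eq_mul, RingHom.id_apply]; module }
  have hAdef : ∀ v, A v = v.1 • E.vec (f p) + v.2.1 • E.vec (f q)
        + (v.2.2 - √2 * (v.1 + v.2.1)) • E.vec (f o) := fun v => rfl
  have e : ∀ v : LVec, v = v.1 • E.vec p + v.2.1 • E.vec q
      + (v.2.2 - √2 * (v.1 + v.2.1)) • E.vec o := by
    intro v; rw [hp, hq, ho]
    ext <;> simp; ring
  have hA : ∀ u v, lform (A u) (A v) = lform u v := by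
    intro u v
    conv_rhs => rw [e u, e v]
    rw [hAdef, hAdef]
    simp only [lform_add_left, lform_add_right, lform_smul_left, lform_smul_right, hinv]
  have hAx : ∀ x, E.vec (f x) = A (E.vec x) := by
    intro x
    have h3 : lform (E.vec (f x)) (A (E.vec x)) = -1 := by
      rw [← E.lform_self x]
      conv_rhs => rhs; rw [e (E.vec x)]
      rw [hAdef]
      simp only [lform_add_right, lform_smul_right, hinv]
    have h4 : A (E.vec x) ∈ hyperboloid :=
      mem_hyperboloid_of_lform_neg (E.mem (f x)) (by rw [hA, E.lform_self]) (by rw [h3]; norm_num)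
    exact eq_of_lform_eq_neg_one (E.mem _) h4 h3
  have hinj : Function.Injective A := by
    rw [← LinearMap.ker_eq_bot, LinearMap.ker_eq_bot']
    intro v hv
    apply eq_zero_of_forall_lform_eq_zero
    intro w
    rw [← hA, hv, lform_zero_left]
  exact ⟨LinearEquiv.ofInjectiveEndo A hinj, hA, hAx⟩

/-- The Lorentz transformation inducing an isometry. -/
noncomputable def lin (f : X ≃ᵢ X) : LVec ≃ₗ[ℝ] LVec := (E.exists_lin f).choose

theorem lform_lin (f : X ≃ᵢ X) (u v : LVec) : lform (E.lin f u) (E.lin f v) = lform u v :=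
  (E.exists_lin f).choose_spec.1 u v

theorem vec_apply (f : X ≃ᵢ X) (x : X) : E.vec (f x) = E.lin f (E.vec x) :=
  (E.exists_lin f).choose_spec.2 x

theorem lin_unique {f : X ≃ᵢ X} {A : LVec →ₗ[ℝ] LVec} (h : ∀ x, E.vec (f x) = A (E.vec x)) :
    (E.lin f : LVec →ₗ[ℝ] LVec) = A := by
  apply linearMap_ext_hyperboloid
  intro p hp
  obtain ⟨x, rfl⟩ := E.surj hp
  rw [← h, LinearEquiv.coe_coe, E.vec_apply]

theorem lin_trans (f g : X ≃ᵢ X) (v : LVec) : E.lin (f.trans g) v = E.lin g (E.lin f v) := by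
  have := E.lin_unique (f := f.trans g)
    (A := (E.lin g : LVec →ₗ[ℝ] LVec) ∘ₗ (E.lin f : LVec →ₗ[ℝ] LVec))
    (fun x => by simp [E.vec_apply])
  exact LinearMap.congr_fun this v

theorem lin_refl (v : LVec) : E.lin (IsometryEquiv.refl X) v = v := by
  have := E.lin_unique (f := IsometryEquiv.refl X) (A := LinearMap.id) (fun x => rfl)
  exact LinearMap.congr_fun this v

theorem lin_lin_symm (f : X ≃ᵢ X) (v : LVec) : E.lin f (E.lin f.symm v) = v := by
  rw [← E.lin_trans, show f.symm.trans f = IsometryEquiv.refl X by ext x; simp; rfl, E.lin_refl]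

theorem eq_of_lin_eq {f g : X ≃ᵢ X} (h : ∀ v, E.lin f v = E.lin g v) : f = g := by
  ext x; apply E.injective; rw [E.vec_apply, h, E.vec_apply]

/-- The reflection of `X` with a given spacelike normal. -/
noncomputable def refl (a : LVec) (ha : 0 < lform a a) : X ≃ᵢ X where
  toFun x := (E.surj (lrefl_mem_hyperboloid ha (E.mem x))).choose
  invFun x := (E.surj (lrefl_mem_hyperboloid ha (E.mem x))).choose
  left_inv x := by
    apply E.injective
    rw [(E.surj (lrefl_mem_hyperboloid ha (E.mem _))).choose_spec,
      (E.surj (lrefl_mem_hyperboloid ha (E.mem x))).choose_spec, lrefl_lrefl ha.ne']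
  right_inv x := by
    apply E.injective
    rw [(E.surj (lrefl_mem_hyperboloid ha (E.mem _))).choose_spec,
      (E.surj (lrefl_mem_hyperboloid ha (E.mem x))).choose_spec, lrefl_lrefl ha.ne']
  isometry_toFun := by
    apply Isometry.of_dist_eq
    intro x y
    rw [E.dist_eq_iff, (E.surj (lrefl_mem_hyperboloid ha (E.mem _))).choose_spec,
      (E.surj (lrefl_mem_hyperboloid ha (E.mem _))).choose_spec, lform_lrefl ha.ne']

theorem vec_refl {a : LVec} (ha : 0 < lform a a) (x : X) :
    E.vec (E.refl a ha x) = lrefl a (E.vec x) :=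
  (E.surj (lrefl_mem_hyperboloid ha (E.mem x))).choose_spec

theorem lin_reflection {a : LVec} (ha : 0 < lform a a) (v : LVec) :
    E.lin (E.refl a ha) v = lrefl a v :=
  LinearMap.congr_fun (E.lin_unique (A := lrefl a) (E.vec_refl ha)) v

/-- Every unit spacelike vector is orthogonal to a point of the hyperboloid. -/
theorem exists_pt_perp {u : LVec} (hu : 0 < lform u u) : ∃ p : X, lform (E.vec p) u = 0 := by
  set o : LVec := (0, 0, 1)
  have ho : o ∈ hyperboloid := origin_mem_hyperboloid
  set q := o - (lform o u / lform u u) • u with hq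
  have hqu : lform q u = 0 := by
    rw [hq, lform_sub_left, lform_smul_left]; field_simp; ring
  have hqq : lform q q = -1 - lform o u ^ 2 / lform u u := by
    rw [hq]
    simp only [lform_sub_left, lform_sub_right, lform_smul_left, lform_smul_right, ho.1,
      lform_comm u o]
    field_simp; ring
  have hneg : lform q q < 0 := by
    rw [hqq]; have : 0 ≤ lform o u ^ 2 / lform u u := by positivity
    linarith
  have hs : 0 < √(-lform q q) := Real.sqrt_pos.2 (by linarith)
  have hss := Real.sq_sqrt (show 0 ≤ -lform q q by linarith)
  have h1 : lform ((√(-lform q q))⁻¹ • q) ((√(-lform q q))⁻¹ • q) = -1 := by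
    rw [lform_smul_left, lform_smul_right]; field_simp; linarith
  rcases mem_or_neg_mem_hyperboloid h1 with h | h <;> obtain ⟨p, hp⟩ := E.surj h <;>
    exact ⟨p, by rw [hp]; simp [lform_neg_left, lform_smul_left, hqu]⟩

theorem exists_pt_lform_eq {u : LVec} (hu : lform u u = 1) (s : ℝ) :
    ∃ p : X, lform (E.vec p) u = s := by
  obtain ⟨p, hp⟩ := E.exists_pt_perp (u := u) (by rw [hu]; norm_num)
  obtain ⟨x, hx⟩ := E.surj (cosh_smul_add_sinh_smul_mem (E.mem p) hp hu (Real.arsinh s))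
  refine ⟨x, ?_⟩
  rw [hx, lform_add_left, lform_smul_left, lform_smul_left, hp, hu, Real.sinh_arsinh]; ring

theorem exists_normalize {a : LVec} (ha : 0 < lform a a) :
    ∃ c : ℝ, 0 < c ∧ lform (c • a) (c • a) = 1 := by
  have hs := Real.sqrt_pos.2 ha
  have hss := Real.sq_sqrt ha.le
  refine ⟨(√(lform a a))⁻¹, by positivity, ?_⟩
  rw [lform_smul_left, lform_smul_right]; field_simp; exact hss.symm

theorem exists_pt_lform_pos {a : LVec} (ha : 0 < lform a a) :
    ∃ p : X, 0 < lform (E.vec p) a := by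
  obtain ⟨c, hc, h⟩ := exists_normalize ha
  obtain ⟨p, hp⟩ := E.exists_pt_lform_eq h 1
  rw [lform_smul_right] at hp
  exact ⟨p, pos_of_mul_pos_right (by rw [hp]; norm_num) hc.le⟩

theorem isReflection_refl {a : LVec} (ha : 0 < lform a a) : IsReflection (E.refl a ha) := by
  have hfix : ∀ x, E.refl a ha x = x ↔ lform (E.vec x) a = 0 := by
    intro x
    rw [← lrefl_eq_self_iff ha.ne', ← E.vec_refl ha]
    exact E.injective.eq_iff.symm
  obtain ⟨p, hp⟩ := E.exists_pt_lform_pos ha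
  obtain ⟨q, hq⟩ := E.exists_pt_lform_pos (a := -a)
    (by rwa [lform_neg_left, lform_neg_right, neg_neg])
  rw [lform_neg_right] at hq
  refine ⟨?_, ?_, ?_⟩
  · apply E.eq_of_lin_eq
    intro v
    rw [E.lin_trans, E.lin_reflection, E.lin_reflection, lrefl_lrefl ha.ne', E.lin_refl]
  · intro h
    have := (hfix p).1 (by rw [h]; rfl)
    exact hp.ne' this
  · intro h
    have hc := E.continuous_lform_vec a
    obtain ⟨x, hx, h1, h2⟩ := h {x | 0 < lform (E.vec x) a} {x | lform (E.vec x) a < 0}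
      (isOpen_lt continuous_const hc) (isOpen_lt hc continuous_const)
      (by
        intro x hx
        rcases lt_trichotomy (lform (E.vec x) a) 0 with h | h | h
        · exact .inr h
        · exact absurd ((hfix x).2 h) hx
        · exact .inl h)
      ⟨p, fun h => hp.ne' ((hfix p).1 h), hp⟩
      ⟨q, fun h => by have := (hfix q).1 h; linarith, by simpa using hq⟩
    simp only [Set.mem_ofPred_eq] at h1 h2
    exact lt_asymm h1 h2

theorem isPreconnected_compl_singleton (E : HypChart X) (x₀ : X) :
    IsPreconnected ({x₀}ᶜ : Set X) := by
  have hmem : ∀ a : ℝ × ℝ, ((a.1, a.2, √(1 + a.1 ^ 2 + a.2 ^ 2)) : LVec) ∈ hyperboloid := by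
    intro a
    have h := Real.sq_sqrt (show 0 ≤ 1 + a.1 ^ 2 + a.2 ^ 2 by positivity)
    exact ⟨by simp only [lform]; linarith, Real.sqrt_pos.2 (by positivity)⟩
  choose g hg using fun a => E.surj (hmem a)
  have hgc : Continuous g := by
    rw [E.isInducing_vec.continuous_iff]
    have : E.vec ∘ g = fun a => (a.1, a.2, √(1 + a.1 ^ 2 + a.2 ^ 2)) := funext hg
    rw [this]; fun_prop
  have hgs : ∀ x, g ((E.vec x).1, (E.vec x).2.1) = x := by
    intro x
    apply E.injective
    rw [hg]
    have h1 := E.lform_self x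
    have h2 := (E.mem x).2
    simp only [lform] at h1
    have : 1 + (E.vec x).1 ^ 2 + (E.vec x).2.1 ^ 2 = (E.vec x).2.2 ^ 2 := by linarith
    simp only [this, Real.sqrt_sq h2.le]
  have : ({x₀}ᶜ : Set X) = g '' {((E.vec x₀).1, (E.vec x₀).2.1)}ᶜ := by
    ext x
    constructor
    · intro hx
      refine ⟨_, ?_, hgs x⟩
      intro h
      apply hx
      rw [Set.mem_singleton_iff] at h
      rw [Set.mem_singleton_iff, ← hgs x, h, hgs]
    · rintro ⟨a, ha, rfl⟩ h
      apply ha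
      rw [Set.mem_singleton_iff] at h ⊢
      rw [← h, hg]
  rw [this]
  refine IsPreconnected.image ?_ _ hgc.continuousOn
  exact (isConnected_compl_singleton_of_one_lt_rank
    (by simp [← Module.finrank_eq_rank ℝ]) _).isPreconnected

end HypChart

theorem lrefl_smul {c : ℝ} (hc : c ≠ 0) (a v : LVec) : lrefl (c • a) v = lrefl a v := by
  rw [lrefl_apply, lrefl_apply, lform_smul_right, lform_smul_right, lform_smul_left, smul_smul]
  congr 2
  by_cases h : lform a a = 0
  · simp [h]
  · field_simp

theorem eq_of_lform_vec_eq {a b p q : LVec} (hp : p ∈ hyperboloid) (hq : q ∈ hyperboloid)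
    (ha : 0 < lform a a) (hb : b ≠ 0) (hab : lform a b = 0) (hpa : lform p a = 0)
    (hpb : lform p b = 0) (hqa : lform q a = 0) (hqb : lform q b = 0) : p = q := by
  have hbb : 0 < lform b b := lform_self_pos hp hpb hb
  have hd := lform_lcross_lcross a b
  rw [hab] at hd
  have hdn : lform (lcross a b) (lcross a b) < 0 := by rw [hd]; nlinarith [mul_pos ha hbb]
  have ep := lform_mul_eq a b p
  have eq := lform_mul_eq a b q
  rw [hpa, hpb] at ep
  rw [hqa, hqb] at eq
  simp only [mul_zero, sub_zero, zero_smul, add_zero] at ep eq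
  set d := lcross a b
  have hq0 := lform_ne_zero hq hdn.le (ne_zero_of_lform_self_ne hdn.ne)
  have hp0 := lform_ne_zero hp hdn.le (ne_zero_of_lform_self_ne hdn.ne)
  have e : p = (lform p d / lform q d) • q := by
    apply smul_right_injective _ hdn.ne
    simp only
    rw [ep, smul_comm, eq, smul_smul]; congr 1; field_simp
  set c := lform p d / lform q d
  have h1 := hp.1
  rw [e, lform_smul_left, lform_smul_right, hq.1] at h1
  have h2 := hp.2
  rw [e] at h2
  simp only [Prod.smul_snd, smul_eq_mul] at h2
  have hc : 0 < c := pos_of_mul_pos_left h2 hq.2.le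
  have : c = 1 := by nlinarith
  rw [e, this, one_smul]

namespace HypChart

variable (E : HypChart X)

theorem exists_lrefl_of_isReflection {σ : X ≃ᵢ X} (h : IsReflection σ) :
    ∃ a : LVec, lform a a = 1 ∧ ∀ v, E.lin σ v = lrefl a v := by
  obtain ⟨h1, h2, h3⟩ := h
  have hinv : ∀ v, E.lin σ (E.lin σ v) = v := by
    intro v; rw [← E.lin_trans, h1, E.lin_refl]
  obtain ⟨x, hx⟩ : ∃ x, σ x ≠ x := by
    by_contra hcon; push Not at hcon
    exact h2 (IsometryEquiv.ext hcon)
  set A := E.lin σ with hAdef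
  set p := E.vec x with hp
  have hne : p ≠ A p := by
    rw [← E.vec_apply]; exact fun h => hx (E.injective h.symm)
  have hApm : A p ∈ hyperboloid := by rw [← E.vec_apply]; exact E.mem _
  have hpos := lform_sub_self_pos (E.mem x) hApm hne
  set a := p - A p with ha
  have haa : lform p p = lform (A p) (A p) := by rw [E.lform_lin]
  have hAa : A a = -a := by rw [ha, map_sub, hinv]; abel
  let C : LVec →ₗ[ℝ] LVec := lrefl a ∘ₗ (A : LVec →ₗ[ℝ] LVec)
  have hCdef : ∀ v, C v = lrefl a (A v) := fun v => rfl
  have hC : ∀ u v, lform (C u) (C v) = lform u v := by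
    intro u v; rw [hCdef, hCdef, lform_lrefl hpos.ne', E.lform_lin]
  have hCp : C p = p := by rw [hCdef, ha, lrefl_sub' haa hpos.ne']
  have hCa : C a = a := by
    rw [hCdef, hAa, map_neg, lrefl_apply, mul_div_assoc, div_self hpos.ne']; module
  have hAC : ∀ v, A v = lrefl a (C v) := by intro v; rw [hCdef, lrefl_lrefl hpos.ne']
  have hd : 0 < lform (lcross p a) (lcross p a) := by
    rw [lform_lcross_lcross, E.lform_self]; nlinarith [sq_nonneg (lform p a)]
  rcases eq_id_or_eq_lrefl hC hCp hCa hd.ne' with hid | hR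
  · obtain ⟨c, hc, hca⟩ := exists_normalize hpos
    refine ⟨c • a, hca, fun v => ?_⟩
    rw [hAC, hid, lrefl_smul hc.ne']; rfl
  · exfalso
    apply h3
    set d := lcross p a with hddef
    have hda : lform d a = 0 := lform_lcross_right p a
    have hfix : ∀ y, σ y = y → lform (E.vec y) a = 0 ∧ lform (E.vec y) d = 0 := by
      intro y hy
      have h4 : A (E.vec y) = E.vec y := by rw [← E.vec_apply, hy]
      have h5 : lrefl a (E.vec y) = lrefl d (E.vec y) := by
        conv_lhs => rw [← h4, hAC, lrefl_lrefl hpos.ne']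
        rw [hR]
      rw [lrefl_apply, lrefl_apply, sub_right_inj] at h5
      have h7 := congrArg (lform a) h5
      have h8 := congrArg (lform d) h5
      rw [lform_smul_right, lform_smul_right, lform_comm a d, hda] at h7
      rw [lform_smul_right, lform_smul_right, hda] at h8
      field_simp at h7 h8
      rw [mul_zero] at h7 h8
      exact ⟨(mul_eq_zero.1 h7).resolve_right hd.ne',
        (mul_eq_zero.1 h8.symm).resolve_left hpos.ne'⟩
    rcases Set.eq_empty_or_nonempty {y | σ y = y} with he | ⟨y₀, hy₀⟩
    · have : {y | σ y ≠ y} = univ := by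
        ext y
        simp only [Set.mem_ofPred_eq, Set.mem_univ, iff_true]
        intro hy
        have : y ∈ {y | σ y = y} := hy
        rw [he] at this; exact this
      rw [this]
      exact ConeConvex.isPreconnected E (fun _ _ _ _ _ _ _ _ _ _ => mem_univ _)
    · have : {y | σ y ≠ y} = {y₀}ᶜ := by
        ext y
        simp only [Set.mem_ofPred_eq, Set.mem_compl_iff, Set.mem_singleton_iff, not_iff_not]
        constructor
        · intro hy
          have f1 := hfix y hy
          have f2 := hfix y₀ hy₀
          exact E.injective (eq_of_lform_vec_eq (E.mem y) (E.mem y₀) hpos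
            (ne_zero_of_lform_self_ne hd.ne') (by rw [lform_comm, hda]) f1.1 f1.2 f2.1 f2.2)
        · rintro rfl; exact hy₀
      rw [this]
      exact E.isPreconnected_compl_singleton y₀

/-- An isometry fixing two independent vectors whose normal is not spacelike is the identity. -/
theorem eq_refl_of_fix_two {f : X ≃ᵢ X} {u w : LVec} (hu : E.lin f u = u) (hw : E.lin f w = w)
    (hd : lform (lcross u w) (lcross u w) ≤ 0) (hd0 : lcross u w ≠ 0) :
    f = IsometryEquiv.refl X := by
  ext x
  apply E.injective
  rw [E.vec_apply]
  change E.lin f (E.vec x) = E.vec x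
  set p := E.vec x
  have hpd : lform p (lcross u w) ≠ 0 := lform_ne_zero (E.mem x) hd hd0
  set d := lcross u w with hdd
  set y := E.lin f p - p with hy
  have h1 : lform y u = 0 := by
    rw [hy, lform_sub_left, ← E.lform_lin f p u, hu, sub_self]
  have h2 : lform y w = 0 := by
    rw [hy, lform_sub_left, ← E.lform_lin f p w, hw, sub_self]
  have h3 := lform_lcross_smul_eq u w p y
  rw [h1, h2, zero_smul, zero_smul, zero_add, zero_add, ← hdd, lform_comm d p] at h3
  have h4 : y = (lform y p / lform p d) • d := by
    apply smul_right_injective _ hpd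
    simp only
    rw [h3, smul_smul]; congr 1; field_simp
  set c := lform y p / lform p d
  have hyp : E.lin f p = p + c • d := by rw [← h4, hy]; abel
  have hm : E.lin f p ∈ hyperboloid := by rw [← E.vec_apply]; exact E.mem _
  have h5 := lform_le_neg_one (E.mem x) hm
  have h6 := hm.1
  rw [hyp] at h5 h6
  rw [lform_add_right, lform_smul_right, E.lform_self] at h5
  have hpp : lform p p = -1 := E.lform_self x
  simp only [lform_add_left, lform_add_right, lform_smul_left, lform_smul_right,
    lform_comm d p, hpp] at h6
  have h7 : c * lform p d = 0 := by
    have : c * (c * lform d d) ≤ 0 := by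
      nlinarith [mul_nonneg (mul_self_nonneg c) (neg_nonneg.2 hd)]
    change -1 + c * lform p d ≤ -1 at h5
    linarith
  rw [hyp, (mul_eq_zero.1 h7).resolve_right hpd, zero_smul, add_zero]

theorem eq_refl_of_fix_three {f : X ≃ᵢ X} {a b c : LVec} (ha : E.lin f a = a) (hb : E.lin f b = b)
    (hc : E.lin f c = c) (hd : lform (lcross a b) c ≠ 0) :
    f = IsometryEquiv.refl X := by
  apply E.eq_of_lin_eq
  intro v
  rw [E.lin_refl, ← sub_eq_zero]
  apply eq_zero_of_lform_eq_zero hd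
  · rw [lform_sub_left, ← E.lform_lin f v a, ha, sub_self]
  · rw [lform_sub_left, ← E.lform_lin f v b, hb, sub_self]
  · rw [lform_sub_left, ← E.lform_lin f v c, hc, sub_self]

/-! ### Regions and their boundary curves -/

/-- The set of points whose Lorentzian product with `u` is at most `s`. -/
def region (u : LVec) (s : ℝ) : Set X := {x | lform (E.vec x) u ≤ s}

/-- The set of points whose Lorentzian product with `u` is `s`. -/
def curve (u : LVec) (s : ℝ) : Set X := {x | lform (E.vec x) u = s}

theorem mem_region {u : LVec} {s : ℝ} {x : X} : x ∈ E.region u s ↔ lform (E.vec x) u ≤ s := Iff.rfl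

theorem mem_curve {u : LVec} {s : ℝ} {x : X} : x ∈ E.curve u s ↔ lform (E.vec x) u = s := Iff.rfl

theorem isClosed_region (u : LVec) (s : ℝ) : IsClosed (E.region u s) :=
  isClosed_le (E.continuous_lform_vec u) continuous_const

theorem isOpen_lform_lt (u : LVec) (s : ℝ) : IsOpen {x | lform (E.vec x) u < s} :=
  isOpen_lt (E.continuous_lform_vec u) continuous_const

theorem image_region (f : X ≃ᵢ X) (u : LVec) (s : ℝ) :
    f '' E.region u s = E.region (E.lin f u) s := by
  ext x
  constructor
  · rintro ⟨y, hy, rfl⟩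
    rw [mem_region, E.vec_apply, E.lform_lin]; exact hy
  · intro hx
    refine ⟨f.symm x, ?_, f.apply_symm_apply x⟩
    rw [mem_region, ← E.lform_lin f, ← E.vec_apply, f.apply_symm_apply]; exact hx

theorem closedBall_eq_region (p : X) {r : ℝ} (hr : 0 ≤ r) :
    closedBall p r = E.region (-E.vec p) (Real.cosh r) := by
  ext x
  rw [mem_closedBall, E.dist_le_real_iff hr, mem_region, lform_neg_right]
  constructor <;> intro h <;> linarith

/-- Through every point of a level curve there is a path crossing it transversally. -/
theorem exists_seq_lform_gt {u : LVec} (hu : lform u u = 1) (x : X) {O : Set X} (hO : IsOpen O)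
    (hx : x ∈ O) : ∃ y ∈ O, lform (E.vec x) u < lform (E.vec y) u := by
  set s := lform (E.vec x) u with hs
  have hpos : 0 < 1 + s ^ 2 := by positivity
  have hr := Real.sqrt_pos.2 hpos
  have hrr := Real.sq_sqrt hpos.le
  set w := (√(1 + s ^ 2))⁻¹ • (u + s • E.vec x) with hw
  have hxw : lform (E.vec x) w = 0 := by
    rw [hw, lform_smul_right, lform_add_right, lform_smul_right, E.lform_self, ← hs]; ring
  have hww : lform w w = 1 := by
    rw [hw]
    simp only [lform_smul_right, lform_smul_left, lform_add_right, lform_add_left, E.lform_self,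
      lform_comm u (E.vec x), hu]
    rw [← hs]; field_simp; rw [hrr]; ring
  have hwu : lform w u = √(1 + s ^ 2) := by
    rw [hw, lform_smul_left, lform_add_left, lform_smul_left, ← hs, hu]; field_simp; linarith
  choose γ hγ using fun τ => E.surj (cosh_smul_add_sinh_smul_mem (E.mem x) hxw hww τ)
  have hγc : Continuous γ := by
    rw [E.isInducing_vec.continuous_iff]
    have : E.vec ∘ γ = fun τ => Real.cosh τ • E.vec x + Real.sinh τ • w := funext hγ
    rw [this]
    exact (Real.continuous_cosh.smul continuous_const).add
      (Real.continuous_sinh.smul continuous_const)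
  have hγ0 : γ 0 = x := by apply E.injective; rw [hγ]; simp
  have hγu : ∀ τ, lform (E.vec (γ τ)) u = s * Real.cosh τ + √(1 + s ^ 2) * Real.sinh τ := by
    intro τ
    rw [hγ, lform_add_left, lform_smul_left, lform_smul_left, hwu, ← hs]; ring
  have hev : ∀ᶠ τ in nhdsWithin (0 : ℝ) (Ioi 0), γ τ ∈ O := by
    apply nhdsWithin_le_nhds
    apply hγc.continuousAt.eventually_mem
    rw [hγ0]; exact hO.mem_nhds hx
  obtain ⟨τ, hτO, hτ⟩ := (hev.and self_mem_nhdsWithin).exists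
  refine ⟨γ τ, hτO, ?_⟩
  rw [hγu]
  have h1 : |s| ≤ √(1 + s ^ 2) := Real.abs_le_sqrt (by linarith)
  have h2 := Real.sinh_pos_iff.2 (show (0 : ℝ) < τ from hτ)
  have h3 := Real.cosh_sq τ
  have h4 := Real.one_le_cosh τ
  rcases le_total 0 s with h0 | h0
  · have : 0 < √(1 + s ^ 2) * Real.sinh τ := by positivity
    nlinarith
  · rw [abs_of_nonpos h0] at h1
    have e1 : Real.cosh τ < 1 + Real.sinh τ := by nlinarith
    nlinarith

theorem interior_region {u : LVec} (hu : lform u u = 1) (s : ℝ) :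
    interior (E.region u s) = {x | lform (E.vec x) u < s} := by
  apply subset_antisymm
  · intro x hx
    obtain ⟨y, hy, hxy⟩ := E.exists_seq_lform_gt hu x isOpen_interior hx
    exact lt_of_lt_of_le hxy (E.mem_region.1 (interior_subset hy))
  · exact interior_maximal (fun x hx => E.mem_region.2 (le_of_lt hx)) (E.isOpen_lform_lt u s)

theorem frontier_region {u : LVec} (hu : lform u u = 1) (s : ℝ) :
    frontier (E.region u s) = E.curve u s := by
  rw [(E.isClosed_region u s).frontier_eq, E.interior_region hu]
  ext x
  simp only [Set.mem_sdiff, mem_region, Set.mem_ofPred_eq, mem_curve, not_lt]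
  exact ⟨fun h => le_antisymm h.1 h.2, fun h => ⟨h.le, h.ge⟩⟩

end HypChart

theorem lform_lcross_sq (a b c : LVec) : lform (lcross a b) c ^ 2 =
    -(lform a a * (lform b b * lform c c - lform b c ^ 2)
      - lform a b * (lform a b * lform c c - lform b c * lform a c)
      + lform a c * (lform a b * lform b c - lform b b * lform a c)) := by
  simp only [lform, lcross]; ring

theorem lcross_lcross (p v : LVec) :
    lcross p (lcross p v) = lform p p • v - lform p v • p := by
  ext <;> simp [lform, lcross] <;> ring

/-- Two orthogonal null vectors are proportional. -/
theorem exists_smul_of_null {n m p : LVec} (hp : p ∈ hyperboloid) (hn : lform n n = 0)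
    (hn0 : n ≠ 0) (hm : lform m m = 0) (h : lform n m = 0) : ∃ c : ℝ, m = c • n := by
  have hpn := lform_ne_zero hp hn.le hn0
  refine ⟨lform p m / lform p n, ?_⟩
  by_contra hne
  have := lform_self_pos (w := m - (lform p m / lform p n) • n) hp
    (by rw [lform_sub_right, lform_smul_right]; field_simp; ring) (sub_ne_zero.2 hne)
  simp [lform_sub_left, lform_sub_right, lform_smul_left, lform_smul_right, hn, hm, h,
    lform_comm m n] at this

namespace HypChart

variable (E : HypChart X)

theorem curve_neg (u : LVec) (s : ℝ) : E.curve (-u) s = E.curve u (-s) := by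
  ext x; rw [mem_curve, mem_curve, lform_neg_right]; constructor <;> intro h <;> linarith

theorem curve_zero_union {u : LVec} : E.curve u 0 = E.region u 0 ∩ E.region (-u) 0 := by
  ext x
  simp only [mem_curve, mem_inter_iff, mem_region, lform_neg_right]
  constructor
  · intro h; constructor <;> linarith
  · rintro ⟨h1, h2⟩; linarith

theorem isHalfspace_region {u : LVec} (hu : lform u u = 1) : IsHalfspace (E.region u 0) := by
  have hpos : 0 < lform u u := by rw [hu]; norm_num
  have h1 : E.lin (E.refl u hpos) u = -u := by
    rw [E.lin_reflection, lrefl_apply, hu]; module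
  refine ⟨E.refl u hpos, E.isReflection_refl hpos, E.isClosed_region u 0, ?_, ?_⟩
  · rw [E.image_region, h1]
    ext x
    simp only [mem_union, mem_region, lform_neg_right, mem_univ, iff_true]
    rcases le_total (lform (E.vec x) u) 0 with h | h
    · exact .inl h
    · right; linarith
  · rw [E.image_region, h1, ← curve_zero_union]
    ext x
    rw [mem_curve, ← lrefl_eq_self_iff hpos.ne', ← E.vec_refl hpos]
    exact E.injective.eq_iff

theorem exists_region_of_isHalfspace {P : Set X} (h : IsHalfspace P) :
    ∃ u : LVec, lform u u = 1 ∧ P = E.region u 0 := by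
  obtain ⟨σ, hσ, hcl, hun, hin⟩ := h
  obtain ⟨a, ha, hσa⟩ := E.exists_lrefl_of_isReflection hσ
  have hne : lform a a ≠ 0 := by rw [ha]; norm_num
  have hfix : ∀ x, σ x = x ↔ lform (E.vec x) a = 0 := by
    intro x
    rw [← lrefl_eq_self_iff hne, ← hσa, ← E.vec_apply]
    exact E.injective.eq_iff.symm
  have hσσ : ∀ x, σ (σ x) = x := fun x => by
    have := congrArg (fun g => g x) hσ.1; exact this
  have hmem : ∀ x, x ∈ σ '' P ↔ σ x ∈ P := by
    intro x
    constructor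
    · rintro ⟨y, hy, rfl⟩; rwa [hσσ]
    · intro h; exact ⟨σ x, h, hσσ x⟩
  have hσl : ∀ x, lform (E.vec (σ x)) a = -lform (E.vec x) a := by
    intro x
    rw [E.vec_apply, hσa, lrefl_apply, lform_sub_left, lform_smul_left, ha]; ring
  have hzero : ∀ x, lform (E.vec x) a = 0 → x ∈ P := by
    intro x hx
    have : x ∈ P ∩ σ '' P := by rw [hin]; exact (hfix x).2 hx
    exact this.1
  have hdis : ∀ x, x ∈ P → σ x ∈ P → lform (E.vec x) a = 0 := by
    intro x h1 h2
    have : x ∈ P ∩ σ '' P := ⟨h1, (hmem x).2 h2⟩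
    rw [hin] at this
    exact (hfix x).1 this
  have hor : ∀ x, x ∈ P ∨ σ x ∈ P := by
    intro x
    have : x ∈ P ∪ σ '' P := by rw [hun]; trivial
    rcases this with h | h
    · exact .inl h
    · exact .inr ((hmem x).1 h)
  have hU : IsPreconnected {x | 0 < lform (E.vec x) a} := by
    apply ConeConvex.isPreconnected E
    intro x hx y hy z α β hα hβ hz
    simp only [Set.mem_ofPred_eq] at hx hy ⊢
    have h0 : 0 ≤ lform (E.vec z) a := by
      rw [hz, lform_add_left, lform_smul_left, lform_smul_left]; positivity
    refine lt_of_le_of_ne h0 fun h => ?_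
    rw [hz, lform_add_left, lform_smul_left, lform_smul_left] at h
    have e1 : α = 0 := by
      by_contra hc
      have := mul_pos (lt_of_le_of_ne hα (Ne.symm hc)) hx
      have := mul_nonneg hβ hy.le; linarith
    have e2 : β = 0 := by
      by_contra hc
      have := mul_pos (lt_of_le_of_ne hβ (Ne.symm hc)) hy
      have := mul_nonneg hα hx.le; linarith
    apply ne_zero_of_mem_hyperboloid (E.mem z)
    rw [hz, e1, e2]; simp
  have hcase := (isPreconnected_iff_subset_of_disjoint_closed.1 hU) P (σ ⁻¹' P) hcl
    (hcl.preimage σ.continuous) (fun x _ => hor x) (by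
      ext x
      simp only [mem_inter_iff, Set.mem_ofPred_eq, mem_preimage, mem_empty_iff_false, iff_false]
      rintro ⟨h1, h2, h3⟩
      exact h1.ne' (hdis x h2 h3))
  rcases hcase with hc | hc
  · refine ⟨-a, by rw [lform_neg_left, lform_neg_right, neg_neg, ha], ?_⟩
    ext x
    rw [mem_region, lform_neg_right]
    constructor
    · intro hx
      by_contra hlt
      have h1 : σ x ∈ P := hc (show 0 < lform (E.vec (σ x)) a by rw [hσl]; linarith)
      have := hdis x hx h1
      linarith
    · intro h0
      rcases (show 0 ≤ lform (E.vec x) a by linarith).lt_or_eq with h | h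
      · exact hc h
      · exact hzero x h.symm
  · refine ⟨a, ha, ?_⟩
    ext x
    rw [mem_region]
    constructor
    · intro hx
      by_contra hlt
      have h1 : σ x ∈ P := hc (show 0 < lform (E.vec x) a by linarith)
      have := hdis x hx h1
      linarith
    · intro h0
      rcases h0.lt_or_eq with h | h
      · have : σ (σ x) ∈ P := hc (show 0 < lform (E.vec (σ x)) a by rw [hσl]; linarith)
        rwa [hσσ] at this
      · exact hzero x h

/-- The Gram determinant inequality for two points and a unit normal vector. -/
theorem gram_le (x y : X) {u : LVec} (hu : lform u u = 1) :
    lform (E.vec x) u ^ 2 + lform (E.vec y) u ^ 2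
      - 2 * Real.cosh (dist x y) * (lform (E.vec x) u * lform (E.vec y) u) + 1
      ≤ Real.cosh (dist x y) ^ 2 := by
  have h := lform_lcross_sq (E.vec x) (E.vec y) u
  rw [E.lform_self, E.lform_self, hu, E.lform_eq] at h
  nlinarith [sq_nonneg (lform (lcross (E.vec x) (E.vec y)) u)]

/-- The foot of the perpendicular from a point to a line. -/
theorem exists_foot (x : X) {u : LVec} (hu : lform u u = 1) :
    ∃ y, lform (E.vec y) u = 0 ∧ Real.cosh (dist x y) = √(1 + lform (E.vec x) u ^ 2) := by
  set s := lform (E.vec x) u with hs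
  have hpos : 0 < 1 + s ^ 2 := by positivity
  have hr := Real.sqrt_pos.2 hpos
  have hrr := Real.sq_sqrt hpos.le
  have hxv : lform (E.vec x) ((√(1 + s ^ 2))⁻¹ • (E.vec x - s • u)) = -√(1 + s ^ 2) := by
    rw [lform_smul_right, lform_sub_right, lform_smul_right, E.lform_self, ← hs]
    field_simp; linarith
  have hmem : (√(1 + s ^ 2))⁻¹ • (E.vec x - s • u) ∈ hyperboloid := by
    apply mem_hyperboloid_of_lform_neg (E.mem x)
    · simp only [lform_smul_right, lform_smul_left, lform_sub_right, lform_sub_left, E.lform_self,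
        lform_comm u (E.vec x), hu]
      rw [← hs]; field_simp; rw [hrr]; ring
    · rw [hxv]; linarith
  obtain ⟨y, hy⟩ := E.surj hmem
  refine ⟨y, ?_, ?_⟩
  · rw [hy, lform_smul_left, lform_sub_left, lform_smul_left, hu, ← hs]; ring
  · rw [E.cosh_dist, hy, hxv, neg_neg]

theorem infDist_region_le_iff {u : LVec} (hu : lform u u = 1) {l : ℝ} (hl : 0 ≤ l) (x : X) :
    infDist x (E.region u 0) ≤ l ↔ lform (E.vec x) u ≤ Real.sinh l := by
  obtain ⟨y, hy, hxy⟩ := E.exists_foot x hu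
  have hyr : y ∈ E.region u 0 := hy.le
  have hsl := Real.sinh_nonneg_iff.2 hl
  constructor
  · intro h
    by_contra hlt
    push Not at hlt
    have h2 : Real.arsinh (lform (E.vec x) u) ≤ infDist x (E.region u 0) := by
      rw [le_infDist ⟨y, hyr⟩]
      intro z hz
      rw [← Real.sinh_le_sinh, Real.sinh_arsinh]
      have hg := E.gram_le x z hu
      rw [Real.cosh_sq] at hg
      have h3 : 0 ≤ -(lform (E.vec x) u * lform (E.vec z) u) := by
        rw [← mul_neg]; exact mul_nonneg (by linarith) (neg_nonneg.2 hz)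
      have h4 := mul_nonneg (Real.cosh_pos (dist x z)).le h3
      apply le_of_sq_le_sq _ (Real.sinh_nonneg_iff.2 dist_nonneg)
      nlinarith [sq_nonneg (lform (E.vec z) u)]
    have h3 := h2.trans h
    rw [← Real.sinh_le_sinh, Real.sinh_arsinh] at h3
    linarith
  · intro h
    rcases le_total (lform (E.vec x) u) 0 with h0 | h0
    · rw [infDist_zero_of_mem (show x ∈ E.region u 0 from h0)]; exact hl
    · refine (infDist_le_dist_of_mem hyr).trans ?_
      rw [← abs_of_nonneg (dist_nonneg (x := x) (y := y)), ← abs_of_nonneg hl, ← Real.cosh_le_cosh,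
        hxy, Real.sqrt_le_iff, Real.cosh_sq]
      refine ⟨(Real.cosh_pos l).le, ?_⟩
      nlinarith

theorem setOf_infDist_region {u : LVec} (hu : lform u u = 1) {l : ℝ} (hl : 0 ≤ l) :
    {x | infDist x (E.region u 0) ≤ l} = E.region u (Real.sinh l) := by
  ext x; exact E.infDist_region_le_iff hu hl x

theorem parallelDomain_curve {u : LVec} (hu : lform u u = 1) {l : ℝ} (hl : 0 ≤ l) :
    parallelDomain (E.curve u 0) l = E.region u (Real.sinh l) ∩ E.region (-u) (Real.sinh l) := by
  ext x
  obtain ⟨y, hy, hxy⟩ := E.exists_foot x hu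
  have hyr : y ∈ E.curve u 0 := hy
  have hsl := Real.sinh_nonneg_iff.2 hl
  have key : infDist x (E.curve u 0) ≤ l ↔ |lform (E.vec x) u| ≤ Real.sinh l := by
    constructor
    · intro h
      have h2 : Real.arsinh |lform (E.vec x) u| ≤ infDist x (E.curve u 0) := by
        rw [le_infDist ⟨y, hyr⟩]
        intro z hz
        rw [← Real.sinh_le_sinh, Real.sinh_arsinh]
        have hg := E.gram_le x z hu
        rw [Real.cosh_sq, E.mem_curve.1 hz] at hg
        apply abs_le_of_sq_le_sq _ (Real.sinh_nonneg_iff.2 dist_nonneg)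
        linarith
      have h3 := h2.trans h
      rwa [← Real.sinh_le_sinh, Real.sinh_arsinh] at h3
    · intro h
      refine (infDist_le_dist_of_mem hyr).trans ?_
      rw [← abs_of_nonneg (dist_nonneg (x := x) (y := y)), ← abs_of_nonneg hl, ← Real.cosh_le_cosh,
        hxy, Real.sqrt_le_iff, Real.cosh_sq]
      refine ⟨(Real.cosh_pos l).le, ?_⟩
      have := sq_abs (lform (E.vec x) u)
      nlinarith [abs_nonneg (lform (E.vec x) u)]
  change infDist x (E.curve u 0) ≤ l ↔ _
  rw [key, abs_le, mem_inter_iff, mem_region, mem_region, lform_neg_right]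
  constructor <;> rintro ⟨h1, h2⟩ <;> constructor <;> linarith

theorem isHypercycleOrLine_iff {C : Set X} :
    IsHypercycleOrLine C ↔ ∃ (u : LVec) (s : ℝ), lform u u = 1 ∧ 0 ≤ s ∧ C = E.curve u s := by
  constructor
  · rintro ⟨P, l, hP, hl, rfl⟩
    obtain ⟨u, hu, rfl⟩ := E.exists_region_of_isHalfspace hP
    refine ⟨u, Real.sinh l, hu, Real.sinh_nonneg_iff.2 hl, ?_⟩
    rw [E.setOf_infDist_region hu hl, E.frontier_region hu]
  · rintro ⟨u, s, hu, hs, rfl⟩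
    refine ⟨E.region u 0, Real.arsinh s, E.isHalfspace_region hu, Real.arsinh_nonneg_iff.2 hs, ?_⟩
    rw [E.setOf_infDist_region hu (Real.arsinh_nonneg_iff.2 hs), E.frontier_region hu,
      Real.sinh_arsinh]

theorem hypercycleWithBase_iff {C B : Set X} :
    HypercycleWithBase C B ↔ ∃ (u : LVec) (s : ℝ), lform u u = 1 ∧ 0 ≤ s ∧ B = E.curve u 0 ∧
      C = E.curve u s := by
  constructor
  · rintro ⟨P, l, hP, hl, rfl, rfl⟩
    obtain ⟨u, hu, rfl⟩ := E.exists_region_of_isHalfspace hP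
    refine ⟨u, Real.sinh l, hu, Real.sinh_nonneg_iff.2 hl, E.frontier_region hu 0, ?_⟩
    rw [E.setOf_infDist_region hu hl, E.frontier_region hu]
  · rintro ⟨u, s, hu, hs, rfl, rfl⟩
    refine ⟨E.region u 0, Real.arsinh s, E.isHalfspace_region hu, Real.arsinh_nonneg_iff.2 hs,
      E.frontier_region hu 0, ?_⟩
    rw [E.setOf_infDist_region hu (Real.arsinh_nonneg_iff.2 hs), E.frontier_region hu,
      Real.sinh_arsinh]

end HypChart

namespace HypChart

variable (E : HypChart X)

theorem exists_frame {γ : ℝ → X} (hγ : Isometry γ) :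
    ∃ p w : LVec, p ∈ hyperboloid ∧ lform p w = 0 ∧ lform w w = 1 ∧
      ∀ t, E.vec (γ t) = Real.cosh t • p + Real.sinh t • w := by
  have hs : 0 < Real.sinh 1 := Real.sinh_pos_iff.2 one_pos
  have hd : ∀ s t : ℝ, lform (E.vec (γ s)) (E.vec (γ t)) = -Real.cosh (s - t) := by
    intro s t
    rw [E.lform_eq, hγ.dist_eq, Real.dist_eq, Real.cosh_abs]
  have hp := hd 0 0
  have hpq := hd 0 1
  have hqq := hd 1 1
  have hcs := Real.cosh_sq 1
  rw [sub_self, Real.cosh_zero] at hp hqq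
  rw [zero_sub, Real.cosh_neg] at hpq
  set p := E.vec (γ 0) with hpdef
  set q := E.vec (γ 1) with hqdef
  have hpw : lform p ((Real.sinh 1)⁻¹ • (q - Real.cosh 1 • p)) = 0 := by
    rw [lform_smul_right, lform_sub_right, lform_smul_right, hpq, hp]; ring
  have hww : lform ((Real.sinh 1)⁻¹ • (q - Real.cosh 1 • p))
      ((Real.sinh 1)⁻¹ • (q - Real.cosh 1 • p)) = 1 := by
    simp only [lform_smul_left, lform_smul_right, lform_sub_left, lform_sub_right,
      lform_comm q p, hpq, hp, hqq]
    field_simp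
    linarith
  refine ⟨p, (Real.sinh 1)⁻¹ • (q - Real.cosh 1 • p), E.mem _, hpw, hww, fun t => ?_⟩
  apply eq_of_lform_eq_neg_one (E.mem _) (cosh_smul_add_sinh_smul_mem (E.mem _) hpw hww t)
  have h0 := hd t 0
  have h1 := hd t 1
  rw [Real.cosh_sub] at h1
  rw [sub_zero] at h0
  rw [← hqdef] at h1
  simp only [lform_add_right, lform_smul_right, lform_sub_right, hpdef, h0, h1]
  field_simp
  have := Real.cosh_sq t
  linear_combination (-Real.sinh 1) * this

theorem range_eq_curve {γ : ℝ → X} {p w : LVec} (hp : p ∈ hyperboloid) (hpw : lform p w = 0)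
    (hw : lform w w = 1) (h : ∀ t, E.vec (γ t) = Real.cosh t • p + Real.sinh t • w) :
    Set.range γ = E.curve (lcross p w) 0 := by
  ext x
  rw [mem_curve]
  constructor
  · rintro ⟨t, rfl⟩
    rw [h, lform_comm, lform_add_right, lform_smul_right, lform_smul_right, lform_lcross_left,
      lform_lcross_right]
    ring
  · intro hx
    have hm := lform_mul_eq p w (E.vec x)
    rw [hx, lform_lcross_lcross, hpw, hw, hp.1] at hm
    have hmx : E.vec x = (-lform (E.vec x) p) • p + lform (E.vec x) w • w := by
      have : E.vec x = (0 ^ 2 - -1 * 1 : ℝ) • E.vec x := by norm_num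
      exact this.trans (hm.trans (by module))
    have hxx := congrArg (lform (E.vec x)) hmx
    rw [E.lform_self, lform_add_right, lform_smul_right, lform_smul_right] at hxx
    have hle := lform_le_neg_one (E.mem x) hp
    refine ⟨Real.arsinh (lform (E.vec x) w), E.injective ?_⟩
    have : √(1 + lform (E.vec x) w ^ 2) = -lform (E.vec x) p := by
      rw [show 1 + lform (E.vec x) w ^ 2 = (-lform (E.vec x) p) ^ 2 by linarith]
      exact Real.sqrt_sq (by linarith)
    rw [h, Real.sinh_arsinh, Real.cosh_arsinh, this]
    exact hmx.symm

theorem isGeodesicLine_iff {B : Set X} :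
    IsGeodesicLine B ↔ ∃ u : LVec, lform u u = 1 ∧ B = E.curve u 0 := by
  constructor
  · rintro ⟨γ, hγ, rfl⟩
    obtain ⟨p, w, hp, hpw, hw, h⟩ := E.exists_frame hγ
    refine ⟨lcross p w, ?_, E.range_eq_curve hp hpw hw h⟩
    rw [lform_lcross_lcross, hpw, hw, hp.1]; norm_num
  · rintro ⟨u, hu, rfl⟩
    obtain ⟨p, hpu⟩ := E.exists_pt_perp (u := u) (by rw [hu]; norm_num)
    have hpw : lform (E.vec p) (lcross (E.vec p) u) = 0 := by
      rw [lform_comm, lform_lcross_left]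
    have hw : lform (lcross (E.vec p) u) (lcross (E.vec p) u) = 1 := by
      rw [lform_lcross_lcross, hpu, hu, E.lform_self]; norm_num
    choose γ h using fun t : ℝ => E.surj (cosh_smul_add_sinh_smul_mem (E.mem p) hpw hw t)
    have hc : lcross (E.vec p) (lcross (E.vec p) u) = -u := by
      rw [lcross_lcross, hpu, E.lform_self]; module
    refine ⟨γ, Isometry.of_dist_eq fun s t => ?_, ?_⟩
    · have : Real.cosh (dist (γ s) (γ t)) = Real.cosh (dist s t) := by
        rw [E.cosh_dist, h, h, Real.dist_eq, Real.cosh_abs, Real.cosh_sub]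
        simp only [lform_add_left, lform_add_right, lform_smul_left, lform_smul_right, hpw,
          E.lform_self, hw, lform_comm (lcross (E.vec p) u) (E.vec p)]
        ring
      exact Real.cosh_strictMonoOn.injOn dist_nonneg dist_nonneg this
    · rw [E.range_eq_curve (E.mem p) hpw hw h, hc, curve_neg, neg_zero]

theorem exists_region_of_isParaball {K : Set X} (hK : IsParaball K) :
    ∃ n : LVec, lform n n = 0 ∧ n ≠ 0 ∧ K = E.region n 1 := by
  obtain ⟨γ, hγ, rfl⟩ := hK
  obtain ⟨p, w, hp, hpw, hw, h⟩ := E.exists_frame hγ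
  have hn : lform (p + w) (p + w) = 0 := by
    simp only [lform_add_left, lform_add_right, hpw, hw, hp.1, lform_comm w p]; ring
  have hpn : lform p (p + w) = -1 := by rw [lform_add_right, hp.1, hpw]; ring
  have hn0 : p + w ≠ 0 := by
    intro h0; rw [h0, lform_zero_right] at hpn; norm_num at hpn
  refine ⟨-(p + w), by rw [lform_neg_left, lform_neg_right, neg_neg, hn], neg_ne_zero.2 hn0, ?_⟩
  have hA : ∀ x : X, lform (E.vec x) (p + w) < 0 := by
    have hfut : 0 < (p + w).2.2 := by
      by_contra hle
      have hw2 : lform p (-(p + w)) < 0 ∨ (p + w).2.2 = 0 := by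
        rcases (not_lt.1 hle).lt_or_eq with h | h
        · left
          exact lform_neg_of_future hp (by rw [lform_neg_left, lform_neg_right, hn]; norm_num)
            (show 0 < -(p + w).2.2 by linarith)
        · exact .inr h
      rcases hw2 with h2 | h2
      · rw [lform_neg_right, hpn] at h2; norm_num at h2
      · apply hn0
        have : (p + w).1 * (p + w).1 + (p + w).2.1 * (p + w).2.1
          - (p + w).2.2 * (p + w).2.2 = 0 := hn
        rw [h2] at this
        have e1 : (p + w).1 = 0 := by nlinarith [sq_nonneg (p + w).1, sq_nonneg (p + w).2.1]
        have e2 : (p + w).2.1 = 0 := by nlinarith [sq_nonneg (p + w).1, sq_nonneg (p + w).2.1]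
        exact Prod.ext e1 (Prod.ext e2 h2)
    exact fun x => lform_neg_of_future (E.mem x) hn.le hfut
  have hlim : ∀ x : X, Tendsto (fun t => dist x (γ t) - t) atTop
      (nhds (Real.log (-lform (E.vec x) (p + w)))) := by
    intro x
    have hA' : 0 < -lform (E.vec x) (p + w) := by linarith [hA x]
    set A := -lform (E.vec x) (p + w) with hAdef
    set C := -lform (E.vec x) (p - w) with hCdef
    have hexp : ∀ t, Real.exp (dist x (γ t) - t) =
        A + C * Real.exp (-2 * t) - Real.exp (-dist x (γ t) - t) := by
      intro t
      have h1 := E.cosh_dist x (γ t)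
      rw [h, lform_add_right, lform_smul_right, lform_smul_right, Real.cosh_eq, Real.cosh_eq,
        Real.sinh_eq] at h1
      have e1 : Real.exp (dist x (γ t) - t) = Real.exp (dist x (γ t)) * Real.exp (-t) := by
        rw [← Real.exp_add]; ring_nf
      have e2 : Real.exp (-dist x (γ t) - t) = Real.exp (-dist x (γ t)) * Real.exp (-t) := by
        rw [← Real.exp_add]; ring_nf
      have e3 : Real.exp (-2 * t) = Real.exp (-t) * Real.exp (-t) := by
        rw [← Real.exp_add]; ring_nf
      have e4 : Real.exp t * Real.exp (-t) = 1 := by rw [← Real.exp_add]; simp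
      rw [e1, e2, e3, hAdef, hCdef, lform_add_right, lform_sub_right]
      linear_combination 2 * Real.exp (-t) * h1
        + (-lform (E.vec x) p - lform (E.vec x) w) * e4
    have hl : Tendsto (fun t => Real.exp (dist x (γ t) - t)) atTop (nhds A) := by
      simp_rw [hexp]
      have t1 : Tendsto (fun t : ℝ => Real.exp (-2 * t)) atTop (nhds 0) :=
        Real.tendsto_exp_atBot.comp (tendsto_id.const_mul_atTop_of_neg (by norm_num))
      have t2 : Tendsto (fun t : ℝ => Real.exp (-dist x (γ t) - t)) atTop (nhds 0) := by
        refine squeeze_zero (fun t => (Real.exp_pos _).le) (fun t => ?_)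
          (Real.tendsto_exp_atBot.comp tendsto_neg_atTop_atBot)
        exact Real.exp_le_exp.2 (by linarith [dist_nonneg (x := x) (y := γ t)])
      simpa using (tendsto_const_nhds.add (t1.const_mul C)).sub t2
    have := (Real.continuousAt_log hA'.ne').tendsto.comp hl
    simpa [Function.comp_def] using this
  ext x
  rw [mem_region, lform_neg_right]
  have hA' : 0 < -lform (E.vec x) (p + w) := by linarith [hA x]
  constructor
  · rintro ⟨b, hb, hx⟩
    have := tendsto_nhds_unique hx (hlim x)
    rw [this] at hb
    exact (Real.log_nonpos_iff hA'.le).1 hb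
  · intro hx
    exact ⟨_, (Real.log_nonpos_iff hA'.le).2 hx, hlim x⟩

end HypChart

theorem lform_null_sign {n : LVec} (hn : lform n n = 0) (hn0 : n ≠ 0) :
    (∀ p ∈ hyperboloid, lform p n < 0) ∨ (∀ p ∈ hyperboloid, 0 < lform p n) := by
  rcases lt_trichotomy n.2.2 0 with h | h | h
  · right
    intro p hp
    have := lform_neg_of_future (w := -n) hp
      (by rw [lform_neg_left, lform_neg_right, neg_neg, hn]) (show 0 < -n.2.2 by linarith)
    rw [lform_neg_right] at this; linarith
  · refine absurd ?_ hn0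
    have : n.1 * n.1 + n.2.1 * n.2.1 - n.2.2 * n.2.2 = 0 := hn
    rw [h] at this
    have e1 : n.1 = 0 := by nlinarith [sq_nonneg n.1, sq_nonneg n.2.1]
    have e2 : n.2.1 = 0 := by nlinarith [sq_nonneg n.1, sq_nonneg n.2.1]
    exact Prod.ext e1 (Prod.ext e2 h)
  · left
    exact fun p hp => lform_neg_of_future hp hn.le h

namespace HypChart

variable (E : HypChart X)

theorem axiallySymmetric_of_lrefl {S : Set X} {a : LVec} (ha : 0 < lform a a)
    (h : E.refl a ha '' S = S) : AxiallySymmetric S :=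
  ⟨E.refl a ha, E.isReflection_refl ha, h⟩

theorem axiallySymmetric_inter {u v a : LVec} (ha : 0 < lform a a) (hu : lform u a = 0)
    (hv : lform v a = 0) (s t : ℝ) : AxiallySymmetric (E.region u s ∩ E.region v t) := by
  refine E.axiallySymmetric_of_lrefl ha ?_
  rw [image_inter (E.refl a ha).injective, E.image_region, E.image_region, E.lin_reflection,
    E.lin_reflection, lrefl_eq_self hu, lrefl_eq_self hv]

theorem axiallySymmetric_region {u : LVec} (hu : lform u u = 1) (s : ℝ) :
    AxiallySymmetric (E.region u s) := by
  obtain ⟨p, hp⟩ := E.exists_pt_perp (u := u) (by rw [hu]; norm_num)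
  have := E.axiallySymmetric_inter (u := u) (v := u) (a := lcross (E.vec p) u)
    (by rw [lform_lcross_lcross, hp, hu, E.lform_self]; norm_num)
    (by rw [lform_comm, lform_lcross_right]) (by rw [lform_comm, lform_lcross_right]) s s
  rwa [inter_self] at this

theorem axiallySymmetric_closedBall_inter (p : X) {r : ℝ} (hr : 0 ≤ r) (w : LVec) (s : ℝ) :
    AxiallySymmetric (closedBall p r ∩ E.region w s) := by
  obtain ⟨a, ha, hp, hw⟩ := exists_spacelike_normal (E.mem p) w
  rw [E.closedBall_eq_region p hr]
  exact E.axiallySymmetric_inter ha (by rw [lform_neg_left, hp, neg_zero]) hw _ _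

theorem axiallySymmetric_null_inter_null {n m : LVec} (hn : lform n n = 0) (hn0 : n ≠ 0)
    (hm : lform m m = 0) (s t : ℝ) :
    AxiallySymmetric (E.region n s ∩ E.region m t) := by
  by_cases h : lform n m = 0
  · obtain ⟨c, rfl⟩ := exists_smul_of_null origin_mem_hyperboloid hn hn0 hm h
    have ho := lform_ne_zero origin_mem_hyperboloid hn.le hn0
    have hc : lform n (lcross n (0, 0, 1)) = 0 := by rw [lform_comm, lform_lcross_left]
    refine E.axiallySymmetric_inter (a := lcross n (0, 0, 1)) ?_ hc ?_ s t
    · rw [lform_lcross_lcross, hn, lform_comm, zero_mul, sub_zero]; positivity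
    · rw [lform_smul_left, hc, mul_zero]
  · refine E.axiallySymmetric_inter (a := lcross n m) ?_ ?_ ?_ s t
    · rw [lform_lcross_lcross, hn, zero_mul, sub_zero]; positivity
    · rw [lform_comm, lform_lcross_left]
    · rw [lform_comm, lform_lcross_right]

theorem axiallySymmetric_region_inter_region {u v : LVec} (hu : lform u u = 1)
    (hv : lform v v = 1) (s : ℝ) : AxiallySymmetric (E.region u s ∩ E.region v s) := by
  have huv : lform (u - v) (u - v) = 2 - 2 * lform u v := by
    simp only [lform_sub_left, lform_sub_right, hu, hv, lform_comm v u]; ring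
  rcases lt_trichotomy (lform u v) 1 with h | h | h
  · have hpos : 0 < lform (u - v) (u - v) := by linarith
    refine E.axiallySymmetric_of_lrefl hpos ?_
    rw [image_inter (E.refl _ hpos).injective, E.image_region, E.image_region, E.lin_reflection,
      E.lin_reflection, lrefl_sub (by rw [hu, hv]) hpos.ne',
      lrefl_sub' (by rw [hu, hv]) hpos.ne', inter_comm]
  · by_cases he : u = v
    · rw [he, inter_self]; exact E.axiallySymmetric_region hv s
    · have hn : lform (u - v) (u - v) = 0 := by rw [huv, h]; ring
      rcases lform_null_sign hn (sub_ne_zero.2 he) with h' | h'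
      · rw [inter_eq_right.2]
        · exact E.axiallySymmetric_region hv s
        · intro x hx
          have := h' _ (E.mem x)
          rw [mem_region] at hx ⊢
          rw [lform_sub_right] at this
          linarith
      · rw [inter_eq_left.2]
        · exact E.axiallySymmetric_region hu s
        · intro x hx
          have := h' _ (E.mem x)
          rw [mem_region] at hx ⊢
          rw [lform_sub_right] at this
          linarith
  · refine E.axiallySymmetric_inter (a := lcross u v) ?_ ?_ ?_ s s
    · rw [lform_lcross_lcross, hu, hv]; nlinarith
    · rw [lform_comm, lform_lcross_left]
    · rw [lform_comm, lform_lcross_right]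

/-- The strip around the line orthogonal to `u`. -/
def strip (u : LVec) (s : ℝ) : Set X := E.region u s ∩ E.region (-u) s

theorem image_strip (f : X ≃ᵢ X) (u : LVec) (s : ℝ) :
    f '' E.strip u s = E.strip (E.lin f u) s := by
  rw [strip, image_inter f.injective, E.image_region, E.image_region, map_neg, strip]

theorem strip_neg (u : LVec) (s : ℝ) : E.strip (-u) s = E.strip u s := by
  rw [strip, neg_neg, inter_comm, strip]

theorem axiallySymmetric_strip_inter_strip {u v : LVec} (hu : lform u u = 1)
    (hv : lform v v = 1) (s : ℝ) : AxiallySymmetric (E.strip u s ∩ E.strip v s) := by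
  wlog h : lform u v ≤ 0 generalizing v
  · rw [← E.strip_neg v]
    exact this (by rw [lform_neg_left, lform_neg_right, neg_neg, hv])
      (by rw [lform_neg_right]; linarith)
  have hpos : 0 < lform (u - v) (u - v) := by
    simp only [lform_sub_left, lform_sub_right, hu, hv, lform_comm v u]; linarith
  refine E.axiallySymmetric_of_lrefl hpos ?_
  rw [image_inter (E.refl _ hpos).injective, E.image_strip, E.image_strip, E.lin_reflection,
      E.lin_reflection, lrefl_sub (by rw [hu, hv]) hpos.ne',
      lrefl_sub' (by rw [hu, hv]) hpos.ne', inter_comm]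

theorem axiallySymmetric_null_inter_strip {n u : LVec} (hn : lform n n = 0)
    (hu : lform u u = 1) (r s : ℝ) : AxiallySymmetric (E.region n r ∩ E.strip u s) := by
  by_cases h : lform n u = 0
  · have hpos : 0 < lform u u := by rw [hu]; norm_num
    refine E.axiallySymmetric_of_lrefl hpos ?_
    rw [image_inter (E.refl _ hpos).injective, E.image_strip, E.image_region, E.lin_reflection,
      E.lin_reflection, lrefl_eq_self h]
    have : lrefl u u = -u := by rw [lrefl_apply, hu]; module
    rw [this, strip_neg]
  · have hpos : 0 < lform (lcross n u) (lcross n u) := by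
      rw [lform_lcross_lcross, hn, zero_mul, sub_zero]; positivity
    refine E.axiallySymmetric_of_lrefl hpos ?_
    rw [image_inter (E.refl _ hpos).injective, E.image_strip, E.image_region, E.lin_reflection,
      E.lin_reflection, lrefl_eq_self (by rw [lform_comm, lform_lcross_left]),
      lrefl_eq_self (by rw [lform_comm, lform_lcross_right])]

theorem lform_lin_self {f : X ≃ᵢ X} {u : LVec} {c : ℝ} (h : lform u u = c) :
    lform (E.lin f u) (E.lin f u) = c := by rw [E.lform_lin, h]

theorem exists_strip_of_isParallelDomain {K : Set X} (hK : IsParallelDomain K) :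
    ∃ (u : LVec) (s : ℝ), lform u u = 1 ∧ K = E.strip u s := by
  obtain ⟨B, l, hB, hl, rfl⟩ := hK
  obtain ⟨u, hu, rfl⟩ := E.isGeodesicLine_iff.1 hB
  exact ⟨u, Real.sinh l, hu, E.parallelDomain_curve hu hl.le⟩

theorem isParallelDomain_strip {u : LVec} (hu : lform u u = 1) {s : ℝ} (hs : 0 < s) :
    IsParallelDomain (E.strip u s) := by
  refine ⟨E.curve u 0, Real.arsinh s, E.isGeodesicLine_iff.2 ⟨u, hu, rfl⟩,
    Real.arsinh_pos_iff.2 hs, ?_⟩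
  rw [E.parallelDomain_curve hu (Real.arsinh_nonneg_iff.2 hs.le), Real.sinh_arsinh, strip]

theorem exists_region_of_hypercycleDomain_or_halfspace {K : Set X}
    (hK : IsHypercycleDomain K ∨ IsHalfspace K) :
    ∃ (u : LVec) (s : ℝ), lform u u = 1 ∧ K = E.region u s := by
  rcases hK with ⟨P, l, hP, hl, rfl⟩ | h
  · obtain ⟨u, hu, rfl⟩ := E.exists_region_of_isHalfspace hP
    exact ⟨u, Real.sinh l, hu, E.setOf_infDist_region hu hl.le⟩
  · obtain ⟨u, hu, rfl⟩ := E.exists_region_of_isHalfspace h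
    exact ⟨u, 0, hu, rfl⟩

theorem hypercycleDomain_or_halfspace_region {u : LVec} (hu : lform u u = 1) {s : ℝ}
    (hs : 0 ≤ s) : IsHypercycleDomain (E.region u s) ∨ IsHalfspace (E.region u s) := by
  rcases hs.eq_or_lt with rfl | hs
  · exact .inr (E.isHalfspace_region hu)
  · left
    refine ⟨E.region u 0, Real.arsinh s, E.isHalfspace_region hu, Real.arsinh_pos_iff.2 hs, ?_⟩
    rw [E.setOf_infDist_region hu (Real.arsinh_nonneg_iff.2 hs.le), Real.sinh_arsinh]

theorem exists_region_of_caseABody (E : HypChart X) {K : Set X} (hK : CaseABody K) :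
    ∃ (w : LVec) (s : ℝ), K = E.region w s := by
  rcases hK with ⟨p, r, hr, rfl⟩ | h | h
  · exact ⟨_, _, E.closedBall_eq_region p hr.le⟩
  · obtain ⟨n, -, -, h⟩ := E.exists_region_of_isParaball h
    exact ⟨n, 1, h⟩
  · obtain ⟨u, s, -, h⟩ := E.exists_region_of_hypercycleDomain_or_halfspace h
    exact ⟨u, s, h⟩

theorem axiallySymmetric_disc_inter {K L : Set X} (hK : IsDisc K) {w : LVec} {s : ℝ}
    (hL : L = E.region w s) (f g : X ≃ᵢ X) : AxiallySymmetric (f '' K ∩ g '' L) := by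
  obtain ⟨p, r, hr, rfl⟩ := hK
  rw [hL, f.image_closedBall, E.image_region]
  exact E.axiallySymmetric_closedBall_inter _ hr.le _ _

theorem axiallySymmetric_of_congruent (E : HypChart X) {K L : Set X}
    (hK : IsHypercycleDomain K ∨ IsHalfspace K) (h : Congruent K L) (f g : X ≃ᵢ X) :
    AxiallySymmetric (f '' K ∩ g '' L) := by
  obtain ⟨u, s, hu, rfl⟩ := E.exists_region_of_hypercycleDomain_or_halfspace hK
  obtain ⟨k, rfl⟩ := h
  simp only [E.image_region]
  exact E.axiallySymmetric_region_inter_region (E.lform_lin_self hu)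
    (E.lform_lin_self (E.lform_lin_self hu)) s

theorem axiallySymmetric_of_caseA (E : HypChart X) {K L : Set X} (h : CaseA K L)
    (f g : X ≃ᵢ X) :
    AxiallySymmetric (f '' K ∩ g '' L) := by
  obtain ⟨hK, hL, h1, h2⟩ := h
  obtain ⟨w, s, hKr⟩ := E.exists_region_of_caseABody hK
  obtain ⟨w', s', hLr⟩ := E.exists_region_of_caseABody hL
  rcases hK with hK | hK | hK
  · exact E.axiallySymmetric_disc_inter hK hLr f g
  · rcases hL with hL | hL | hL
    · rw [inter_comm]
      exact E.axiallySymmetric_disc_inter hL hKr g f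
    · obtain ⟨n, hn, hn0, rfl⟩ := E.exists_region_of_isParaball hK
      obtain ⟨m, hm, hm0, rfl⟩ := E.exists_region_of_isParaball hL
      rw [E.image_region, E.image_region]
      exact E.axiallySymmetric_null_inter_null (E.lform_lin_self hn)
        ((E.lin f).map_ne_zero_iff.2 hn0) (E.lform_lin_self hm) _ _
    · rw [inter_comm]
      rcases h2 hL with h | h
      · rw [inter_comm]
        exact E.axiallySymmetric_disc_inter h hLr f g
      · exact E.axiallySymmetric_of_congruent hL h g f
  · rcases h1 hK with h | h
    · rw [inter_comm]
      exact E.axiallySymmetric_disc_inter h hKr g f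
    · exact E.axiallySymmetric_of_congruent hK h f g

theorem axiallySymmetric_paraball_inter (E : HypChart X) {K L : Set X} (hK : IsParaball K)
    (hL : IsParallelDomain L) (f g : X ≃ᵢ X) : AxiallySymmetric (f '' K ∩ g '' L) := by
  obtain ⟨n, hn, hn0, rfl⟩ := E.exists_region_of_isParaball hK
  obtain ⟨u, s, hu, rfl⟩ := E.exists_strip_of_isParallelDomain hL
  rw [E.image_region, E.image_strip]
  exact E.axiallySymmetric_null_inter_strip (E.lform_lin_self hn) (E.lform_lin_self hu) _ _

theorem axiallySymmetric_of_caseD (E : HypChart X) {K L : Set X} (h : CaseD K L)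
    (f g : X ≃ᵢ X) :
    AxiallySymmetric (f '' K ∩ g '' L) := by
  rcases h with ⟨hK, hL⟩ | ⟨hL, hK⟩
  · exact E.axiallySymmetric_paraball_inter hK hL f g
  · rw [inter_comm]; exact E.axiallySymmetric_paraball_inter hL hK g f

theorem axiallySymmetric_of_caseE (E : HypChart X) {K L : Set X} (h : CaseE K L)
    (f g : X ≃ᵢ X) :
    AxiallySymmetric (f '' K ∩ g '' L) := by
  obtain ⟨⟨k, rfl⟩, hK, -⟩ := h
  obtain ⟨u, s, hu, rfl⟩ := E.exists_strip_of_isParallelDomain hK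
  simp only [E.image_strip]
  exact E.axiallySymmetric_strip_inter_strip (E.lform_lin_self hu)
    (E.lform_lin_self (E.lform_lin_self hu)) s

end HypChart

namespace HypChart

variable (E : HypChart X)

theorem coneConvex_segment (x y : X) :
    E.ConeConvex {z | ∃ α β : ℝ, 0 ≤ α ∧ 0 ≤ β ∧ E.vec z = α • E.vec x + β • E.vec y} := by
  rintro a ⟨α, β, hα, hβ, ha⟩ b ⟨α', β', hα', hβ', hb⟩ z μ ν hμ hν hz
  refine ⟨μ * α + ν * α', μ * β + ν * β', by positivity, by positivity, ?_⟩
  rw [hz, ha, hb]; module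

theorem eq_of_vec_eq_smul {x y : X} {c : ℝ} (hc : 0 ≤ c) (h : E.vec x = c • E.vec y) : x = y := by
  have h1 := E.lform_self x
  rw [h, lform_smul_left, lform_smul_right, E.lform_self] at h1
  have h2 : c = 1 := by nlinarith
  rw [h2, one_smul] at h
  exact E.injective h

/-- A segment from an interior point of a closed set to a point outside meets the frontier. -/
theorem exists_frontier_combo {K : Set X} (hK : IsClosed K) {o y : X} (ho : o ∈ interior K)
    (hy : y ∉ K) : ∃ z ∈ frontier K, ∃ α β : ℝ, 0 < α ∧ 0 < β ∧ α + β < 1 ∧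
      E.vec z = α • E.vec o + β • E.vec y := by
  have hS := ConeConvex.isPreconnected E (E.coneConvex_segment o y)
  have : ∃ z ∈ frontier K, ∃ α β : ℝ, 0 ≤ α ∧ 0 ≤ β ∧
      E.vec z = α • E.vec o + β • E.vec y := by
    by_contra! hne
    obtain ⟨z, -, h1, h2⟩ := hS (interior K) Kᶜ isOpen_interior hK.isOpen_compl
      (by
        rintro z ⟨α, β, hα, hβ, hz⟩
        by_contra hc
        rw [mem_union, not_or, mem_compl_iff, not_not] at hc
        refine hne z ?_ α β hα hβ hz
        rw [hK.frontier_eq]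
        exact ⟨hc.2, hc.1⟩)
      ⟨o, ⟨1, 0, by norm_num, by norm_num, by simp⟩, ho⟩
      ⟨y, ⟨0, 1, by norm_num, by norm_num, by simp⟩, hy⟩
    exact h2 (interior_subset h1)
  obtain ⟨z, hz, α, β, hα, hβ, h⟩ := this
  rw [hK.frontier_eq] at hz
  have hα' : 0 < α := by
    refine lt_of_le_of_ne hα fun h0 => hy ?_
    rw [← h0, zero_smul, zero_add] at h
    rw [← E.eq_of_vec_eq_smul hβ h]; exact hz.1
  have hβ' : 0 < β := by
    refine lt_of_le_of_ne hβ fun h0 => hz.2 ?_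
    rw [← h0, zero_smul, add_zero] at h
    rw [E.eq_of_vec_eq_smul hα h]; exact ho
  refine ⟨z, by rw [hK.frontier_eq]; exact hz, α, β, hα', hβ', ?_, h⟩
  have h1 := E.combo_sq h
  have hoy : dist o y ≠ 0 := dist_ne_zero.2 fun h => hy (h ▸ interior_subset ho)
  have h2 := Real.one_lt_cosh.2 hoy
  have h3 := mul_pos hα' hβ'
  nlinarith [h3, mul_lt_mul_of_pos_left h2 h3]

/-- A supporting vector at a frontier point of a convex set. -/
theorem exists_support {K : Set X} (hcv : GConvex K) (hint : (interior K).Nonempty) {c : X}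
    (hc : c ∉ interior K) :
    ∃ w : LVec, w ≠ 0 ∧ lform (E.vec c) w = 0 ∧ ∀ x ∈ K, lform (E.vec x) w ≤ 0 := by
  have hconv := ConeConvex.convex_klein E (hcv.coneConvex E)
  have hcn : E.klein c ∉ interior (E.klein '' K) := by
    intro h
    apply hc
    rw [mem_interior_iff_mem_nhds] at h ⊢
    have := E.continuous_klein.continuousAt.preimage_mem_nhds h
    rwa [E.isOpenEmbedding_klein.injective.preimage_image] at this
  have hsub : E.klein '' interior K ⊆ interior (E.klein '' K) :=
    interior_maximal (image_mono interior_subset)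
      (E.isOpenEmbedding_klein.isOpenMap _ isOpen_interior)
  obtain ⟨f, hf⟩ := geometric_hahn_banach_open_point hconv.interior isOpen_interior hcn
  have hne : (interior (E.klein '' K)).Nonempty := (hint.image _).mono hsub
  have hle : ∀ x ∈ K, f (E.klein x) ≤ f (E.klein c) := by
    intro x hx
    have h1 : E.klein x ∈ closure (interior (E.klein '' K)) := by
      rw [hconv.closure_interior_eq_closure_of_nonempty_interior hne]
      exact subset_closure ⟨x, hx, rfl⟩
    exact closure_minimal (fun a ha => (hf a ha).le)
      (isClosed_le f.continuous continuous_const) h1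
  have hform : ∀ x, lform (E.vec x) (f (1, 0), f (0, 1), f (E.klein c)) =
      (E.vec x).2.2 * (f (E.klein x) - f (E.klein c)) := by
    intro x
    have hpos := (E.mem x).2
    have h1 : E.klein x = ((E.vec x).1 / (E.vec x).2.2) • ((1, 0) : ℝ × ℝ)
        + ((E.vec x).2.1 / (E.vec x).2.2) • ((0, 1) : ℝ × ℝ) := by simp [klein]
    have h2 : f (E.klein x) = (E.vec x).1 / (E.vec x).2.2 * f (1, 0)
        + (E.vec x).2.1 / (E.vec x).2.2 * f (0, 1) := by
      rw [h1, map_add, map_smul, map_smul, smul_eq_mul, smul_eq_mul]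
    rw [h2]
    simp only [lform]
    field_simp
  refine ⟨(f (1, 0), f (0, 1), f (E.klein c)), ?_, ?_, ?_⟩
  · intro h0
    obtain ⟨x, hx⟩ := hint
    have h1 := hform x
    rw [h0, lform_zero_right] at h1
    have h2 := hf _ (hsub ⟨x, hx, rfl⟩)
    have h3 := (E.mem x).2
    have := mul_neg_of_pos_of_neg h3 (sub_neg.2 h2)
    linarith
  · rw [hform, sub_self, mul_zero]
  · intro x hx
    rw [hform]
    exact mul_nonpos_of_nonneg_of_nonpos (E.mem x).2.le (sub_nonpos.2 (hle x hx))

/-- The hypercycle through `c` parametrized by hyperbolic functions. -/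
theorem exists_curve_pt {u : LVec} (hu : lform u u = 1) (c : X) (τ : ℝ) :
    ∃ x : X, E.vec x = lform (E.vec c) u • u
      + Real.cosh τ • (E.vec c - lform (E.vec c) u • u)
      + Real.sinh τ • lcross (E.vec c) u ∧ lform (E.vec x) u = lform (E.vec c) u := by
  set s := lform (E.vec c) u with hs
  have hcu : lform u (E.vec c) = s := by rw [lform_comm]
  have hcc := E.lform_self c
  have e1 : lform (lcross (E.vec c) u) (lcross (E.vec c) u) = s ^ 2 + 1 := by
    rw [lform_lcross_lcross, ← hs, hu, hcc]; ring
  have e2 := lform_lcross_left (E.vec c) u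
  have e3 := lform_lcross_right (E.vec c) u
  have e4 : lform (E.vec c) (lcross (E.vec c) u) = 0 := by rw [lform_comm, e2]
  have e5 : lform u (lcross (E.vec c) u) = 0 := by rw [lform_comm, e3]
  have hct := Real.cosh_sq τ
  have h1 := Real.one_le_cosh τ
  obtain ⟨x, hx⟩ := E.surj (v := s • u + Real.cosh τ • (E.vec c - s • u)
      + Real.sinh τ • lcross (E.vec c) u)
    (mem_hyperboloid_of_lform_neg (E.mem c) (by
      simp only [lform_add_left, lform_add_right, lform_sub_left, lform_sub_right,
        lform_smul_left, lform_smul_right, e1, e2, e3, e4, e5, hcu, ← hs, hcc, hu]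
      linear_combination (-1 - s ^ 2) * hct) (by
      simp only [lform_add_right, lform_sub_right, lform_smul_right, e4, ← hs, hcc]
      nlinarith [sq_nonneg s]))
  refine ⟨x, hx, ?_⟩
  rw [hx]
  simp only [lform_add_left, lform_sub_left, lform_smul_left, e3, ← hs, hu]
  ring

/-- The supporting vector along a hypercycle. -/
theorem exists_smul_of_support {u w : LVec} (hu : lform u u = 1) {c : X}
    (hcw : lform (E.vec c) w = 0)
    (h : ∀ x ∈ E.curve u (lform (E.vec c) u), lform (E.vec x) w ≤ 0) :
    ∃ k : ℝ, w = k • (u + lform (E.vec c) u • E.vec c) := by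
  set s := lform (E.vec c) u with hs
  have hτ : ∀ τ : ℝ, (1 - Real.cosh τ) * (s * lform u w)
      + Real.sinh τ * lform (lcross (E.vec c) u) w ≤ 0 := by
    intro τ
    obtain ⟨x, hx, hxu⟩ := E.exists_curve_pt hu c τ
    have := h x hxu
    rw [hx] at this
    simp only [lform_add_left, lform_sub_left, lform_smul_left, hcw, ← hs] at this
    linarith
  have htan : lform (lcross (E.vec c) u) w = 0 := by
    have hmax : IsLocalMax (fun τ : ℝ => (1 - Real.cosh τ) * (s * lform u w)
        + Real.sinh τ * lform (lcross (E.vec c) u) w) 0 := by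
      refine Filter.Eventually.of_forall fun τ => ?_
      simpa using hτ τ
    have hd : HasDerivAt (fun τ : ℝ => (1 - Real.cosh τ) * (s * lform u w)
        + Real.sinh τ * lform (lcross (E.vec c) u) w)
        ((0 - Real.sinh 0) * (s * lform u w)
          + Real.cosh 0 * lform (lcross (E.vec c) u) w) 0 :=
      ((((hasDerivAt_const (0 : ℝ) (1 : ℝ)).sub (Real.hasDerivAt_cosh 0)).mul_const _)).add
        ((Real.hasDerivAt_sinh 0).mul_const _)
    have := hmax.hasDerivAt_eq_zero hd
    simpa using this
  have hm := lform_mul_eq (E.vec c) u w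
  rw [lform_lcross_lcross, ← hs, hu, E.lform_self, lform_comm w (lcross _ _), htan,
    lform_comm w (E.vec c), hcw] at hm
  have hpos : (s ^ 2 + 1 : ℝ) ≠ 0 := by positivity
  refine ⟨lform w u / (s ^ 2 + 1), ?_⟩
  have : w = (s ^ 2 + 1)⁻¹ • ((s ^ 2 - -1 * 1 : ℝ) • w) := by
    rw [smul_smul, show (s ^ 2 - -1 * 1 : ℝ) = s ^ 2 + 1 by ring, inv_mul_cancel₀ hpos, one_smul]
  rw [this, hm]
  simp only [div_eq_inv_mul]
  have : lform ((s ^ 2 + 1)⁻¹ • ((0 : ℝ) • lcross (E.vec c) u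
      + (s * lform w u - 1 * 0) • E.vec c + (s * 0 - -1 * lform w u) • u)) u = lform w u := by
    rw [← hm, ← this]
  rw [this]
  module

/-- A convex set having a hypercycle in its frontier lies on its convex side. -/
theorem subset_region_of_curve_subset_frontier {K : Set X} (hcl : IsClosed K) (hcv : GConvex K)
    (hint : (interior K).Nonempty) {u : LVec} (hu : lform u u = 1) {s : ℝ} (hs : 0 ≤ s)
    (hK : E.curve u s ⊆ frontier K) :
    K ⊆ E.region u s ∨ (s = 0 ∧ K ⊆ E.region (-u) 0) := by
  have key : ∀ c ∈ E.curve u s, ∃ k : ℝ, k ≠ 0 ∧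
      ∀ x ∈ K, k * (lform (E.vec x) u + s * lform (E.vec x) (E.vec c)) ≤ 0 := by
    intro c hc
    have hcf := hK hc
    rw [hcl.frontier_eq] at hcf
    obtain ⟨w, hw0, hcw, hw⟩ := E.exists_support hcv hint hcf.2
    rw [mem_curve] at hc
    obtain ⟨k, hk⟩ := E.exists_smul_of_support hu hcw (by
      rw [hc]; exact fun x hx => hw x (hcl.frontier_subset (hK hx)))
    rw [hc] at hk
    refine ⟨k, ?_, fun x hx => ?_⟩
    · rintro rfl; exact hw0 (by rw [hk, zero_smul])
    · have := hw x hx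
      rwa [hk, lform_smul_right, lform_add_right, lform_smul_right] at this
  rcases hs.eq_or_lt with h0 | h0
  · obtain ⟨c, hc⟩ := E.exists_pt_lform_eq hu s
    obtain ⟨k, hk, h⟩ := key c hc
    subst h0
    simp only [zero_mul, add_zero] at h
    rcases hk.lt_or_gt with hk | hk
    · right
      refine ⟨rfl, fun x hx => ?_⟩
      rw [mem_region, lform_neg_right]
      nlinarith [h x hx]
    · left
      intro x hx
      rw [mem_region]
      nlinarith [h x hx]
  · left
    intro x hx
    rw [mem_region]
    by_contra! hlt
    set b := lform (E.vec x) u with hb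
    set k := √((1 + s ^ 2) / (1 + b ^ 2)) with hkdef
    have hk2 : k ^ 2 * (1 + b ^ 2) = 1 + s ^ 2 := by
      rw [hkdef, Real.sq_sqrt (by positivity)]; field_simp
    have hk0 : 0 < k := Real.sqrt_pos.2 (by positivity)
    have hux : lform u (E.vec x) = b := by rw [lform_comm]
    have hsb : s * b < k * (1 + b ^ 2) := by
      nlinarith [mul_pos hk0 (show (0 : ℝ) < 1 + b ^ 2 by positivity)]
    obtain ⟨c, hc⟩ := E.surj (v := s • u + k • (E.vec x - b • u))
      (mem_hyperboloid_of_lform_neg (E.mem x) (by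
        simp only [lform_add_left, lform_add_right, lform_sub_left, lform_sub_right,
          lform_smul_left, lform_smul_right, hux, ← hb, hu, E.lform_self]
        linear_combination (-1) * hk2) (by
        simp only [lform_add_right, lform_sub_right, lform_smul_right, ← hb, E.lform_self]
        nlinarith))
    have hcu : c ∈ E.curve u s := by
      rw [mem_curve, hc]
      simp only [lform_add_left, lform_sub_left, lform_smul_left, ← hb, hu]; ring
    obtain ⟨κ, hκ, h⟩ := key c hcu
    have hxc : lform (E.vec x) (E.vec c) = s * b - k * (1 + b ^ 2) := by
      rw [hc]
      simp only [lform_add_right, lform_sub_right, lform_smul_right, ← hb, E.lform_self]; ring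
    rcases hκ.lt_or_gt with hκ | hκ
    · obtain ⟨c', hc', hcu'⟩ := E.exists_curve_pt hu c 1
      rw [mem_curve] at hcu
      have h1 := h c' (hcl.frontier_subset (hK (hcu'.trans hcu)))
      have h2 : lform (E.vec c') (E.vec c) = s ^ 2 - Real.cosh 1 * (1 + s ^ 2) := by
        rw [hc']
        simp only [lform_add_left, lform_sub_left, lform_smul_left, lform_lcross_left,
          lform_comm u, hcu, E.lform_self]
        ring
      rw [hcu', hcu, h2] at h1
      have h3 : 1 < Real.cosh 1 := Real.one_lt_cosh.2 one_ne_zero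
      have h4 : s + s * (s ^ 2 - Real.cosh 1 * (1 + s ^ 2)) < 0 := by
        have : s + s * (s ^ 2 - Real.cosh 1 * (1 + s ^ 2))
          = s * (1 + s ^ 2) * (1 - Real.cosh 1) := by ring
        rw [this]
        exact mul_neg_of_pos_of_neg (by positivity) (by linarith)
      nlinarith [mul_pos_of_neg_of_neg hκ h4]
    · have h1 := h x hx
      rw [← hb, hxc] at h1
      have h2 : b + s * (s * b - k * (1 + b ^ 2)) ≤ 0 := by
        by_contra! hc; nlinarith [mul_pos hκ hc]
      have h3 : b * (1 + s ^ 2) ≤ s * (k * (1 + b ^ 2)) := by linarith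
      have hb0 : 0 < b := h0.trans hlt
      have h4 : (b * (1 + s ^ 2)) ^ 2 ≤ (s * (k * (1 + b ^ 2))) ^ 2 :=
        pow_le_pow_left₀ (by positivity) h3 2
      have h5 : (s * (k * (1 + b ^ 2))) ^ 2 = s ^ 2 * (1 + s ^ 2) * (1 + b ^ 2) := by
        linear_combination s ^ 2 * (1 + b ^ 2) * hk2
      rw [h5] at h4
      have h6 : (1 + s ^ 2) * (b ^ 2 * (1 + s ^ 2)) ≤ (1 + s ^ 2) * (s ^ 2 * (1 + b ^ 2)) := by
        linarith
      have h7 := le_of_mul_le_mul_left h6 (by positivity)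
      nlinarith

end HypChart

namespace HypChart

variable (E : HypChart X)

theorem lform_lt_of_mem_interior {K : Set X} {o : X} (ho : o ∈ interior K) {u : LVec}
    (hu : lform u u = 1) {s : ℝ} (h : K ⊆ E.region u s) : lform (E.vec o) u < s := by
  have := interior_mono h ho
  rwa [E.interior_region hu] at this

/-- A closed convex set is cut out by the hypercycles covering its frontier. -/
theorem eq_iInter_region {K : Set X} (hcl : IsClosed K) (hint : (interior K).Nonempty)
    {F : Set (LVec × ℝ)} (hF : ∀ i ∈ F, lform i.1 i.1 = 1 ∧ 0 ≤ i.2 ∧ K ⊆ E.region i.1 i.2)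
    (hfr : ∀ x ∈ frontier K, ∃ i ∈ F, x ∈ E.curve i.1 i.2) :
    K = {x | ∀ i ∈ F, lform (E.vec x) i.1 ≤ i.2} := by
  obtain ⟨o, ho⟩ := hint
  apply Subset.antisymm
  · exact fun x hx i hi => (hF i hi).2.2 hx
  · intro y hy
    by_contra hyK
    obtain ⟨z, hz, α, β, hα, hβ, hαβ, h⟩ := E.exists_frontier_combo hcl ho hyK
    obtain ⟨i, hi, hzi⟩ := hfr z hz
    obtain ⟨hu, hs, hK⟩ := hF i hi
    have h1 := E.lform_lt_of_mem_interior ho hu hK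
    have h2 := hy i hi
    rw [mem_curve, h, lform_add_left, lform_smul_left, lform_smul_left] at hzi
    nlinarith [mul_lt_mul_of_pos_left h1 hα, mul_le_mul_of_nonneg_left h2 hβ.le,
      mul_nonneg (sub_nonneg.2 hαβ.le) hs]

theorem eq_or_eq_neg_of_curve_eq {u v : LVec} (hu : lform u u = 1) (hv : lform v v = 1)
    (h : E.curve u 0 = E.curve v 0) : v = u ∨ v = -u := by
  obtain ⟨p, hp⟩ := E.exists_pt_lform_eq hu 0
  have hpv : p ∈ E.curve v 0 := h ▸ hp
  obtain ⟨k, hk⟩ := E.exists_smul_of_support hu hpv (by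
    rw [hp, h]; exact fun x hx => le_of_eq hx)
  rw [hp, zero_smul, add_zero] at hk
  rw [hk, lform_smul_left, lform_smul_right, hu] at hv
  have : (k - 1) * (k + 1) = 0 := by linarith
  rcases mul_eq_zero.1 this with h1 | h1
  · left; rw [hk, sub_eq_zero.1 h1, one_smul]
  · right; rw [hk, eq_neg_of_add_eq_zero_left h1, neg_one_smul]

theorem exists_region_of_curve_subset_frontier {K : Set X} (hcl : IsClosed K) (hcv : GConvex K)
    (hint : (interior K).Nonempty) {u : LVec} (hu : lform u u = 1) {s : ℝ} (hs : 0 ≤ s)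
    (hK : E.curve u s ⊆ frontier K) :
    ∃ v : LVec, (v = u ∨ v = -u) ∧ lform v v = 1 ∧ E.curve u s = E.curve v s ∧
      K ⊆ E.region v s := by
  rcases E.subset_region_of_curve_subset_frontier hcl hcv hint hu hs hK with h | ⟨rfl, h⟩
  · exact ⟨u, .inl rfl, hu, rfl, h⟩
  · exact ⟨-u, .inr rfl, by rw [lform_neg_left, lform_neg_right, neg_neg, hu],
      by rw [curve_neg, neg_zero], h⟩

theorem exists_regions_of_twoHypSameBase {L : Set X} (hcl : IsClosed L) (hcv : GConvex L)
    (hint : (interior L).Nonempty) (h : TwoHypSameBase L) :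
    ∃ (u : LVec) (v : LVec) (s t : ℝ), (v = u ∨ v = -u) ∧
      L = E.region u s ∩ E.region v t := by
  obtain ⟨B, C₁, C₂, -, -, h₁, h₂, hfr⟩ := h
  obtain ⟨u, s, hu, hs, hBu, rfl⟩ := E.hypercycleWithBase_iff.1 h₁
  obtain ⟨v, t, hv, ht, hBv, rfl⟩ := E.hypercycleWithBase_iff.1 h₂
  have huv := E.eq_or_eq_neg_of_curve_eq hu hv (hBu.symm.trans hBv)
  obtain ⟨u', hu'u, hu', huc, hLu⟩ := E.exists_region_of_curve_subset_frontier hcl hcv hint hu hs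
    (hfr ▸ subset_union_left)
  obtain ⟨v', hv'v, hv', hvc, hLv⟩ := E.exists_region_of_curve_subset_frontier hcl hcv hint hv ht
    (hfr ▸ subset_union_right)
  refine ⟨u', v', s, t, ?_, ?_⟩
  · rcases huv with rfl | rfl <;> rcases hu'u with rfl | rfl <;> rcases hv'v with rfl | rfl <;>
      simp
  · have := E.eq_iInter_region hcl hint (F := {(u', s), (v', t)}) (by
      rintro i (rfl | rfl)
      · exact ⟨hu', hs, hLu⟩
      · exact ⟨hv', ht, hLv⟩) (by
      intro x hx
      rw [hfr, huc, hvc] at hx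
      rcases hx with hx | hx
      · exact ⟨_, .inl rfl, hx⟩
      · exact ⟨_, .inr rfl, hx⟩)
    rw [this]
    ext x
    simp [mem_region]

theorem axiallySymmetric_disc_inter_twoHyp (E : HypChart X) {K L : Set X} (hcl : IsClosed L)
    (hcv : GConvex L) (hint : (interior L).Nonempty) (hK : IsDisc K) (hL : TwoHypSameBase L)
    (f g : X ≃ᵢ X) : AxiallySymmetric (f '' K ∩ g '' L) := by
  obtain ⟨u, v, s, t, huv, rfl⟩ := E.exists_regions_of_twoHypSameBase hcl hcv hint hL
  obtain ⟨p, r, hr, rfl⟩ := hK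
  rw [f.image_closedBall, image_inter g.injective, E.image_region, E.image_region]
  obtain ⟨a, ha, hp, hw⟩ := exists_spacelike_normal (E.mem (f p)) (E.lin g u)
  have hv : lform (E.lin g v) a = 0 := by
    rcases huv with rfl | rfl
    · exact hw
    · rw [map_neg, lform_neg_left, hw, neg_zero]
  rw [E.closedBall_eq_region _ hr.le]
  refine E.axiallySymmetric_of_lrefl ha ?_
  rw [image_inter (E.refl _ ha).injective, image_inter (E.refl _ ha).injective, E.image_region,
    E.image_region, E.image_region, E.lin_reflection, E.lin_reflection, E.lin_reflection,
    lrefl_eq_self hw, lrefl_eq_self hv,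
    lrefl_eq_self (by rw [lform_neg_left, hp, neg_zero])]

theorem closedBall_inter_eq_of_multiHyp {L : Set X} (hcl : IsClosed L) (hcv : GConvex L)
    {q : X} {r : ℝ} (hr : 0 < r) (hint : (interior (closedBall q r ∩ L)).Nonempty)
    (hL : MultiHypFarApart L r) :
    ∃ (w : LVec) (s : ℝ), closedBall q r ∩ L = closedBall q r ∩ E.region w s := by
  by_cases hsub : closedBall q r ⊆ L
  · exact ⟨-E.vec q, Real.cosh r, by
      rw [← E.closedBall_eq_region q hr.le, inter_self, inter_eq_left.2 hsub]⟩
  obtain ⟨o, ho⟩ := hint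
  have hoL : o ∈ interior L := interior_mono inter_subset_right ho
  have hoB : o ∈ closedBall q r := (interior_subset ho).1
  have key : ∀ y ∈ closedBall q r, y ∉ L → ∃ z ∈ frontier L, dist z q < r ∧
      ∀ (u : LVec) (s : ℝ), 0 ≤ s → lform (E.vec o) u < s → lform (E.vec y) u ≤ s →
        lform (E.vec z) u < s := by
    intro y hy hyL
    obtain ⟨z, hz, α, β, hα, hβ, hαβ, h⟩ := E.exists_frontier_combo hcl hoL hyL
    refine ⟨z, hz, ?_, ?_⟩
    · rw [mem_closedBall, E.dist_le_real_iff hr.le] at hy hoB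
      rw [E.dist_lt_real_iff hr.le, h, lform_add_left, lform_smul_left, lform_smul_left]
      have := Real.cosh_pos r
      nlinarith
    · intro u s hs h1 h2
      rw [h, lform_add_left, lform_smul_left, lform_smul_left]
      nlinarith [mul_lt_mul_of_pos_left h1 hα, mul_le_mul_of_nonneg_left h2 hβ.le,
        mul_nonneg (sub_nonneg.2 hαβ.le) hs]
  obtain ⟨y₀, hy₀, hy₀L⟩ := not_subset.1 hsub
  obtain ⟨z₀, hz₀, hz₀r, -⟩ := key y₀ hy₀ hy₀L
  obtain ⟨u, s, hu, hs, hC⟩ := E.isHypercycleOrLine_iff.1 (hL.1 z₀ hz₀)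
  obtain ⟨v, -, hv, hc, hLv⟩ := E.exists_region_of_curve_subset_frontier hcl hcv ⟨o, hoL⟩ hu hs
    (hC ▸ connectedComponentIn_subset _ _)
  refine ⟨v, s, Subset.antisymm (inter_subset_inter_right _ hLv) ?_⟩
  rintro y ⟨hy, hyv⟩
  refine ⟨hy, ?_⟩
  by_contra hyL
  obtain ⟨z, hz, hzr, hlt⟩ := key y hy hyL
  have hzv := hlt v s hs (E.lform_lt_of_mem_interior hoL hv hLv) hyv
  have hne : connectedComponentIn (frontier L) z₀ ≠ connectedComponentIn (frontier L) z := by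
    intro he
    have : z ∈ E.curve v s := by
      rw [← hc, ← hC, he]; exact mem_connectedComponentIn hz
    rw [mem_curve] at this
    linarith
  have h1 := (hL.2.2 z₀ hz₀ z hz hne).1
  have h2 := dist_triangle_right z₀ z q
  linarith

theorem axiallySymmetric_closedBall_inter_multiHyp (E : HypChart X) {L : Set X}
    (hcl : IsClosed L) (hcv : GConvex L) {p : X} {r : ℝ} (hr : 0 < r)
    (hL : MultiHypFarApart L r) (f g : X ≃ᵢ X)
    (hint : (interior (f '' closedBall p r ∩ g '' L)).Nonempty) :
    AxiallySymmetric (f '' closedBall p r ∩ g '' L) := by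
  have heq : f '' closedBall p r ∩ g '' L = g '' (closedBall (g.symm (f p)) r ∩ L) := by
    rw [image_inter g.injective, f.image_closedBall, g.image_closedBall, g.apply_symm_apply]
  rw [heq] at hint ⊢
  have hint' : (interior (closedBall (g.symm (f p)) r ∩ L)).Nonempty := by
    have := g.toHomeomorph.image_interior (closedBall (g.symm (f p)) r ∩ L)
    simp only [IsometryEquiv.coe_toHomeomorph] at this
    rw [← this] at hint
    exact hint.of_image
  obtain ⟨w, s, h⟩ := E.closedBall_inter_eq_of_multiHyp hcl hcv hr hint' hL
  rw [h, image_inter g.injective, g.image_closedBall, E.image_region]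
  exact E.axiallySymmetric_closedBall_inter _ hr.le _ _

/-- The sufficiency part: each of the listed cases forces axial symmetry. -/
theorem t5Cond2_of_cases (E : HypChart X) {K L : Set X} (hKcl : IsClosed K) (hLcl : IsClosed L)
    (hKcv : GConvex K) (hLcv : GConvex L) (hKint : (interior K).Nonempty)
    (hLint : (interior L).Nonempty) (h : Theorem5Cases K L) : T5Cond2 K L := by
  intro f g _ _ hint
  rcases h with h | h | h | h | h
  · exact E.axiallySymmetric_of_caseA h f g
  · rcases h with ⟨hK, hL⟩ | ⟨hL, hK⟩
    · exact E.axiallySymmetric_disc_inter_twoHyp hLcl hLcv hLint hK hL f g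
    · rw [inter_comm]
      exact E.axiallySymmetric_disc_inter_twoHyp hKcl hKcv hKint hL hK g f
  · rcases h with ⟨p, r, hr, rfl, hL⟩ | ⟨p, r, hr, rfl, hK⟩
    · exact E.axiallySymmetric_closedBall_inter_multiHyp hLcl hLcv hr hL f g hint
    · rw [inter_comm] at hint ⊢
      exact E.axiallySymmetric_closedBall_inter_multiHyp hKcl hKcv hr hK g f hint
  · exact E.axiallySymmetric_of_caseD h f g
  · exact E.axiallySymmetric_of_caseE h f g

end HypChart

theorem T5Cond2.t5Cond1 {K L : Set X} (h : T5Cond2 K L) : T5Cond1 K L := by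
  intro f g hf hg hint
  obtain ⟨σ, hσ, hS⟩ := h f g hf hg hint
  exact ⟨σ, hσ.2.1, hS⟩

theorem OrientationPreserving.refl : OrientationPreserving (IsometryEquiv.refl X) :=
  ⟨[], by simp, by simp, rfl⟩

theorem OrientationPreserving.trans {f g : X ≃ᵢ X} (hf : OrientationPreserving f)
    (hg : OrientationPreserving g) : OrientationPreserving (f.trans g) := by
  obtain ⟨l, hl, hle, rfl⟩ := hf
  obtain ⟨m, hm, hme, rfl⟩ := hg
  refine ⟨l ++ m, ?_, ?_, ?_⟩
  · intro σ hσ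
    rcases List.mem_append.1 hσ with h | h
    · exact hl σ h
    · exact hm σ h
  · rw [List.length_append]; exact hle.add hme
  · rw [List.foldr_append]
    clear hl hle hm hme
    induction l with
    | nil => rfl
    | cons a l ih =>
      rw [List.foldr_cons, List.foldr_cons, ← ih]
      rfl

theorem IsReflection.trans {σ τ : X ≃ᵢ X} (hσ : IsReflection σ) (hτ : IsReflection τ) :
    OrientationPreserving (σ.trans τ) := by
  refine ⟨[σ, τ], ?_, by simp, ?_⟩
  · intro ρ hρ
    rcases List.mem_pair.1 hρ with rfl | rfl
    · exact hσ
    · exact hτ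
  · rfl

theorem eq_smul_of_lcross_eq_zero {u v : LVec} (hu : lform u u = 1) (h : lcross u v = 0) :
    v = lform u v • u := by
  have := lcross_lcross u v
  rw [h, hu, one_smul] at this
  have h0 : lcross u 0 = 0 := by simp [lcross]
  rw [h0] at this
  exact (sub_eq_zero.1 this.symm)

theorem lcross_ne_zero {u v : LVec} (hu : lform u u = 1) (hv : lform v v = 1) (h1 : v ≠ u)
    (h2 : v ≠ -u) : lcross u v ≠ 0 := by
  intro h
  have h3 := eq_smul_of_lcross_eq_zero hu h
  set k := lform u v
  rw [h3, lform_smul_left, lform_smul_right, hu] at hv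
  have : (k - 1) * (k + 1) = 0 := by linarith
  rcases mul_eq_zero.1 this with h | h
  · exact h1 (by rw [h3, sub_eq_zero.1 h, one_smul])
  · exact h2 (by rw [h3, eq_neg_of_add_eq_zero_left h, neg_one_smul])

namespace HypChart

variable (E : HypChart X)

theorem orientationPreserving_refl_trans_refl {a b : LVec} (ha : 0 < lform a a)
    (hb : 0 < lform b b) : OrientationPreserving ((E.refl a ha).trans (E.refl b hb)) :=
  (E.isReflection_refl ha).trans (E.isReflection_refl hb)

/-- Orientation preserving congruences act transitively on pairs of points at a given distance. -/
theorem exists_orientationPreserving_pair (E : HypChart X) {z y p q : X}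
    (h : dist z y = dist p q) (hpq : p ≠ q) :
    ∃ g : X ≃ᵢ X, OrientationPreserving g ∧ g z = p ∧ g y = q := by
  obtain ⟨f, hf, hfz⟩ : ∃ f : X ≃ᵢ X, OrientationPreserving f ∧ f z = p := by
    by_cases hzp : z = p
    · exact ⟨_, OrientationPreserving.refl, hzp⟩
    · obtain ⟨a, ha, hpa, -⟩ := exists_spacelike_normal (E.mem p) 0
      have hpos := lform_sub_self_pos (E.mem z) (E.mem p) fun h => hzp (E.injective h)
      refine ⟨_, E.orientationPreserving_refl_trans_refl hpos ha, E.injective ?_⟩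
      rw [E.vec_apply, E.lin_trans, E.lin_reflection, E.lin_reflection,
        lrefl_sub (by rw [E.lform_self, E.lform_self]) hpos.ne', lrefl_eq_self hpa]
  have hd : dist p (f y) = dist p q := by rw [← hfz, f.dist_eq, h, hfz]
  by_cases hyq : f y = q
  · exact ⟨f, hf, hfz, hyq⟩
  · have hpos := lform_sub_self_pos (E.mem (f y)) (E.mem q) fun h => hyq (E.injective h)
    have hc : 0 < lform (lcross (E.vec p) (E.vec q)) (lcross (E.vec p) (E.vec q)) := by
      rw [lform_lcross_lcross, E.lform_self, E.lform_self, E.lform_eq]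
      have := Real.one_lt_cosh.2 (dist_ne_zero.2 hpq)
      nlinarith
    have hp : lform (E.vec p) (E.vec (f y) - E.vec q) = 0 := by
      rw [lform_sub_right, E.lform_eq, E.lform_eq, hd]; ring
    refine ⟨_, hf.trans (E.orientationPreserving_refl_trans_refl hpos hc),
      E.injective ?_, E.injective ?_⟩
    · rw [E.vec_apply, E.lin_trans, ← E.vec_apply, hfz, E.lin_trans, E.lin_reflection,
        E.lin_reflection, lrefl_eq_self hp,
        lrefl_eq_self (by rw [lform_comm, lform_lcross_left])]
    · rw [E.vec_apply, E.lin_trans, ← E.vec_apply, E.lin_trans, E.lin_reflection,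
        E.lin_reflection, lrefl_sub (by rw [E.lform_self, E.lform_self]) hpos.ne',
        lrefl_eq_self (by rw [lform_comm, lform_lcross_right])]

/-- Orientation preserving congruences act transitively on unit spacelike vectors. -/
theorem exists_orientationPreserving_lin {v w : LVec} (hv : lform v v = 1)
    (hw : lform w w = 1) : ∃ g : X ≃ᵢ X, OrientationPreserving g ∧ E.lin g v = w := by
  rcases lt_or_ge (lform v w) 1 with h | h
  · obtain ⟨p, hp⟩ := E.exists_pt_perp (u := w) (by rw [hw]; norm_num)
    have hb : 0 < lform (lcross (E.vec p) w) (lcross (E.vec p) w) := by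
      rw [lform_lcross_lcross, hp, hw, E.lform_self]; norm_num
    have hpos : 0 < lform (v - w) (v - w) := by
      simp only [lform_sub_left, lform_sub_right, hv, hw, lform_comm w v]; linarith
    refine ⟨_, E.orientationPreserving_refl_trans_refl hpos hb, ?_⟩
    rw [E.lin_trans, E.lin_reflection, E.lin_reflection, lrefl_sub (by rw [hv, hw]) hpos.ne',
      lrefl_eq_self (by rw [lform_comm, lform_lcross_right])]
  · have hv' : 0 < lform v v := by rw [hv]; norm_num
    have hpos : 0 < lform (-v - w) (-v - w) := by
      simp only [lform_sub_left, lform_sub_right, lform_neg_left, lform_neg_right, hv, hw,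
        lform_comm w v]
      linarith
    refine ⟨_, E.orientationPreserving_refl_trans_refl hv' hpos, ?_⟩
    have h1 : lrefl v v = -v := by rw [lrefl_apply, hv]; module
    rw [E.lin_trans, E.lin_reflection, E.lin_reflection, h1,
      lrefl_sub (by rw [lform_neg_left, lform_neg_right, neg_neg, hv, hw]) (ne_of_gt hpos)]

/-- The convex set cut out by a family of hypercycles. -/
def cell (F : Set (LVec × ℝ)) : Set X := {x | ∀ i ∈ F, lform (E.vec x) i.1 ≤ i.2}

/-- The interior of the convex set cut out by a finite family of hypercycles. -/
def openCell (F : Set (LVec × ℝ)) : Set X := {x | ∀ i ∈ F, lform (E.vec x) i.1 < i.2}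

theorem isOpen_openCell {F : Set (LVec × ℝ)} (hF : F.Finite) : IsOpen (E.openCell F) := by
  have : E.openCell F = ⋂ i ∈ F, {x | lform (E.vec x) i.1 < i.2} := by
    ext x; simp [openCell]
  rw [this]
  exact hF.isOpen_biInter fun i _ => E.isOpen_lform_lt i.1 i.2

theorem openCell_subset_cell (F : Set (LVec × ℝ)) : E.openCell F ⊆ E.cell F :=
  fun _ hx i hi => (hx i hi).le

theorem openCell_subset_interior {F : Set (LVec × ℝ)} (hF : F.Finite) :
    E.openCell F ⊆ interior (E.cell F) :=
  interior_maximal (E.openCell_subset_cell F) (E.isOpen_openCell hF)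

theorem cell_union (F G : Set (LVec × ℝ)) : E.cell (F ∪ G) = E.cell F ∩ E.cell G := by
  ext x
  simp only [cell, mem_union, mem_inter_iff, Set.mem_ofPred_eq]
  exact ⟨fun h => ⟨fun i hi => h i (.inl hi), fun i hi => h i (.inr hi)⟩,
    fun h i hi => hi.elim (h.1 i) (h.2 i)⟩

/-- The action of a congruence on families of hypercycles. -/
noncomputable def move (g : X ≃ᵢ X) (F : Set (LVec × ℝ)) : Set (LVec × ℝ) :=
  (fun i => (E.lin g i.1, i.2)) '' F

theorem lform_vec_lin (g : X ≃ᵢ X) (x : X) (u : LVec) :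
    lform (E.vec (g x)) (E.lin g u) = lform (E.vec x) u := by
  rw [E.vec_apply, E.lform_lin]

theorem apply_mem_cell_move {g : X ≃ᵢ X} {F : Set (LVec × ℝ)} {x : X} :
    g x ∈ E.cell (E.move g F) ↔ x ∈ E.cell F := by
  constructor
  · intro h i hi
    have := h _ ⟨i, hi, rfl⟩
    rwa [E.lform_vec_lin] at this
  · rintro h _ ⟨i, hi, rfl⟩
    show lform (E.vec (g x)) (E.lin g i.1) ≤ i.2
    rw [E.lform_vec_lin]
    exact h i hi

theorem apply_mem_openCell_move {g : X ≃ᵢ X} {F : Set (LVec × ℝ)} {x : X} :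
    g x ∈ E.openCell (E.move g F) ↔ x ∈ E.openCell F := by
  constructor
  · intro h i hi
    have := h _ ⟨i, hi, rfl⟩
    rwa [E.lform_vec_lin] at this
  · rintro h _ ⟨i, hi, rfl⟩
    show lform (E.vec (g x)) (E.lin g i.1) < i.2
    rw [E.lform_vec_lin]
    exact h i hi

theorem image_cell (g : X ≃ᵢ X) (F : Set (LVec × ℝ)) :
    g '' E.cell F = E.cell (E.move g F) := by
  ext y
  constructor
  · rintro ⟨x, hx, rfl⟩
    exact E.apply_mem_cell_move.2 hx
  · intro hy
    refine ⟨g.symm y, ?_, g.apply_symm_apply y⟩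
    rw [← E.apply_mem_cell_move (g := g), g.apply_symm_apply]
    exact hy

/-- A finite family of pairwise disjoint hypercycles bounding the convex set `K`. -/
structure FaceSystem (K : Set X) (F : Set (LVec × ℝ)) : Prop where
  finite : F.Finite
  nonempty : F.Nonempty
  unit : ∀ i ∈ F, lform i.1 i.1 = 1
  nonneg : ∀ i ∈ F, 0 ≤ i.2
  eq_cell : K = E.cell F
  curve_subset : ∀ i ∈ F, E.curve i.1 i.2 ⊆ K
  disjoint : ∀ i ∈ F, ∀ j ∈ F, i ≠ j → ∀ x, x ∈ E.curve i.1 i.2 → x ∉ E.curve j.1 j.2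

theorem exists_faceSystem {K : Set X} (hcl : IsClosed K) (hcv : GConvex K)
    (hint : (interior K).Nonempty) (hpr : K ≠ univ) (hb : BdryHypOrLine K)
    (hfin : (bdryComponents K).Finite) : ∃ F, E.FaceSystem K F := by
  have key : ∀ C ∈ bdryComponents K, ∃ i : LVec × ℝ, lform i.1 i.1 = 1 ∧ 0 ≤ i.2 ∧
      C = E.curve i.1 i.2 ∧ K ⊆ E.region i.1 i.2 := by
    rintro C ⟨x, hx, rfl⟩
    obtain ⟨u, s, hu, hs, hC⟩ := E.isHypercycleOrLine_iff.1 (hb x hx)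
    obtain ⟨v, -, hv, hc, hLv⟩ := E.exists_region_of_curve_subset_frontier hcl hcv hint hu hs
      (hC ▸ connectedComponentIn_subset _ _)
    exact ⟨(v, s), hv, hs, hC.trans hc, hLv⟩
  choose! i hi using key
  have heq : K = E.cell (i '' bdryComponents K) := by
    refine E.eq_iInter_region hcl hint ?_ ?_
    · rintro _ ⟨C, hC, rfl⟩
      exact ⟨(hi C hC).1, (hi C hC).2.1, (hi C hC).2.2.2⟩
    · intro x hx
      refine ⟨_, ⟨_, ⟨x, hx, rfl⟩, rfl⟩, ?_⟩
      rw [← (hi _ ⟨x, hx, rfl⟩).2.2.1]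
      exact mem_connectedComponentIn hx
  refine ⟨i '' bdryComponents K, hfin.image _, ?_, ?_, ?_, heq, ?_, ?_⟩
  · by_contra hne
    rw [not_nonempty_iff_eq_empty] at hne
    rw [hne] at heq
    exact hpr (heq.trans (by ext x; simp [cell]))
  · rintro _ ⟨C, hC, rfl⟩; exact (hi C hC).1
  · rintro _ ⟨C, hC, rfl⟩; exact (hi C hC).2.1
  · rintro _ ⟨C, hC, rfl⟩
    rw [← (hi C hC).2.2.1]
    obtain ⟨x, hx, rfl⟩ := hC
    exact (connectedComponentIn_subset _ _).trans hcl.frontier_subset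
  · rintro _ ⟨C, hC, rfl⟩ _ ⟨D, hD, rfl⟩ hne x hx hx'
    rw [← (hi C hC).2.2.1] at hx
    rw [← (hi D hD).2.2.1] at hx'
    obtain ⟨y, hy, rfl⟩ := hC
    obtain ⟨z, hz, rfl⟩ := hD
    exact hne (by rw [connectedComponentIn_eq hx, connectedComponentIn_eq hx'])

variable {E}

theorem FaceSystem.lt_of_mem_curve {K : Set X} {F : Set (LVec × ℝ)} (h : E.FaceSystem K F)
    {i j : LVec × ℝ} (hi : i ∈ F) (hj : j ∈ F) (hij : j ≠ i) {x : X}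
    (hx : x ∈ E.curve i.1 i.2) : lform (E.vec x) j.1 < j.2 := by
  have h1 := h.curve_subset i hi hx
  rw [h.eq_cell] at h1
  exact lt_of_le_of_ne (h1 j hj) (h.disjoint i hi j hj hij.symm x hx)

theorem FaceSystem.fst_ne {K : Set X} {F : Set (LVec × ℝ)} (h : E.FaceSystem K F)
    {i j : LVec × ℝ} (hi : i ∈ F) (hj : j ∈ F) (hij : i ≠ j) : i.1 ≠ j.1 := by
  intro he
  obtain ⟨x, hx⟩ := E.exists_pt_lform_eq (h.unit i hi) i.2
  obtain ⟨y, hy⟩ := E.exists_pt_lform_eq (h.unit j hj) j.2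
  have h1 := h.lt_of_mem_curve hi hj hij.symm hx
  have h2 := h.lt_of_mem_curve hj hi hij hy
  rw [← he] at h1 hy
  linarith

end HypChart

open Polynomial in
theorem eq_zero_of_infinite_cosh_sinh {p q r : ℝ}
    (h : {τ : ℝ | p * Real.cosh τ + q * Real.sinh τ = r}.Infinite) : p = 0 ∧ q = 0 ∧ r = 0 := by
  set P : ℝ[X] := C (p + q) * X ^ 2 - C (2 * r) * X + C (p - q) with hP
  have hP0 : P = 0 := by
    refine P.eq_zero_of_infinite_isRoot ((h.image Real.exp_injective.injOn).mono ?_)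
    rintro _ ⟨τ, hτ, rfl⟩
    rw [Set.mem_ofPred_eq, Real.cosh_eq, Real.sinh_eq] at hτ
    have he : Real.exp τ * Real.exp (-τ) = 1 := by rw [← Real.exp_add]; simp
    simp only [Set.mem_ofPred_eq, IsRoot.def, hP, eval_add, eval_sub, eval_mul, eval_C, eval_pow,
      eval_X]
    linear_combination 2 * Real.exp τ * hτ - (p - q) * he
  have h0 := congrArg (eval 0) hP0
  have h1 := congrArg (eval 1) hP0
  have h2 := congrArg (eval (-1)) hP0
  simp only [hP, eval_add, eval_sub, eval_mul, eval_C, eval_pow, eval_X, eval_zero] at h0 h1 h2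
  refine ⟨by linarith, by linarith, by linarith⟩

namespace HypChart
variable (E : HypChart X)

/-- A hypercycle through a given point, as a continuous curve. -/
theorem exists_curve_param {u : LVec} (hu : lform u u = 1) (c : X) :
    ∃ γ : ℝ → X, Continuous γ ∧ γ 0 = c ∧ (∀ τ, lform (E.vec (γ τ)) u = lform (E.vec c) u) ∧
      ∀ τ, E.vec (γ τ) = lform (E.vec c) u • u
      + Real.cosh τ • (E.vec c - lform (E.vec c) u • u)
      + Real.sinh τ • lcross (E.vec c) u := by
  choose γ h1 h2 using E.exists_curve_pt hu c
  refine ⟨γ, ?_, E.injective ?_, h2, h1⟩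
  · rw [E.isInducing_vec.continuous_iff]
    have : E.vec ∘ γ = fun τ => lform (E.vec c) u • u
      + Real.cosh τ • (E.vec c - lform (E.vec c) u • u)
      + Real.sinh τ • lcross (E.vec c) u := funext h1
    rw [this]
    have h1 := Real.continuous_cosh
    have h2 := Real.continuous_sinh
    fun_prop
  · rw [h1, Real.cosh_zero, Real.sinh_zero]; module

/-- Near a point of a single face, a cell has interior points. -/
theorem openCell_nonempty {W : Set (LVec × ℝ)} (hW : W.Finite) {u : LVec} {s : ℝ}
    (hu : lform u u = 1) {x : X} (hx : lform (E.vec x) u = s)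
    (h : ∀ j ∈ W, j ≠ (u, s) → lform (E.vec x) j.1 < j.2) : (E.openCell W).Nonempty := by
  obtain ⟨y, hy, hlt⟩ := E.exists_seq_lform_gt (u := -u)
    (by rw [lform_neg_left, lform_neg_right, neg_neg, hu]) x
    (E.isOpen_openCell (hW.sdiff (t := {(u, s)}))) (fun j hj => h j hj.1 hj.2)
  rw [lform_neg_right, lform_neg_right, hx] at hlt
  refine ⟨y, fun j hj => ?_⟩
  by_cases he : j = (u, s)
  · rw [he]; show lform (E.vec y) u < s; linarith
  · exact hy j ⟨hj, he⟩

theorem eq_or_eq_neg_of_infinite {u a : LVec} (hu : lform u u = 1) (ha : lform a a = 1) {c : X}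
    {γ : ℝ → X} (hγ : ∀ τ, E.vec (γ τ) = lform (E.vec c) u • u
      + Real.cosh τ • (E.vec c - lform (E.vec c) u • u) + Real.sinh τ • lcross (E.vec c) u)
    {t : ℝ} (h : {τ | lform (E.vec (γ τ)) a = t}.Infinite) :
    (a = u ∧ t = lform (E.vec c) u) ∨ (a = -u ∧ t = -lform (E.vec c) u) := by
  set s := lform (E.vec c) u with hs
  have hset : {τ | lform (E.vec (γ τ)) a = t} = {τ : ℝ | (lform (E.vec c) a - s * lform u a)
      * Real.cosh τ + lform (lcross (E.vec c) u) a * Real.sinh τ = t - s * lform u a} := by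
    ext τ
    simp only [Set.mem_ofPred_eq, hγ, lform_add_left, lform_smul_left, lform_sub_left]
    constructor <;> intro h <;> linarith
  rw [hset] at h
  obtain ⟨h1, h2, h3⟩ := eq_zero_of_infinite_cosh_sinh h
  have hcr : lform (lcross (E.vec c) u) (lcross (E.vec c) u) = s ^ 2 + 1 := by
    rw [lform_lcross_lcross, E.lform_self, hu]; ring
  have hau : a - lform u a • u = 0 := by
    apply eq_zero_of_lform_eq_zero (a := E.vec c) (b := u) (c := lcross (E.vec c) u)
    · rw [hcr]; positivity
    · rw [lform_sub_left, lform_smul_left, lform_comm a, lform_comm u (E.vec c)]; linarith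
    · rw [lform_sub_left, lform_smul_left, hu, lform_comm]; ring
    · rw [lform_sub_left, lform_smul_left, lform_comm a, h2, lform_comm u (lcross _ _),
        lform_lcross_right]
      ring
  have hau := sub_eq_zero.1 hau
  have hk : (lform u a - 1) * (lform u a + 1) = 0 := by
    rw [hau, lform_smul_left, lform_smul_right, hu] at ha; linarith
  rcases mul_eq_zero.1 hk with hk | hk
  · left
    have : lform u a = 1 := by linarith
    rw [this] at hau h3
    exact ⟨by rw [hau, one_smul], by linarith⟩
  · right
    have : lform u a = -1 := by linarith
    rw [this] at hau h3
    exact ⟨by rw [hau, neg_one_smul], by linarith⟩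

/-- A congruence preserving a cell permutes its visible faces. -/
theorem lin_mem_of_image_cell {W : Set (LVec × ℝ)} (hW : W.Finite)
    (hunit : ∀ i ∈ W, lform i.1 i.1 = 1) {f : X ≃ᵢ X} (hf : f '' E.cell W = E.cell W)
    {u : LVec} {s : ℝ} (hu : (u, s) ∈ W) {x : X} (hx : lform (E.vec x) u = s)
    (h : ∀ j ∈ W, j ≠ (u, s) → lform (E.vec x) j.1 < j.2) : (E.lin f u, s) ∈ W := by
  have huu : lform u u = 1 := hunit _ hu
  have hmem : ∀ y, f y ∈ E.cell W ↔ y ∈ E.cell W := fun y => by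
    have := f.injective.mem_set_image (s := E.cell W) (a := y)
    rwa [hf] at this
  set O := E.openCell (W \ {(u, s)}) with hO
  have hOo : IsOpen O := E.isOpen_openCell hW.sdiff
  have hxO : x ∈ O := fun j hj => h j hj.1 hj.2
  have hcell : ∀ y ∈ O, lform (E.vec y) u ≤ s → y ∈ E.cell W := fun y hy hys j hj => by
    by_cases he : j = (u, s)
    · rw [he]; exact hys
    · exact (hy j ⟨hj, he⟩).le
  obtain ⟨γ, hγc, hγ0, hγu, hγ⟩ := E.exists_curve_param huu x
  have hT : (γ ⁻¹' O).Infinite :=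
    infinite_of_mem_nhds 0 ((hOo.preimage hγc).mem_nhds (by rw [mem_preimage, hγ0]; exact hxO))
  have hcov : γ ⁻¹' O ⊆ ⋃ i ∈ W, {τ | lform (E.vec (f (γ τ))) i.1 = i.2} := by
    intro τ hτ
    by_contra hne
    have hin : f (γ τ) ∈ E.openCell W := by
      intro i hi
      refine lt_of_le_of_ne ((hmem _).2 (hcell _ hτ (by rw [hγu, hx])) i hi) fun he => ?_
      exact hne (mem_biUnion hi he)
    obtain ⟨y, hy, hlt⟩ := E.exists_seq_lform_gt huu (γ τ)
      ((E.isOpen_openCell hW).preimage f.continuous) hin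
    have := (hmem y).1 (E.openCell_subset_cell _ hy) _ hu
    rw [hγu, hx] at hlt
    exact absurd this (not_le.2 hlt)
  obtain ⟨i, hi, hinf⟩ : ∃ i ∈ W, {τ | lform (E.vec (f (γ τ))) i.1 = i.2}.Infinite := by
    by_contra hne
    push Not at hne
    exact hT ((hW.biUnion hne).subset hcov)
  have heq : ∀ y, lform (E.vec (f y)) i.1 = lform (E.vec y) (E.lin f.symm i.1) := fun y => by
    rw [← E.lform_vec_lin f y, E.lin_lin_symm]
  simp only [heq] at hinf
  rcases E.eq_or_eq_neg_of_infinite huu (by rw [E.lform_lin, hunit i hi]) hγ hinf with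
    ⟨h1, h2⟩ | ⟨h1, h2⟩
  · rw [hx] at h2
    rw [← h1, E.lin_lin_symm, ← h2]
    exact hi
  · exfalso
    obtain ⟨y, hy, hlt⟩ := E.exists_seq_lform_gt (u := -u)
      (by rw [lform_neg_left, lform_neg_right, neg_neg, huu]) x hOo hxO
    rw [lform_neg_right, lform_neg_right, hx] at hlt
    have := (hmem y).2 (hcell y hy (by linarith)) i hi
    rw [heq, h1, lform_neg_right, h2, hx] at this
    linarith

end HypChart

theorem T5Cond1.symm {K L : Set X} (h : T5Cond1 K L) : T5Cond1 L K := by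
  intro φ ψ hφ hψ hne
  rw [inter_comm] at hne ⊢
  exact h ψ φ hψ hφ hne

namespace HypChart
variable (E : HypChart X)

theorem move_insert (g : X ≃ᵢ X) (i : LVec × ℝ) (F : Set (LVec × ℝ)) :
    E.move g (insert i F) = insert (E.lin g i.1, i.2) (E.move g F) := image_insert_eq

theorem move_singleton (g : X ≃ᵢ X) (i : LVec × ℝ) :
    E.move g {i} = {(E.lin g i.1, i.2)} := image_singleton

variable {E}

theorem finite_move {g : X ≃ᵢ X} {G : Set (LVec × ℝ)} (hG : G.Finite) : (E.move g G).Finite :=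
  hG.image _

theorem unit_move {g : X ≃ᵢ X} {G : Set (LVec × ℝ)} (hG : ∀ i ∈ G, lform i.1 i.1 = 1) :
    ∀ i ∈ E.move g G, lform i.1 i.1 = 1 := by
  rintro _ ⟨i, hi, rfl⟩
  exact (E.lform_lin g _ _).trans (hG i hi)

theorem FaceSystem.exists_congruence {K L : Set X} {F G : Set (LVec × ℝ)}
    (hF : E.FaceSystem K F) (hG : E.FaceSystem L G) (h : T5Cond1 K L) {g : X ≃ᵢ X}
    (hg : OrientationPreserving g) (hne : (E.openCell (F ∪ E.move g G)).Nonempty) :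
    ∃ f : X ≃ᵢ X, f ≠ IsometryEquiv.refl X ∧
      f '' E.cell (F ∪ E.move g G) = E.cell (F ∪ E.move g G) := by
  have he : (IsometryEquiv.refl X : X → X) '' K ∩ g '' L = E.cell (F ∪ E.move g G) := by
    rw [E.cell_union, ← E.image_cell, ← hF.eq_cell, ← hG.eq_cell]
    congr 1
    exact image_id K
  have := h _ g OrientationPreserving.refl hg
  rw [he] at this
  exact this (hne.mono (E.openCell_subset_interior (hF.finite.union (finite_move hG.finite))))

theorem FaceSystem.lin_mem {K L : Set X} {F G : Set (LVec × ℝ)}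
    (hF : E.FaceSystem K F) (hG : E.FaceSystem L G) {f g : X ≃ᵢ X}
    (hf : f '' E.cell (F ∪ E.move g G) = E.cell (F ∪ E.move g G)) {u : LVec} {s : ℝ}
    (hu : (u, s) ∈ F ∪ E.move g G) {x : X} (hx : lform (E.vec x) u = s)
    (h : ∀ j ∈ F ∪ E.move g G, j ≠ (u, s) → lform (E.vec x) j.1 < j.2) :
    (E.lin f u, s) ∈ F ∪ E.move g G := by
  refine E.lin_mem_of_image_cell (hF.finite.union (finite_move hG.finite)) ?_ hf hu hx h
  rintro i (hi | hi)
  · exact hF.unit i hi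
  · exact unit_move hG.unit i hi

/-- A convex set bounded by a single hypercycle, or by two hypercycles with the same base line, or
which has two boundary components with different base lines. -/
theorem FaceSystem.trichotomy {K : Set X} {F : Set (LVec × ℝ)} (hF : E.FaceSystem K F) :
    (∃ u s, F = {(u, s)}) ∨ (∃ u s₁ s₂, F = {(u, s₁), (-u, s₂)} ∧ 0 < s₁ + s₂) ∨
      ∃ i ∈ F, ∃ j ∈ F, i ≠ j ∧ i.1 ≠ -j.1 := by
  by_cases h : ∃ i ∈ F, ∃ j ∈ F, i ≠ j ∧ i.1 ≠ -j.1
  · exact .inr (.inr h)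
  push Not at h
  obtain ⟨i, hi⟩ := hF.nonempty
  by_cases h1 : ∃ j ∈ F, i ≠ j
  · obtain ⟨j, hj, hij⟩ := h1
    refine .inr (.inl ⟨i.1, i.2, j.2, ?_, ?_⟩)
    · have hji : j.1 = -i.1 := h j hj i hi hij.symm
      apply Subset.antisymm
      · intro k hk
        by_cases hik : k = i
        · exact .inl hik
        · right
          have hki := h k hk i hi hik
          by_contra hne
          rw [← hji] at hne hki
          exact hF.fst_ne hk hj hne hki
      · rintro k (rfl | rfl)
        · exact hi
        · rw [← hji]; exact hj
    · obtain ⟨x, hx⟩ := E.exists_pt_lform_eq (hF.unit i hi) i.2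
      have := hF.lt_of_mem_curve hi hj hij.symm hx
      rw [h j hj i hi hij.symm, lform_neg_right, hx] at this
      linarith
  · push Not at h1
    refine .inl ⟨i.1, i.2, Subset.antisymm (fun k hk => (h1 k hk).symm) ?_⟩
    rintro k rfl
    exact hi

theorem exists_unit_lform_half (E : HypChart X) {u : LVec} (hu : lform u u = 1) :
    ∃ w, lform w w = 1 ∧ lform u w = 1 / 2 := by
  obtain ⟨p, hp⟩ := E.exists_pt_perp (u := u) (by rw [hu]; norm_num)
  have he : lform (lcross (E.vec p) u) (lcross (E.vec p) u) = 1 := by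
    rw [lform_lcross_lcross, hp, hu, E.lform_self]; norm_num
  have h2 := lform_lcross_right (E.vec p) u
  have h3 : √(3 : ℝ) ^ 2 = 3 := Real.sq_sqrt (by norm_num)
  refine ⟨(1 / 2 : ℝ) • u + (√3 / 2) • lcross (E.vec p) u, ?_, ?_⟩
  · simp only [lform_add_left, lform_add_right, lform_smul_left, lform_smul_right, hu, he, h2,
      lform_comm u (lcross (E.vec p) u)]
    linarith
  · simp only [lform_add_right, lform_smul_right, hu, h2, lform_comm u (lcross (E.vec p) u)]
    norm_num

/-- Two hypercycles with intersecting base lines intersect. -/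
theorem exists_pt_lform_eq_lform_eq (E : HypChart X) {u w : LVec} (hu : lform u u = 1)
    (hw : lform w w = 1) (huw : lform u w ^ 2 < 1) (a b : ℝ) :
    ∃ x : X, lform (E.vec x) u = a ∧ lform (E.vec x) w = b := by
  set c := lform u w with hc
  have hd : 0 < 1 - c ^ 2 := by linarith
  set m := lcross u w with hm
  have hmm : lform m m = -(1 - c ^ 2) := by rw [hm, lform_lcross_lcross, hu, hw]; ring
  have hmu : lform u m = 0 := by rw [lform_comm, hm, lform_lcross_left]
  have hmw : lform w m = 0 := by rw [lform_comm, hm, lform_lcross_right]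
  set r := √(1 - c ^ 2) with hr
  have hr0 : 0 < r := Real.sqrt_pos.2 hd
  have hrr : r ^ 2 = 1 - c ^ 2 := Real.sq_sqrt hd.le
  obtain ⟨e, heu, hew, he⟩ : ∃ e ∈ hyperboloid, lform u e = 0 ∧ lform w e = 0 := by
    have h1 : lform (r⁻¹ • m) (r⁻¹ • m) = -1 := by
      rw [lform_smul_left, lform_smul_right, hmm, ← hrr]; field_simp
    rcases mem_or_neg_mem_hyperboloid h1 with h | h
    · exact ⟨_, h, by rw [lform_smul_right, hmu, mul_zero],
        by rw [lform_smul_right, hmw, mul_zero]⟩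
    · exact ⟨_, h, by rw [lform_neg_right, lform_smul_right, hmu, mul_zero, neg_zero],
        by rw [lform_neg_right, lform_smul_right, hmw, mul_zero, neg_zero]⟩
  set α := (a - c * b) / (1 - c ^ 2) with hα
  set β := (b - c * a) / (1 - c ^ 2) with hβ
  set y := α • u + β • w with hy
  have hyu : lform y u = a := by
    rw [hy, lform_add_left, lform_smul_left, lform_smul_left, hu, lform_comm w, ← hc, hα, hβ]
    field_simp; ring
  have hyw : lform y w = b := by
    rw [hy, lform_add_left, lform_smul_left, lform_smul_left, hw, ← hc, hα, hβ]
    field_simp; ring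
  have hye : lform e y = 0 := by
    rw [lform_comm, hy, lform_add_left, lform_smul_left, lform_smul_left, hew, he]; ring
  have hyy := lform_self_nonneg heu hye
  have hg : √(1 + lform y y) ^ 2 = 1 + lform y y := Real.sq_sqrt (by linarith)
  have hg0 : 0 < √(1 + lform y y) := Real.sqrt_pos.2 (by linarith)
  have hmem : y + √(1 + lform y y) • e ∈ hyperboloid := by
    apply mem_hyperboloid_of_lform_neg heu
    · simp only [lform_add_left, lform_add_right, lform_smul_left, lform_smul_right, heu.1, hye,
        lform_comm y e]
      linarith
    · rw [lform_add_right, lform_smul_right, hye, heu.1]; linarith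
  obtain ⟨x, hx⟩ := E.surj hmem
  refine ⟨x, ?_, ?_⟩
  · rw [hx, lform_add_left, lform_smul_left, hyu, lform_comm e, hew]; ring
  · rw [hx, lform_add_left, lform_smul_left, hyw, lform_comm e, he]; ring

theorem ne_refl_absurd {f : X ≃ᵢ X} (hf : f ≠ IsometryEquiv.refl X) {u w : LVec}
    (hu : lform u u = 1) (hw : lform w w = 1) (huw : lform u w ^ 2 ≤ 1) (h1 : w ≠ u) (h2 : w ≠ -u)
    (hfu : E.lin f u = u) (hfw : E.lin f w = w) : False := by
  refine hf (E.eq_refl_of_fix_two hfu hfw ?_ (lcross_ne_zero hu hw h1 h2))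
  rw [lform_lcross_lcross, hu, hw]; linarith

theorem FaceSystem.cases_of_singleton {K L : Set X} {u v : LVec} {s t : ℝ}
    (hF : E.FaceSystem K {(u, s)}) (hG : E.FaceSystem L {(v, t)}) (h : T5Cond1 K L) :
    Theorem5Cases K L := by
  have hu : lform u u = 1 := hF.unit _ rfl
  have hv : lform v v = 1 := hG.unit _ rfl
  obtain ⟨w, hw, huw⟩ := E.exists_unit_lform_half hu
  have hlt : lform u w ^ 2 < 1 := by rw [huw]; norm_num
  obtain ⟨g, hg, hgv⟩ := E.exists_orientationPreserving_lin hv hw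
  have hW : ({(u, s)} ∪ E.move g {(v, t)} : Set (LVec × ℝ)) = {(u, s), (w, t)} := by
    rw [E.move_singleton, singleton_union, hgv]
  obtain ⟨x, hxu, hxw⟩ := E.exists_pt_lform_eq_lform_eq hu hw hlt s (t - 1)
  obtain ⟨y, hyu, hyw⟩ := E.exists_pt_lform_eq_lform_eq hu hw hlt (s - 1) t
  have hx : ∀ j ∈ ({(u, s)} ∪ E.move g {(v, t)} : Set (LVec × ℝ)), j ≠ (u, s) →
      lform (E.vec x) j.1 < j.2 := by
    rw [hW]
    rintro j (rfl | rfl) hj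
    · exact absurd rfl hj
    · simp only [hxw]; linarith
  have hy : ∀ j ∈ ({(u, s)} ∪ E.move g {(v, t)} : Set (LVec × ℝ)), j ≠ (w, t) →
      lform (E.vec y) j.1 < j.2 := by
    rw [hW]
    rintro j (rfl | rfl) hj
    · simp only [hyu]; linarith
    · exact absurd rfl hj
  obtain ⟨f, hf, hfW⟩ := hF.exists_congruence hG h hg
    (E.openCell_nonempty (hF.finite.union (finite_move hG.finite)) hu hxu hx)
  have h1 := hF.lin_mem hG hfW (by rw [hW]; exact .inl rfl) hxu hx
  have h2 := hF.lin_mem hG hfW (by rw [hW]; exact .inr rfl) hyw hy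
  have hB := E.lform_lin f u w
  rw [hW] at h1 h2
  simp only [mem_insert_iff, mem_singleton_iff, Prod.mk.injEq] at h1 h2
  have hst : s = t := by
    rcases h1 with ⟨h1, -⟩ | ⟨-, h1⟩
    · rcases h2 with ⟨h2, -⟩ | ⟨h2, -⟩
      · rw [h1, h2, hu, huw] at hB; norm_num at hB
      · refine (ne_refl_absurd hf hu hw hlt.le ?_ ?_ h1 h2).elim
        · rintro rfl; rw [hu] at huw; norm_num at huw
        · rintro rfl; rw [lform_neg_right, hu] at huw; norm_num at huw
    · exact h1
  subst hst
  have hs : 0 ≤ s := hF.nonneg _ rfl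
  have hK : K = E.region u s := by
    rw [hF.eq_cell]; ext x; simp [cell, region]
  have hL : L = E.region v s := by
    rw [hG.eq_cell]; ext x; simp [cell, region]
  obtain ⟨k, -, hk⟩ := E.exists_orientationPreserving_lin hu hv
  obtain ⟨l, -, hl⟩ := E.exists_orientationPreserving_lin hv hu
  refine .inl ⟨?_, ?_, fun _ => .inr ⟨k, ?_⟩, fun _ => .inr ⟨l, ?_⟩⟩
  · rw [hK]; exact .inr (.inr (E.hypercycleDomain_or_halfspace_region hu hs))
  · rw [hL]; exact .inr (.inr (E.hypercycleDomain_or_halfspace_region hv hs))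
  · rw [hK, hL, E.image_region, hk]
  · rw [hK, hL, E.image_region, hl]

theorem FaceSystem.not_strip_singleton {K L : Set X} {u v : LVec} {s₁ s₂ t : ℝ}
    (hF : E.FaceSystem K {(u, s₁), (-u, s₂)}) (hs : 0 < s₁ + s₂) (hG : E.FaceSystem L {(v, t)}) :
    ¬ T5Cond1 K L := by
  intro h
  have hu : lform u u = 1 := hF.unit _ (.inl rfl)
  have hv : lform v v = 1 := hG.unit _ rfl
  obtain ⟨w, hw, huw⟩ := E.exists_unit_lform_half hu
  have hlt : lform u w ^ 2 < 1 := by rw [huw]; norm_num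
  obtain ⟨g, hg, hgv⟩ := E.exists_orientationPreserving_lin hv hw
  have hW : ({(u, s₁), (-u, s₂)} ∪ E.move g {(v, t)} : Set (LVec × ℝ))
      = {(u, s₁), (-u, s₂), (w, t)} := by
    rw [E.move_singleton, hgv]; ext; simp; tauto
  obtain ⟨x, hxu, hxw⟩ := E.exists_pt_lform_eq_lform_eq hu hw hlt s₁ (t - 1)
  obtain ⟨y, hyu, hyw⟩ := E.exists_pt_lform_eq_lform_eq hu hw hlt ((s₁ - s₂) / 2) t
  obtain ⟨z, hzu, hzw⟩ := E.exists_pt_lform_eq_lform_eq hu hw hlt (-s₂) (t - 1)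
  have hx : ∀ j ∈ ({(u, s₁), (-u, s₂)} ∪ E.move g {(v, t)} : Set (LVec × ℝ)), j ≠ (u, s₁) →
      lform (E.vec x) j.1 < j.2 := by
    rw [hW]
    rintro j (rfl | rfl | rfl) hj
    · exact absurd rfl hj
    · simp only [lform_neg_right, hxu]; linarith
    · simp only [hxw]; linarith
  have hy : ∀ j ∈ ({(u, s₁), (-u, s₂)} ∪ E.move g {(v, t)} : Set (LVec × ℝ)), j ≠ (w, t) →
      lform (E.vec y) j.1 < j.2 := by
    rw [hW]
    rintro j (rfl | rfl | rfl) hj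
    · simp only [hyu]; linarith
    · simp only [lform_neg_right, hyu]; linarith
    · exact absurd rfl hj
  have hz : ∀ j ∈ ({(u, s₁), (-u, s₂)} ∪ E.move g {(v, t)} : Set (LVec × ℝ)), j ≠ (-u, s₂) →
      lform (E.vec z) j.1 < j.2 := by
    rw [hW]
    rintro j (rfl | rfl | rfl) hj
    · simp only [hzu]; linarith
    · exact absurd rfl hj
    · simp only [hzw]; linarith
  obtain ⟨f, hf, hfW⟩ := hF.exists_congruence hG h hg
    (E.openCell_nonempty (hF.finite.union (finite_move hG.finite)) hu hxu hx)
  have h1 := hF.lin_mem hG hfW (by rw [hW]; exact .inl rfl) hxu hx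
  have h2 := hF.lin_mem hG hfW (by rw [hW]; exact .inr (.inr rfl)) hyw hy
  have h3 := hF.lin_mem hG hfW (by rw [hW]; exact .inr (.inl rfl))
    (by rw [lform_neg_right, hzu, neg_neg]) hz
  have hB := E.lform_lin f u w
  rw [hW] at h1 h2 h3
  simp only [mem_insert_iff, mem_singleton_iff, Prod.mk.injEq, map_neg] at h1 h2 h3
  have hwu : w ≠ u := by rintro rfl; rw [hu] at huw; norm_num at huw
  have hwu' : w ≠ -u := by
    rintro rfl; rw [lform_neg_right, hu] at huw; norm_num at huw
  have hwu2 : lform w u = 1 / 2 := by rw [lform_comm, huw]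
  rcases h1 with ⟨h1, -⟩ | ⟨h1, -⟩ | ⟨h1, -⟩ <;> rcases h2 with ⟨h2, -⟩ | ⟨h2, -⟩ | ⟨h2, -⟩ <;>
    rw [h1, h2] at hB <;> simp only [lform_neg_left, lform_neg_right, hu, hw, huw, hwu2] at hB <;>
    norm_num at hB
  · exact ne_refl_absurd hf hu hw hlt.le hwu hwu' h1 h2
  · rw [h1] at h3
    rcases h3 with ⟨h3, -⟩ | ⟨h3, -⟩ | ⟨h3, -⟩
    · exact hwu' (by rw [← h3, neg_neg])
    · exact hwu (neg_injective h3)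
    · have := hw
      nth_rewrite 1 [← h3] at this
      rw [lform_neg_left, hw] at this
      norm_num at this

end HypChart

namespace HypChart
variable {E : HypChart X}

/-- A unit vector whose line has a common ideal point with a given line. -/
theorem exists_parallel (E : HypChart X) {u : LVec} (hu : lform u u = 1) :
    ∃ n, lform n n = 0 ∧ lform u n = 0 ∧ n ≠ 0 ∧ (∀ x, lform (E.vec x) n < 0) ∧
      ∀ a ν, 0 < ν → ∃ x, lform (E.vec x) u = a ∧ lform (E.vec x) n = -ν := by
  obtain ⟨o, hou⟩ := E.exists_pt_perp (u := u) (by rw [hu]; norm_num)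
  have hp := E.mem o
  have hpp := E.lform_self o
  set p := E.vec o
  set e := lcross p u
  have hee : lform e e = 1 := by rw [lform_lcross_lcross, hou, hu, hpp]; norm_num
  have hep : lform e p = 0 := lform_lcross_left _ _
  have heu : lform e u = 0 := lform_lcross_right _ _
  have hpe : lform p e = 0 := by rw [lform_comm, hep]
  have hue : lform u e = 0 := by rw [lform_comm, heu]
  have huo : lform u p = 0 := by rw [lform_comm, hou]
  have hnn : lform (p + e) (p + e) = 0 := by
    simp only [lform_add_left, lform_add_right, hpp, hee, hep, hpe]; norm_num
  have hpn : lform p (p + e) = -1 := by rw [lform_add_right, hpp, hpe]; norm_num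
  have hn0 : p + e ≠ 0 := by
    intro h; rw [h, lform_zero_right] at hpn; norm_num at hpn
  have hsign : ∀ q ∈ hyperboloid, lform q (p + e) < 0 := by
    rcases lform_null_sign hnn hn0 with h | h
    · exact h
    · have := h p hp; rw [hpn] at this; norm_num at this
  refine ⟨p + e, hnn, by rw [lform_add_right, huo, hue, add_zero], hn0,
    fun x => hsign _ (E.mem x), fun a ν hν => ?_⟩
  set α := (ν + (1 + a ^ 2) / ν) / 2 with hα
  set β := ((1 + a ^ 2) / ν - ν) / 2 with hβ
  have hα0 : 0 < α := by positivity
  have hab : β ^ 2 - α ^ 2 = -(1 + a ^ 2) := by rw [hα, hβ]; field_simp; ring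
  obtain ⟨x, hx⟩ := E.surj (v := a • u + α • p + β • e) (by
    apply mem_hyperboloid_of_lform_neg hp
    · simp only [lform_add_left, lform_add_right, lform_smul_left, lform_smul_right, hpp, hee,
        hep, hpe, hou, huo, heu, hue, hu]
      linarith
    · simp only [lform_add_right, lform_smul_right, hpp, hpe, hou]
      linarith)
  refine ⟨x, ?_, ?_⟩
  · rw [hx]
    simp only [lform_add_left, lform_smul_left, hu, hou, heu]; ring
  · rw [hx]
    simp only [lform_add_left, lform_add_right, lform_smul_left, hpp, hee,
        hep, hpe, huo, hue, hα, hβ]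
    ring

theorem FaceSystem.eq_of_strip {K L : Set X} {u v : LVec} {s₁ s₂ t₁ t₂ : ℝ}
    (hF : E.FaceSystem K {(u, s₁), (-u, s₂)}) (hs : 0 < s₁ + s₂)
    (hG : E.FaceSystem L {(v, t₁), (-v, t₂)}) (ht : 0 < t₁ + t₂) (h : T5Cond1 K L) :
    s₁ = t₂ := by
  have hs1 : 0 ≤ s₁ := hF.nonneg _ (.inl rfl)
  have ht2 : 0 ≤ t₂ := hG.nonneg _ (.inr rfl)
  rcases (add_nonneg hs1 ht2).eq_or_lt with hst | hst
  · linarith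
  have hu : lform u u = 1 := hF.unit _ (.inl rfl)
  have hv : lform v v = 1 := hG.unit _ (.inl rfl)
  obtain ⟨n, hnn, hun, hn0, hneg, hpt⟩ := E.exists_parallel hu
  have hnu : lform n u = 0 := by rw [lform_comm, hun]
  have hw : lform (u + n) (u + n) = 1 := by
    simp only [lform_add_left, lform_add_right, hu, hun, hnu, hnn]; norm_num
  have huw : lform u (u + n) = 1 := by rw [lform_add_right, hu, hun, add_zero]
  obtain ⟨g, hg, hgv⟩ := E.exists_orientationPreserving_lin hv hw
  set w := u + n with hwn
  have hwu : lform w u = 1 := by rw [lform_comm, huw]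
  have hxw : ∀ x, lform (E.vec x) w = lform (E.vec x) u + lform (E.vec x) n := fun x => by
    rw [hwn, lform_add_right]
  have hW : ({(u, s₁), (-u, s₂)} ∪ E.move g {(v, t₁), (-v, t₂)} : Set (LVec × ℝ))
      = {(u, s₁), (-u, s₂), (w, t₁), (-w, t₂)} := by
    rw [E.move_insert, E.move_singleton, map_neg, hgv]; ext; simp; tauto
  obtain ⟨ν, hν1, hν2⟩ := exists_between (show max 0 (s₁ - t₁) < s₁ + t₂ from
    max_lt hst (by linarith))
  obtain ⟨μ, hμ1, hμ2⟩ := exists_between (show max 0 (t₂ - s₂) < s₁ + t₂ from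
    max_lt hst (by linarith))
  rw [max_lt_iff] at hν1 hμ1
  obtain ⟨x, hxu, hxn⟩ := hpt s₁ ν hν1.1
  obtain ⟨y, hyu, hyn⟩ := hpt (μ - t₂) μ hμ1.1
  have hx : ∀ j ∈ ({(u, s₁), (-u, s₂)} ∪ E.move g {(v, t₁), (-v, t₂)} : Set (LVec × ℝ)),
      j ≠ (u, s₁) → lform (E.vec x) j.1 < j.2 := by
    rw [hW]
    rintro j (rfl | rfl | rfl | rfl) hj
    · exact absurd rfl hj
    · simp only [lform_neg_right, hxu]; linarith
    · simp only [hxw, hxu, hxn]; linarith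
    · simp only [lform_neg_right, hxw, hxu, hxn]; linarith
  have hy : ∀ j ∈ ({(u, s₁), (-u, s₂)} ∪ E.move g {(v, t₁), (-v, t₂)} : Set (LVec × ℝ)),
      j ≠ (-w, t₂) → lform (E.vec y) j.1 < j.2 := by
    rw [hW]
    rintro j (rfl | rfl | rfl | rfl) hj
    · simp only [hyu]; linarith
    · simp only [lform_neg_right, hyu]; linarith
    · simp only [hxw, hyu, hyn]; linarith
    · exact absurd rfl hj
  obtain ⟨f, hf, hfW⟩ := hF.exists_congruence hG h hg
    (E.openCell_nonempty (hF.finite.union (finite_move hG.finite)) hu hxu hx)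
  have h1 := hF.lin_mem hG hfW (by rw [hW]; exact .inl rfl) hxu hx
  have h2 := hF.lin_mem hG hfW (by rw [hW]; exact .inr (.inr (.inr rfl)))
    (by rw [lform_neg_right, hxw, hyu, hyn]; ring) hy
  have hB := E.lform_lin f u w
  have hAn : E.lin f n = E.lin f w - E.lin f u := by rw [hwn, map_add]; abel
  have hAneg : lform (E.vec (f x)) (E.lin f n) < 0 := by rw [E.lform_vec_lin]; exact hneg x
  have hne : E.lin f w ≠ E.lin f u := fun he =>
    hn0 (left_eq_add.1 ((E.lin f).injective he).symm)
  rw [hW] at h1 h2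
  simp only [mem_insert_iff, mem_singleton_iff, Prod.mk.injEq, map_neg, neg_inj] at h1 h2
  have hnne : w ≠ u := fun he => hn0 (left_eq_add.1 he.symm)
  have hnne' : w ≠ -u := by
    intro he; rw [he, lform_neg_right, hu] at huw; norm_num at huw
  have hn1 := hneg (f x)
  have hd1 : w - u = n := by rw [hwn]; abel
  have hd2 : u - w = -n := by rw [hwn]; abel
  have hd3 : -w - -u = -n := by rw [hwn]; abel
  by_contra hst'
  simp only [neg_eq_iff_eq_neg] at h2
  rcases h1 with ⟨h1, -⟩ | ⟨h1, -⟩ | ⟨h1, -⟩ | ⟨-, h1⟩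
  · rcases h2 with ⟨h2, -⟩ | ⟨h2, -⟩ | ⟨h2, -⟩ | ⟨h2, -⟩
    · rw [h1, h2, lform_neg_right, hu, huw] at hB; norm_num at hB
    · exact hne (by rw [h1, h2])
    · rw [h1, h2, lform_neg_right, huw] at hB; norm_num at hB
    · exact ne_refl_absurd hf hu hw (by rw [huw]; norm_num) hnne hnne' h1 h2
  · rcases h2 with ⟨h2, -⟩ | ⟨h2, -⟩ | ⟨h2, -⟩ | ⟨h2, -⟩
    · exact hne (by rw [h1, h2])
    · rw [h1, h2, lform_neg_left, hu, huw] at hB; norm_num at hB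
    · rw [hAn, h1, h2, hd3, lform_neg_right] at hAneg; linarith
    · rw [h1, h2, lform_neg_left, huw] at hB; norm_num at hB
  · rcases h2 with ⟨h2, -⟩ | ⟨h2, -⟩ | ⟨h2, -⟩ | ⟨h2, -⟩
    · rw [h1, h2, lform_neg_right, hwu, huw] at hB; norm_num at hB
    · rw [hAn, h1, h2, hd2, lform_neg_right] at hAneg; linarith
    · rw [h1, h2, lform_neg_right, hw, huw] at hB; norm_num at hB
    · exact hne (by rw [h1, h2])
  · exact hst' h1

theorem FaceSystem.cases_of_strip {K L : Set X} {u v : LVec} {s₁ s₂ t₁ t₂ : ℝ}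
    (hF : E.FaceSystem K {(u, s₁), (-u, s₂)}) (hs : 0 < s₁ + s₂)
    (hG : E.FaceSystem L {(v, t₁), (-v, t₂)}) (ht : 0 < t₁ + t₂) (h : T5Cond1 K L) :
    Theorem5Cases K L := by
  have hF' : E.FaceSystem K {(-u, s₂), (- -u, s₁)} := by
    rw [neg_neg, pair_comm]; exact hF
  have hG' : E.FaceSystem L {(-v, t₂), (- -v, t₁)} := by
    rw [neg_neg, pair_comm]; exact hG
  have e1 := hF.eq_of_strip hs hG ht h
  have e2 := hF'.eq_of_strip (by linarith) hG ht h
  have e3 := hF.eq_of_strip hs hG' (by linarith) h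
  have hs1 : 0 < s₁ := by linarith
  have hu : lform u u = 1 := hF.unit _ (.inl rfl)
  have hv : lform v v = 1 := hG.unit _ (.inl rfl)
  have hK : K = E.strip u s₁ := by
    rw [hF.eq_cell, e2, ← e1]; ext x; simp [cell, region, strip]
  have hL : L = E.strip v s₁ := by
    rw [hG.eq_cell, ← e1, ← e3]; ext x; simp [cell, region, strip]
  obtain ⟨k, -, hk⟩ := E.exists_orientationPreserving_lin hu hv
  refine .inr (.inr (.inr (.inr ⟨⟨k, ?_⟩, ?_, ?_⟩)))
  · rw [hK, hL, E.image_strip, hk]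
  · rw [hK]; exact E.isParallelDomain_strip hu hs1
  · rw [hL]; exact E.isParallelDomain_strip hv hs1

end HypChart

theorem continuousAt_lrefl {a : LVec} (ha : lform a a ≠ 0) (v : LVec) :
    ContinuousAt (fun p : LVec × LVec => lrefl p.1 p.2) (a, v) := by
  simp only [lrefl_apply]
  have h1 : Continuous fun p : LVec × LVec => lform p.2 p.1 :=
    continuous_lform.comp (continuous_snd.prodMk continuous_fst)
  have h2 : Continuous fun p : LVec × LVec => lform p.1 p.1 :=
    continuous_lform.comp (continuous_fst.prodMk continuous_fst)
  exact continuousAt_snd.sub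
    (((h1.continuousAt.const_mul 2).div h2.continuousAt ha).smul continuousAt_fst)

theorem continuous_lform_right (w : LVec) : Continuous (lform w) :=
  continuous_lform.comp (continuous_const.prodMk continuous_id)

namespace HypChart
variable {E : HypChart X}

theorem mem_openCell_move {g : X ≃ᵢ X} {G : Set (LVec × ℝ)} {x : X} :
    x ∈ E.openCell (E.move g G) ↔ ∀ i ∈ G, lform (E.vec x) (E.lin g i.1) < i.2 :=
  forall_mem_image

theorem coneConvex_openCell (E : HypChart X) {F : Set (LVec × ℝ)} (hF : ∀ i ∈ F, 0 ≤ i.2) :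
    E.ConeConvex (E.openCell F) := by
  intro x hx y hy z α β hα hβ hz i hi
  have h1 := E.combo_sq hz
  have h2 := Real.one_le_cosh (dist x y)
  have h3 : α + β ≤ 1 := by
    have : α * β * 1 ≤ α * β * Real.cosh (dist x y) :=
      mul_le_mul_of_nonneg_left h2 (mul_nonneg hα hβ)
    nlinarith
  have hlt : α * lform (E.vec x) i.1 + β * lform (E.vec y) i.1 < (α + β) * i.2 := by
    rcases hα.eq_or_lt with rfl | hα
    · rcases hβ.eq_or_lt with rfl | hβ
      · norm_num at h1
      · nlinarith [mul_lt_mul_of_pos_left (hy i hi) hβ]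
    · nlinarith [mul_lt_mul_of_pos_left (hx i hi) hα,
        mul_le_mul_of_nonneg_left (hy i hi).le hβ]
  rw [hz, lform_add_left, lform_smul_left, lform_smul_left]
  nlinarith [hF i hi]

theorem FaceSystem.exists_mem_openCell {K : Set X} {F : Set (LVec × ℝ)} (h : E.FaceSystem K F)
    {i : LVec × ℝ} (hi : i ∈ F) {x : X} (hx : lform (E.vec x) i.1 = i.2) {O : Set X}
    (hO : IsOpen O) (hxO : x ∈ O) : ∃ y ∈ O, y ∈ E.openCell F := by
  obtain ⟨y, ⟨hyO, hy⟩, hlt⟩ := E.exists_seq_lform_gt (u := -i.1)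
    (by rw [lform_neg_left, lform_neg_right, neg_neg, h.unit i hi]) x
    (hO.inter (E.isOpen_openCell (h.finite.sdiff (t := {i}))))
    ⟨hxO, fun j hj => h.lt_of_mem_curve hi hj.1 hj.2 hx⟩
  rw [lform_neg_right, lform_neg_right, hx] at hlt
  refine ⟨y, hyO, fun j hj => ?_⟩
  by_cases he : j = i
  · rw [he]; linarith
  · exact hy j ⟨hj, he⟩

theorem exists_mem_curve_dist_gt (E : HypChart X) {u : LVec} (hu : lform u u = 1) (z : X) (r : ℝ) :
    ∃ x, lform (E.vec x) u = lform (E.vec z) u ∧ r < dist z x := by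
  obtain ⟨x, hx, hxu⟩ := E.exists_curve_pt hu z (|r| + 1)
  refine ⟨x, hxu, ?_⟩
  set s := lform (E.vec z) u
  have h1 := E.lform_eq z x
  rw [hx] at h1
  simp only [lform_add_right, lform_smul_right, lform_sub_right, E.lform_self,
    lform_comm (E.vec z) (lcross (E.vec z) u), lform_lcross_left] at h1
  have h2 := Real.one_le_cosh (|r| + 1)
  have h3 : Real.cosh (|r| + 1) ≤ Real.cosh (dist z x) := by
    nlinarith [sq_nonneg s]
  rw [Real.cosh_le_cosh, abs_of_nonneg (by positivity), abs_of_nonneg dist_nonneg] at h3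
  linarith [le_abs_self r]

theorem FaceSystem.exists_dist_eq {K : Set X} {F : Set (LVec × ℝ)} (h : E.FaceSystem K F)
    {i : LVec × ℝ} (hi : i ∈ F) {z : X} (hz : lform (E.vec z) i.1 = i.2) {r : ℝ} (hr : 0 < r) :
    ∃ y ∈ E.openCell F, dist z y = r := by
  obtain ⟨x, hx, hzx⟩ := E.exists_mem_curve_dist_gt (h.unit i hi) z r
  have hd : Continuous fun y => dist z y := by fun_prop
  obtain ⟨a, ha, haF⟩ := h.exists_mem_openCell hi hz (isOpen_lt hd continuous_const)
    (show dist z z < r by rwa [dist_self])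
  obtain ⟨b, hb, hbF⟩ := h.exists_mem_openCell hi (hx.trans hz) (isOpen_lt continuous_const hd) hzx
  obtain ⟨y, hy, hyr⟩ := ((E.coneConvex_openCell h.nonneg).isPreconnected E).intermediate_value
    haF hbF hd.continuousOn ⟨le_of_lt ha, le_of_lt hb⟩
  exact ⟨y, hy, hyr⟩

/-- A hypercycle crosses a hypercycle to which it is not tangent. -/
theorem exists_mem_curve_lt (E : HypChart X) {u w : LVec} (hu : lform u u = 1) {p : X}
    (h : lform (lcross (E.vec p) u) w ≠ 0) {O : Set X} (hO : IsOpen O) (hp : p ∈ O) :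
    ∃ x ∈ O, lform (E.vec x) u = lform (E.vec p) u ∧
      lform (E.vec x) w < lform (E.vec p) w := by
  by_contra hne
  push Not at hne
  obtain ⟨γ, hγc, hγ0, hγu, hγ⟩ := E.exists_curve_param hu p
  have hmin : IsLocalMin (fun τ => lform (E.vec (γ τ)) w) 0 := by
    filter_upwards [(hO.preimage hγc).mem_nhds (by rw [mem_preimage, hγ0]; exact hp)] with τ hτ
    simp only [hγ0]
    exact hne _ hτ (hγu τ)
  have heq : (fun τ => lform (E.vec (γ τ)) w) = fun τ => lform (E.vec p) u * lform u w
      + Real.cosh τ * (lform (E.vec p) w - lform (E.vec p) u * lform u w)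
      + Real.sinh τ * lform (lcross (E.vec p) u) w := by
    funext τ
    simp only [hγ, lform_add_left, lform_smul_left, lform_sub_left]
  rw [heq] at hmin
  have hd := ((((Real.hasDerivAt_cosh 0).mul_const
    (lform (E.vec p) w - lform (E.vec p) u * lform u w)).const_add
    (lform (E.vec p) u * lform u w)).add ((Real.hasDerivAt_sinh 0).mul_const
    (lform (lcross (E.vec p) u) w)))
  have := hmin.hasDerivAt_eq_zero hd
  rw [Real.sinh_zero, Real.cosh_zero] at this
  exact h (by linarith)

/-- A small rotation makes two hypercycles through a point transversal. -/
theorem exists_rotation_transversal (E : HypChart X) {u w : LVec} (hu : lform u u = 1)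
    (hw : lform w w = 1) (p q : X) {G : Set (LVec × ℝ)} (hG : G.Finite) (hq : q ∈ E.openCell G) :
    ∃ g : X ≃ᵢ X, OrientationPreserving g ∧ g p = p ∧ q ∈ E.openCell (E.move g G) ∧
      lform (lcross (E.vec p) u) (E.lin g w) ≠ 0 := by
  set m := lcross (E.vec p) u with hm
  by_cases h0 : lform m w = 0
  swap
  · refine ⟨_, OrientationPreserving.refl, rfl, mem_openCell_move.2 fun i hi => ?_, ?_⟩
    · rw [E.lin_refl]; exact hq i hi
    · rwa [E.lin_refl]
  set s := lform (E.vec p) u with hs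
  have hmm : lform m m = s ^ 2 + 1 := by
    rw [hm, lform_lcross_lcross, E.lform_self, hu]; ring
  have hmp : lform m (E.vec p) = 0 := lform_lcross_left _ _
  have hmu : lform m u = 0 := lform_lcross_right _ _
  have hup : lform u (E.vec p) = s := by rw [lform_comm]
  set n := u + s • E.vec p with hn
  have hnp : lform (E.vec p) n = 0 := by
    rw [hn, lform_add_right, lform_smul_right, E.lform_self]; linarith
  have hmn : lform m n = 0 := by
    rw [hn, lform_add_right, lform_smul_right, hmu, hmp]; ring
  have hnm : lform n m = 0 := by rw [lform_comm, hmn]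
  have hnn : lform n n = s ^ 2 + 1 := by
    simp only [hn, lform_add_left, lform_add_right, lform_smul_left, lform_smul_right, hu,
      E.lform_self, hup, ← hs]
    ring
  have hwn : lform w n ≠ 0 := by
    intro h
    have : w + lform w (E.vec p) • E.vec p = 0 := by
      apply eq_zero_of_lform_eq_zero (a := E.vec p) (b := u) (c := m)
      · rw [← hm, hmm]; positivity
      · rw [lform_add_left, lform_smul_left, E.lform_self]; ring
      · rw [hn, lform_add_right, lform_smul_right] at h
        rw [lform_add_left, lform_smul_left, ← hs]; linarith
      · rw [lform_add_left, lform_smul_left, lform_comm w m, h0, lform_comm (E.vec p) m, hmp]; ring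
    have hwp := eq_neg_of_add_eq_zero_left this
    have h1 := hw
    rw [hwp, lform_neg_left, lform_neg_right, lform_smul_left, lform_smul_right,
      E.lform_self] at h1
    nlinarith [sq_nonneg (lform w (E.vec p))]
  have hm0 : 0 < lform m m := by rw [hmm]; positivity
  have ha : ∀ ε : ℝ, lform (m + ε • n) (m + ε • n) = (s ^ 2 + 1) * (1 + ε ^ 2) := fun ε => by
    simp only [lform_add_left, lform_add_right, lform_smul_left, lform_smul_right, hmm, hnn,
      hmn, hnm]
    ring
  have ha0 : ∀ ε : ℝ, 0 < lform (m + ε • n) (m + ε • n) := fun ε => by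
    rw [ha]; positivity
  have hcont : ∀ i ∈ G, ∀ᶠ ε : ℝ in nhds 0,
      lform (E.vec q) (lrefl (m + ε • n) (lrefl m i.1)) < i.2 := by
    intro i hi
    have hc : ContinuousAt (fun ε : ℝ => lform (E.vec q) (lrefl (m + ε • n) (lrefl m i.1))) 0 := by
      apply (continuous_lform_right _).continuousAt.comp
      have h1 := continuousAt_lrefl (a := m + (0 : ℝ) • n) (ha0 0).ne' (lrefl m i.1)
      have h2 : ContinuousAt (fun ε : ℝ => (m + ε • n, lrefl m i.1)) 0 := by fun_prop
      exact ContinuousAt.comp (f := fun ε : ℝ => (m + ε • n, lrefl m i.1)) h1 h2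
    refine hc.eventually_lt_const ?_
    show lform (E.vec q) (lrefl (m + (0 : ℝ) • n) (lrefl m i.1)) < i.2
    rw [zero_smul, add_zero, lrefl_lrefl hm0.ne']
    exact hq i hi
  have hev := (eventually_all_finite hG).2 hcont
  obtain ⟨ε, hε, hε0⟩ := ((hev.filter_mono nhdsWithin_le_nhds).and
    (self_mem_nhdsWithin (s := Ioi (0 : ℝ)))).exists
  refine ⟨_, E.orientationPreserving_refl_trans_refl hm0 (ha0 ε), E.injective ?_,
    mem_openCell_move.2 fun i hi => ?_, ?_⟩
  · rw [E.vec_apply, E.lin_trans, E.lin_reflection, E.lin_reflection, lrefl_eq_self (a := m)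
      (by rw [lform_comm, hmp]), lrefl_eq_self]
    rw [lform_add_right, lform_smul_right, hnp, lform_comm, hmp]; ring
  · rw [E.lin_trans, E.lin_reflection, E.lin_reflection]
    exact hε i hi
  · have hwa : lform w (m + ε • n) = ε * lform w n := by
      rw [lform_add_right, lform_smul_right, lform_comm w m, h0, zero_add]
    have hma : lform m (m + ε • n) = s ^ 2 + 1 := by
      rw [lform_add_right, lform_smul_right, hmn, hmm, mul_zero, add_zero]
    rw [E.lin_trans, E.lin_reflection, E.lin_reflection,
      lrefl_eq_self (a := m) (by rw [lform_comm, h0]), lrefl_apply, lform_sub_right,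
      lform_smul_right, h0, hwa, hma, ha]
    have hε0 : ε ≠ 0 := ne_of_gt hε0
    have : 0 - 2 * (ε * lform w n) / ((s ^ 2 + 1) * (1 + ε ^ 2)) * (s ^ 2 + 1)
        = -(2 * ε * lform w n / (1 + ε ^ 2)) := by
      have h1 : s ^ 2 + 1 ≠ 0 := by positivity
      have h2 : 1 + ε ^ 2 ≠ 0 := by positivity
      field_simp
      ring
    rw [this, neg_ne_zero]
    have h2 : 1 + ε ^ 2 ≠ 0 := by positivity
    exact div_ne_zero (mul_ne_zero (mul_ne_zero two_ne_zero hε0) hwn) h2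

theorem FaceSystem.exists_crossing {K L : Set X} {F G : Set (LVec × ℝ)} (hF : E.FaceSystem K F)
    (hG : E.FaceSystem L G) {i j k : LVec × ℝ} (hi : i ∈ F) (hj : j ∈ F) (hij : i ≠ j)
    (hk : k ∈ G) : ∃ g : X ≃ᵢ X, OrientationPreserving g ∧ ∃ x₁ x₂ x₃ : X,
      lform (E.vec x₁) i.1 = i.2 ∧ x₁ ∈ E.openCell (E.move g G) ∧
      lform (E.vec x₂) j.1 = j.2 ∧ x₂ ∈ E.openCell (E.move g G) ∧
      lform (E.vec x₃) k.1 = k.2 ∧ g x₃ ∈ E.openCell F := by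
  obtain ⟨p, hp⟩ := E.exists_pt_lform_eq (hF.unit i hi) i.2
  obtain ⟨q, hq⟩ := E.exists_pt_lform_eq (hF.unit j hj) j.2
  obtain ⟨z, hz⟩ := E.exists_pt_lform_eq (hG.unit k hk) k.2
  have hpq : p ≠ q := by
    rintro rfl
    exact hF.disjoint i hi j hj hij p hp hq
  obtain ⟨y, hy, hzy⟩ := hG.exists_dist_eq hk hz (dist_pos.2 hpq)
  obtain ⟨g₀, hg₀, hg₀z, hg₀y⟩ := E.exists_orientationPreserving_pair hzy hpq
  have hq₀ : q ∈ E.openCell (E.move g₀ G) := by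
    rw [← hg₀y]; exact E.apply_mem_openCell_move.2 hy
  obtain ⟨g₁, hg₁, hg₁p, hq₁, htr⟩ := E.exists_rotation_transversal (hF.unit i hi)
    (w := E.lin g₀ k.1) (by rw [E.lform_lin]; exact hG.unit k hk) p q (finite_move hG.finite) hq₀
  have hmove : E.move g₁ (E.move g₀ G) = E.move (g₀.trans g₁) G := by
    rw [move, move, move, image_image]
    simp only [E.lin_trans]
  rw [hmove] at hq₁
  rw [← E.lin_trans] at htr
  set g := g₀.trans g₁ with hg
  have hgz : g z = p := by rw [hg, IsometryEquiv.trans_apply, hg₀z, hg₁p]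
  set w := E.lin g k.1 with hw
  have hww : lform w w = 1 := by rw [hw, E.lform_lin]; exact hG.unit k hk
  have hpw : lform (E.vec p) w = k.2 := by rw [← hgz, hw, E.lform_vec_lin, hz]
  obtain ⟨x₁, hx₁O, hx₁, hx₁w⟩ := E.exists_mem_curve_lt (hF.unit i hi) htr
    (O := E.openCell (E.move g (G \ {k}))) (E.isOpen_openCell (finite_move hG.finite.sdiff)) (by
      rw [mem_openCell_move]
      intro l hl
      rw [← hgz, E.lform_vec_lin]
      exact hG.lt_of_mem_curve hk hl.1 hl.2 hz)
  obtain ⟨x₃, hx₃O, hx₃, hx₃u⟩ := E.exists_mem_curve_lt (u := w) (w := i.1) (p := p) hww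
    (by rw [lform_lcross_swap, neg_ne_zero]; exact htr)
    (E.isOpen_openCell (hF.finite.sdiff (t := {i})))
    (fun l hl => hF.lt_of_mem_curve hi hl.1 hl.2 hp)
  refine ⟨g, hg₀.trans hg₁, x₁, q, g.symm x₃, hx₁.trans hp, ?_, hq, hq₁, ?_, ?_⟩
  · rw [mem_openCell_move] at hx₁O ⊢
    intro l hl
    by_cases hlk : l = k
    · rw [hlk, ← hpw]; exact hx₁w
    · exact hx₁O l ⟨hl, hlk⟩
  · rw [← E.lform_vec_lin g, g.apply_symm_apply, ← hw, hx₃, hpw]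
  · rw [g.apply_symm_apply]
    intro l hl
    by_cases hli : l = i
    · rw [hli, ← hp]; exact hx₃u
    · exact hx₃O l ⟨hl, hli⟩

end HypChart

/-- A polynomial multiple of the reflection `lrefl`. -/
noncomputable def polyRefl (x v : LVec) : LVec := lform x x • v - (2 * lform v x) • x

theorem polyRefl_eq {x : LVec} (hx : lform x x ≠ 0) (v : LVec) :
    polyRefl x v = lform x x • lrefl x v := by
  rw [polyRefl, lrefl_apply, smul_sub, smul_smul, mul_div_cancel₀ _ hx]

theorem lform_polyRefl_polyRefl {x y : LVec} (hx : lform x x = 0) (hy : lform y y = 0)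
    (p v : LVec) : lform p (polyRefl x (polyRefl y v)) =
      4 * lform x y * (lform v y * lform p x) := by
  simp only [polyRefl, hx, hy, zero_smul, zero_sub, lform_neg_left, lform_neg_right,
    lform_smul_left, lform_smul_right, lform_comm y x]
  ring

/-- The polynomial whose zeros are the exceptional pairs of reflections. -/
noncomputable def excPoly (p v p' v' : LVec) (c : ℝ) (q : LVec × LVec) : ℝ :=
  lform p (polyRefl q.1 (polyRefl q.2 v)) - lform p' (polyRefl q.1 (polyRefl q.2 v')) -
    c * (lform q.1 q.1 * lform q.2 q.2)

open scoped ContDiff in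
theorem analyticOnNhd_excPoly (p v p' v' : LVec) (c : ℝ) :
    AnalyticOnNhd ℝ (excPoly p v p' v' c) univ := by
  have hl : ∀ {f g : LVec × LVec → LVec}, ContDiff ℝ ω f → ContDiff ℝ ω g →
      ContDiff ℝ ω fun q => lform (f q) (g q) := fun hf hg => by
    unfold lform; fun_prop
  have hr : ∀ {f g : LVec × LVec → LVec}, ContDiff ℝ ω f → ContDiff ℝ ω g →
      ContDiff ℝ ω fun q => polyRefl (f q) (g q) := fun hf hg =>
    ((hl hf hf).smul hg).sub ((contDiff_const.mul (hl hg hf)).smul hf)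
  have h : ContDiff ℝ ω (excPoly p v p' v' c) :=
    ((hl contDiff_const (hr contDiff_fst (hr contDiff_snd contDiff_const))).sub
      (hl contDiff_const (hr contDiff_fst (hr contDiff_snd contDiff_const)))).sub
      (contDiff_const.mul ((hl contDiff_fst contDiff_fst).mul (hl contDiff_snd contDiff_snd)))
  exact h.analyticOnNhd

theorem smul_eq_smul_of_excPoly_eq_zero {p v p' v' : LVec} {c : ℝ}
    (h : ∀ q, excPoly p v p' v' c q = 0) (y : LVec) : lform v y • p = lform v' y • p' := by
  have key : ∀ x y : LVec, lform x x = 0 → lform y y = 0 → lform x y ≠ 0 →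
      lform v y * lform p x - lform v' y * lform p' x = 0 := by
    intro x y hx hy hxy
    have := h (x, y)
    simp only [excPoly, lform_polyRefl_polyRefl hx hy, hx] at this
    have h2 : 4 * lform x y * (lform v y * lform p x - lform v' y * lform p' x) = 0 := by
      linarith
    exact (mul_eq_zero.1 h2).resolve_left (mul_ne_zero four_ne_zero hxy)
  have n : ∀ a b a' b' : ℝ, a ^ 2 + b ^ 2 = 1 → a' ^ 2 + b' ^ 2 = 1 → a * a' + b * b' ≠ 1 →
      lform v (a', b', 1) * lform p (a, b, 1) - lform v' (a', b', 1) * lform p' (a, b, 1) = 0 := by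
    intro a b a' b' h1 h2 h3
    apply key <;> simp only [lform]
    · linarith
    · linarith
    · intro h; apply h3; linarith
  have h12 := n 1 0 (-1) 0 (by norm_num) (by norm_num) (by norm_num)
  have h13 := n 1 0 0 1 (by norm_num) (by norm_num) (by norm_num)
  have h21 := n (-1) 0 1 0 (by norm_num) (by norm_num) (by norm_num)
  have h23 := n (-1) 0 0 1 (by norm_num) (by norm_num) (by norm_num)
  have h31 := n 0 1 1 0 (by norm_num) (by norm_num) (by norm_num)
  have h32 := n 0 1 (-1) 0 (by norm_num) (by norm_num) (by norm_num)
  have h41 := n 0 (-1) 1 0 (by norm_num) (by norm_num) (by norm_num)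
  have h42 := n 0 (-1) (-1) 0 (by norm_num) (by norm_num) (by norm_num)
  have h43 := n 0 (-1) 0 1 (by norm_num) (by norm_num) (by norm_num)
  clear n key h
  simp only [lform] at *
  ext <;> simp only [Prod.smul_fst, Prod.smul_snd, smul_eq_mul]
  · linear_combination (y.1 + y.2.2 - y.2.1) / 2 * (-h21 + (h31 + h41) / 2) +
      (-y.1 + y.2.2 - y.2.1) / 2 * (h12 - (h32 + h42) / 2) + y.2.1 * ((h13 - h23) / 2)
  · linear_combination (y.1 + y.2.2 - y.2.1) / 2 * ((h31 - h41) / 2) +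
      (-y.1 + y.2.2 - y.2.1) / 2 * ((h32 - h42) / 2) + y.2.1 * (-h43 + (h13 + h23) / 2)
  · linear_combination (y.1 + y.2.2 - y.2.1) / 2 * (-(h31 + h41) / 2) +
      (-y.1 + y.2.2 - y.2.1) / 2 * (-(h32 + h42) / 2) + y.2.1 * (-(h13 + h23) / 2)

/-- A nontrivial condition on the composition of two reflections holds generically. -/
theorem eventually_residual_lform_ne {p v p' v' : LVec} (c : ℝ)
    (h : ∃ y, lform v y • p ≠ lform v' y • p') :
    ∀ᶠ q in residual (LVec × LVec), lform q.1 q.1 ≠ 0 → lform q.2 q.2 ≠ 0 →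
      lform p (lrefl q.1 (lrefl q.2 v)) ≠ lform p' (lrefl q.1 (lrefl q.2 v')) + c := by
  have han := analyticOnNhd_excPoly p v p' v' c
  have hcont : Continuous (excPoly p v p' v' c) :=
    continuous_iff_continuousAt.2 fun q => (han q (mem_univ q)).continuousAt
  have hres : {q | excPoly p v p' v' c q ≠ 0} ∈ residual (LVec × LVec) := by
    refine residual_of_dense_open (isOpen_ne_fun hcont continuous_const) ?_
    rw [← compl_compl {q | excPoly p v p' v' c q ≠ 0}, ← interior_eq_empty_iff_dense_compl,
      eq_empty_iff_forall_notMem]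
    intro q hq
    obtain ⟨y, hy⟩ := h
    refine hy (smul_eq_smul_of_excPoly_eq_zero (c := c) (fun q' => ?_) y)
    refine han.eqOn_zero_of_preconnected_of_eventuallyEq_zero isPreconnected_univ (mem_univ q) ?_
      (mem_univ q')
    filter_upwards [mem_interior_iff_mem_nhds.1 hq] with r hr
    simpa using hr
  filter_upwards [hres] with q hq h1 h2 he
  apply hq
  have hl : ∀ v, polyRefl q.1 (polyRefl q.2 v) =
      (lform q.1 q.1 * lform q.2 q.2) • lrefl q.1 (lrefl q.2 v) := fun v => by
    rw [polyRefl_eq h1, polyRefl_eq h2, map_smul, smul_smul]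
  rw [excPoly, hl, hl, lform_smul_right, lform_smul_right, he]
  ring

theorem eventually_lform_lrefl_lrefl_lt {a l v : LVec} {s : ℝ} (ha : lform a a ≠ 0)
    (h : lform l v < s) :
    ∀ᶠ q : LVec × LVec in nhds (a, a), lform l (lrefl q.1 (lrefl q.2 v)) < s := by
  have h1 : Tendsto (fun q : LVec × LVec => lrefl q.2 v) (nhds (a, a)) (nhds (lrefl a v)) :=
    (continuousAt_lrefl ha v).tendsto.comp (f := fun q : LVec × LVec => (q.2, v))
      (continuousAt_snd.prodMk continuousAt_const)
  have h2 : Tendsto (fun q : LVec × LVec => lrefl q.1 (lrefl q.2 v)) (nhds (a, a))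
      (nhds (lrefl a (lrefl a v))) :=
    (continuousAt_lrefl ha (lrefl a v)).tendsto.comp
      (f := fun q : LVec × LVec => (q.1, lrefl q.2 v)) (continuousAt_fst.prodMk_nhds h1)
  rw [lrefl_lrefl ha] at h2
  exact (((continuous_lform_right l).tendsto v).comp h2).eventually_lt_const h

/-- Unit vectors spanning the same tensor agree up to a common sign. -/
theorem eq_or_eq_neg_of_smul_eq {u v p w : LVec} (hu : lform u u = 1) (hv : lform v v = 1)
    (hp : lform p p = 1) (h : ∀ y, lform v y • u = lform w y • p) :
    (u = p ∧ v = w) ∨ (u = -p ∧ v = -w) := by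
  have h1 := h v
  rw [hv, one_smul] at h1
  have hp0 : p ≠ 0 := ne_zero_of_lform_self_ne (by rw [hp]; exact one_ne_zero)
  have h3 : lform w v ^ 2 = 1 := by
    have h2 := hu
    rw [h1, lform_smul_left, lform_smul_right, hp] at h2
    linarith
  have key : ∀ y, lform v y * lform w v = lform w y := fun y => by
    have := h y
    rw [h1, smul_smul] at this
    exact smul_left_injective ℝ hp0 this
  have hw : lform w v • v = w := by
    rw [← sub_eq_zero]
    refine eq_zero_of_forall_lform_eq_zero fun y => ?_
    rw [lform_sub_left, lform_smul_left, ← key y]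
    ring
  rcases sq_eq_one_iff.1 h3 with h4 | h4
  · rw [h4, one_smul] at h1 hw
    exact .inl ⟨h1, hw⟩
  · rw [h4, neg_one_smul] at h1 hw
    exact .inr ⟨h1, by rw [← hw, neg_neg]⟩

namespace HypChart
variable {E : HypChart X}

/-- A small generic perturbation of a motion. -/
theorem exists_generic_motion {F G : Set (LVec × ℝ)} (hF : F.Finite) (hG : G.Finite)
    {g₀ : X ≃ᵢ X} (hg₀ : OrientationPreserving g₀) {x₁ x₂ x₃ : X}
    (h₁ : x₁ ∈ E.openCell (E.move g₀ G)) (h₂ : x₂ ∈ E.openCell (E.move g₀ G))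
    (h₃ : g₀ x₃ ∈ E.openCell F) {P : (LVec → LVec) → Prop}
    (hP : ∀ᶠ q in residual (LVec × LVec), lform q.1 q.1 ≠ 0 → lform q.2 q.2 ≠ 0 →
      P fun v => lrefl q.1 (lrefl q.2 (E.lin g₀ v))) :
    ∃ g : X ≃ᵢ X, OrientationPreserving g ∧ x₁ ∈ E.openCell (E.move g G) ∧
      x₂ ∈ E.openCell (E.move g G) ∧ g x₃ ∈ E.openCell F ∧ P (E.lin g) := by
  obtain ⟨a, ha⟩ : ∃ a : LVec, 0 < lform a a := ⟨(1, 0, 0), by simp [lform]⟩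
  have e1 : ∀ᶠ q : LVec × LVec in nhds (a, a), 0 < lform q.1 q.1 :=
    (continuous_lform.comp (continuous_fst.prodMk continuous_fst)).continuousAt.tendsto
      |>.eventually_const_lt ha
  have e2 : ∀ᶠ q : LVec × LVec in nhds (a, a), 0 < lform q.2 q.2 :=
    (continuous_lform.comp (continuous_snd.prodMk continuous_snd)).continuousAt.tendsto
      |>.eventually_const_lt ha
  have e3 : ∀ x ∈ E.openCell (E.move g₀ G), ∀ᶠ q : LVec × LVec in nhds (a, a),
      ∀ i ∈ G, lform (E.vec x) (lrefl q.1 (lrefl q.2 (E.lin g₀ i.1))) < i.2 := fun x hx =>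
    (eventually_all_finite hG).2 fun i hi =>
      eventually_lform_lrefl_lrefl_lt ha.ne' (mem_openCell_move.1 hx i hi)
  have e4 : ∀ᶠ q : LVec × LVec in nhds (a, a),
      ∀ i ∈ F, lform i.1 (lrefl q.1 (lrefl q.2 (E.vec (g₀ x₃)))) < i.2 :=
    (eventually_all_finite hF).2 fun i hi =>
      eventually_lform_lrefl_lrefl_lt ha.ne' (by rw [lform_comm]; exact h₃ i hi)
  obtain ⟨q, hq, ⟨hq1, hq2⟩, ⟨hx₁, hx₂⟩, hx₃⟩ :=
    (dense_of_mem_residual hP).inter_nhds_nonempty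
      ((e1.and e2).and (((e3 _ h₁).and (e3 _ h₂)).and e4))
  have hlin : ∀ v, E.lin (g₀.trans ((E.refl q.2 hq2).trans (E.refl q.1 hq1))) v =
      lrefl q.1 (lrefl q.2 (E.lin g₀ v)) := fun v => by
    rw [E.lin_trans, E.lin_trans, E.lin_reflection, E.lin_reflection]
  refine ⟨_, hg₀.trans (E.orientationPreserving_refl_trans_refl hq2 hq1), ?_, ?_, ?_, ?_⟩
  · exact mem_openCell_move.2 fun i hi => by rw [hlin]; exact hx₁ i hi
  · exact mem_openCell_move.2 fun i hi => by rw [hlin]; exact hx₂ i hi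
  · intro i hi
    rw [E.vec_apply, hlin, ← E.vec_apply, lform_comm]
    exact hx₃ i hi
  · rw [show (E.lin _ : LVec → LVec) = _ from funext hlin]
    exact hq hq1.ne' hq2.ne'

theorem FaceSystem.not_of_ne_neg {K L : Set X} {F G : Set (LVec × ℝ)} (hF : E.FaceSystem K F)
    (hG : E.FaceSystem L G) {i j : LVec × ℝ} (hi : i ∈ F) (hj : j ∈ F) (hij : i ≠ j)
    (hne : i.1 ≠ -j.1) : ¬ T5Cond1 K L := by
  intro h
  obtain ⟨k, hk⟩ := hG.nonempty
  have hij1 : i.1 ≠ j.1 := hF.fst_ne hi hj hij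
  have hn : lcross i.1 j.1 ≠ 0 :=
    lcross_ne_zero (hF.unit i hi) (hF.unit j hj) hij1.symm fun h => hne (by rw [h, neg_neg])
  have hi0 : ∀ {l : LVec}, lform l l = 1 → l ≠ 0 := fun hl =>
    ne_zero_of_lform_self_ne (by rw [hl]; exact one_ne_zero)
  have hk1 := hG.unit k hk
  obtain ⟨g₀, hg₀, x₁, x₂, x₃, hx₁, hx₁', hx₂, hx₂', hx₃, hx₃'⟩ :=
    hF.exists_crossing hG hi hj hij hk
  have hg1 : ∀ {v : LVec}, lform v v = 1 → lform (E.lin g₀ v) (E.lin g₀ v) = 1 := fun hv => by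
    rw [E.lform_lin, hv]
  have gen : ∀ {p : LVec} (c : ℝ), p ≠ 0 → ∀ᶠ q in residual (LVec × LVec), lform q.1 q.1 ≠ 0 →
      lform q.2 q.2 ≠ 0 → lform p (lrefl q.1 (lrefl q.2 (E.lin g₀ k.1))) ≠ c := by
    intro p c hp
    have := eventually_residual_lform_ne (p := p) (v := E.lin g₀ k.1) (p' := 0) (v' := 0) c
      ⟨E.lin g₀ k.1, by rw [hg1 hk1, one_smul, smul_zero]; exact hp⟩
    simpa only [lform_zero_left, zero_add] using this
  obtain ⟨g, hg, hx₁g, hx₂g, hx₃g, ⟨hP1, hP2⟩, hP3, hP4⟩ := exists_generic_motion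
    (P := fun A => ((∀ u ∈ ({i.1, j.1} : Set LVec), ∀ l ∈ F, ∀ m ∈ G,
        ¬((l.1 = u ∧ m.1 = k.1) ∨ (l.1 = -u ∧ m.1 = -k.1)) →
          lform l.1 (A m.1) ≠ lform u (A k.1)) ∧
        (∀ u ∈ ({i.1, j.1} : Set LVec), ∀ l ∈ F, ∀ m ∈ F, lform u (A k.1) ≠ lform l.1 m.1)) ∧
        (∀ u ∈ ({i.1, j.1} : Set LVec), ∀ l ∈ G, ∀ m ∈ G, lform u (A k.1) ≠ lform l.1 m.1) ∧
        lform (lcross i.1 j.1) (A k.1) ≠ 0) hF.finite hG.finite hg₀ hx₁' hx₂' hx₃' (by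
    have hfin : ({i.1, j.1} : Set LVec).Finite := toFinite _
    have hunit : ∀ u ∈ ({i.1, j.1} : Set LVec), lform u u = 1 := by
      rintro u (rfl | rfl)
      exacts [hF.unit i hi, hF.unit j hj]
    have r1 := (eventually_all_finite hfin).2 fun u hu => (eventually_all_finite hF.finite).2
      fun l hl => (eventually_all_finite hG.finite).2 fun m hm =>
      show ∀ᶠ q in residual (LVec × LVec),
        ¬((l.1 = u ∧ m.1 = k.1) ∨ (l.1 = -u ∧ m.1 = -k.1)) → lform q.1 q.1 ≠ 0 →
        lform q.2 q.2 ≠ 0 → lform l.1 (lrefl q.1 (lrefl q.2 (E.lin g₀ m.1))) ≠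
          lform u (lrefl q.1 (lrefl q.2 (E.lin g₀ k.1))) from by
        rw [eventually_imp_distrib_left]
        intro hc
        have := eventually_residual_lform_ne (p := l.1) (v := E.lin g₀ m.1) (p' := u)
          (v' := E.lin g₀ k.1) 0 (by
            by_contra! hy
            refine hc ?_
            have := eq_or_eq_neg_of_smul_eq (hF.unit l hl) (hg1 (hG.unit m hm)) (hunit u hu) hy
            simpa only [← map_neg, (E.lin g₀).injective.eq_iff] using this)
        simpa only [add_zero] using this
    have r2 := (eventually_all_finite hfin).2 fun u hu => (eventually_all_finite hF.finite).2
      fun l hl => (eventually_all_finite hF.finite).2 fun m hm =>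
      gen (lform l.1 m.1) (hi0 (hunit u hu))
    have r3 := (eventually_all_finite hfin).2 fun u hu => (eventually_all_finite hG.finite).2
      fun l hl => (eventually_all_finite hG.finite).2 fun m hm =>
      gen (lform l.1 m.1) (hi0 (hunit u hu))
    filter_upwards [r1, r2, r3, gen 0 hn] with q q1 q2 q3 q4 ha hb
    exact ⟨⟨fun u hu l hl m hm hc => q1 u hu l hl m hm hc ha hb,
      fun u hu l hl m hm => q2 u hu l hl m hm ha hb⟩,
      fun u hu l hl m hm => q3 u hu l hl m hm ha hb, q4 ha hb⟩)
  set b := E.lin g k.1 with hb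
  have hbW : (b, k.2) ∈ F ∪ E.move g G := .inr ⟨k, hk, rfl⟩
  have hb1 : lform b b = 1 := by rw [hb, E.lform_lin, hk1]
  have hface : ∀ {l : LVec × ℝ} {x : X}, l ∈ F → lform (E.vec x) l.1 = l.2 →
      x ∈ E.openCell (E.move g G) → ∀ m ∈ F ∪ E.move g G, m ≠ (l.1, l.2) →
      lform (E.vec x) m.1 < m.2 := by
    rintro l x hl hx hxg m (hm | hm) hml
    · exact hF.lt_of_mem_curve hl hm hml hx
    · exact hxg m hm
  obtain ⟨f, hf, hfW⟩ := hF.exists_congruence hG h hg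
    (E.openCell_nonempty (hF.finite.union (finite_move hG.finite)) (hF.unit i hi) hx₁
      (hface hi hx₁ hx₁g))
  have m1 := hF.lin_mem hG hfW (.inl hi) hx₁ (hface hi hx₁ hx₁g)
  have m2 := hF.lin_mem hG hfW (.inl hj) hx₂ (hface hj hx₂ hx₂g)
  have m3 := hF.lin_mem hG hfW hbW (x := g x₃) (by rw [hb, E.lform_vec_lin, hx₃]) (by
    rintro m (hm | ⟨l, hl, rfl⟩) hml
    · exact hx₃g m hm
    · rw [E.lform_vec_lin]
      refine hG.lt_of_mem_curve hk hl ?_ hx₃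
      rintro rfl
      exact hml rfl)
  have key : ∀ u ∈ ({i.1, j.1} : Set LVec), ∀ s, (E.lin f u, s) ∈ F ∪ E.move g G →
      ∃ ε : ℝ, (ε = 1 ∨ ε = -1) ∧ ((E.lin f u = ε • u ∧ E.lin f b = ε • b) ∨
        (E.lin f u = ε • b ∧ E.lin f b = ε • u)) := by
    intro u hu s hm
    have hB := E.lform_lin f u b
    rcases hm with hm | ⟨m, hm, hme⟩ <;> rcases m3 with hm' | ⟨m', hm', hme'⟩
    · exact absurd hB.symm (hP2 u hu _ hm _ hm')
    · obtain ⟨hme', -⟩ := Prod.mk.inj hme'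
      rw [← hme'] at hB ⊢
      by_contra hc
      refine hP1 u hu _ hm _ hm' (fun hc' => hc ?_) hB
      rcases hc' with ⟨h1, h2⟩ | ⟨h1, h2⟩
      · exact ⟨1, .inl rfl, .inl ⟨by rw [one_smul]; exact h1, by rw [one_smul, h2]⟩⟩
      · exact ⟨-1, .inr rfl, .inl ⟨by rw [neg_one_smul]; exact h1,
          by rw [neg_one_smul, h2, map_neg]⟩⟩
    · obtain ⟨hme, -⟩ := Prod.mk.inj hme
      rw [← hme] at hB ⊢
      rw [lform_comm] at hB
      by_contra hc
      refine hP1 u hu _ hm' _ hm (fun hc' => hc ?_) hB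
      rcases hc' with ⟨h1, h2⟩ | ⟨h1, h2⟩
      · exact ⟨1, .inl rfl, .inr ⟨by rw [one_smul, h2], by rw [one_smul]; exact h1⟩⟩
      · exact ⟨-1, .inr rfl, .inr ⟨by rw [neg_one_smul, h2, map_neg],
          by rw [neg_one_smul]; exact h1⟩⟩
    · obtain ⟨hme, -⟩ := Prod.mk.inj hme
      obtain ⟨hme', -⟩ := Prod.mk.inj hme'
      rw [← hme, ← hme', E.lform_lin] at hB
      exact absurd hB.symm (hP3 u hu _ hm _ hm')
  have hε : ∀ {ε δ : ℝ} {v w : LVec}, (ε = 1 ∨ ε = -1) → (δ = 1 ∨ δ = -1) → ε • v = δ • w →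
      v = w ∨ v = -w := by
    rintro ε δ v w (rfl | rfl) (rfl | rfl) h <;>
      simp only [one_smul, neg_smul, neg_inj] at h
    exacts [.inl h, .inr h, .inr (neg_eq_iff_eq_neg.1 h), .inl h]
  have hbi : ¬(b = i.1 ∨ b = -i.1) := by
    rintro (h | h) <;> refine hP4 ?_ <;> rw [h]
    · exact lform_lcross_left _ _
    · rw [lform_neg_right, lform_lcross_left, neg_zero]
  have hbj : ¬(b = j.1 ∨ b = -j.1) := by
    rintro (h | h) <;> refine hP4 ?_ <;> rw [h]
    · exact lform_lcross_right _ _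
    · rw [lform_neg_right, lform_lcross_right, neg_zero]
  obtain ⟨ε, he, h1⟩ := key _ (.inl rfl) _ m1
  obtain ⟨δ, hd, h2⟩ := key _ (.inr rfl) _ m2
  rcases h1 with ⟨h1, h1'⟩ | ⟨h1, h1'⟩ <;> rcases h2 with ⟨h2, h2'⟩ | ⟨h2, h2'⟩
  · have hed : ε = δ := smul_left_injective ℝ (hi0 hb1) (h1'.symm.trans h2')
    rw [← hed] at h2
    rcases he with rfl | rfl
    · rw [one_smul] at h1 h1' h2
      exact hf (E.eq_refl_of_fix_three h1 h2 h1' hP4)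
    · have hx : ∀ v, E.lin f v = (-1 : ℝ) • v → lform (E.vec (f x₁) + E.vec x₁) v = 0 := by
        intro v hv
        have := E.lform_lin f (E.vec x₁) v
        rw [hv, lform_smul_right, ← E.vec_apply] at this
        rw [lform_add_left]; linarith
      have h0 := eq_zero_of_lform_eq_zero hP4 (hx _ h1) (hx _ h2) (hx _ h1')
      have p1 := (E.mem (f x₁)).2
      have p2 := (E.mem x₁).2
      have := congrArg (fun v : LVec => v.2.2) h0
      simp only [Prod.snd_add, Prod.snd_zero] at this
      linarith
  · exact hbj (hε he hd (h1'.symm.trans h2'))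
  · exact hbi (hε hd he (h2'.symm.trans h1'))
  · exact (hε he hd (h1'.symm.trans h2')).elim hij1 hne

end HypChart

theorem HypChart.FaceSystem.cases_of_t5Cond1 {E : HypChart X} {K L : Set X}
    {F G : Set (LVec × ℝ)} (hF : E.FaceSystem K F) (hG : E.FaceSystem L G) (h : T5Cond1 K L) :
    Theorem5Cases K L := by
  rcases hF.trichotomy with ⟨u, s, rfl⟩ | ⟨u, s₁, s₂, rfl, hs⟩ | ⟨i, hi, j, hj, hij, hne⟩
  · rcases hG.trichotomy with ⟨v, t, rfl⟩ | ⟨v, t₁, t₂, rfl, ht⟩ | ⟨i, hi, j, hj, hij, hne⟩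
    · exact hF.cases_of_singleton hG h
    · exact absurd h.symm (hG.not_strip_singleton ht hF)
    · exact absurd h.symm (hG.not_of_ne_neg hF hi hj hij hne)
  · rcases hG.trichotomy with ⟨v, t, rfl⟩ | ⟨v, t₁, t₂, rfl, ht⟩ | ⟨i, hi, j, hj, hij, hne⟩
    · exact absurd h (hF.not_strip_singleton hs hG)
    · exact hF.cases_of_strip hs hG ht h
    · exact absurd h.symm (hG.not_of_ne_neg hF hi hj hij hne)
  · exact absurd h (hF.not_of_ne_neg hG hi hj hij hne)

/-- **Theorem 5.** In the hyperbolic plane, for proper closed convex sets `K`, `L`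
with interior points: (3) ⟹ (2) ⟹ (1); and if all connected components of the
boundaries of `K` and `L` are hypercycles or straight lines, of finite total number,
then (1), (2) and (3) are equivalent. -/
theorem theorem5
    (X : Type*) [MetricSpace X] (hX : IsHyperbolicSpace X 2)
    (K L : Set X)
    (hKcl : IsClosed K) (hLcl : IsClosed L)
    (hKcv : GConvex K) (hLcv : GConvex L)
    (hKint : (interior K).Nonempty) (hLint : (interior L).Nonempty)
    (hKpr : K ≠ univ) (hLpr : L ≠ univ) :
    (Theorem5Cases K L → T5Cond2 K L) ∧
    (T5Cond2 K L → T5Cond1 K L) ∧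
    ((BdryHypOrLine K ∧ BdryHypOrLine L ∧ (bdryComponents K ∪ bdryComponents L).Finite) →
      ((T5Cond1 K L ↔ T5Cond2 K L) ∧ (T5Cond2 K L ↔ Theorem5Cases K L))) := by
  obtain ⟨E⟩ := hX.nonempty_hypChart
  have h32 : Theorem5Cases K L → T5Cond2 K L :=
    E.t5Cond2_of_cases hKcl hLcl hKcv hLcv hKint hLint
  have h21 : T5Cond2 K L → T5Cond1 K L := T5Cond2.t5Cond1
  refine ⟨h32, h21, fun ⟨hK, hL, hfin⟩ => ?_⟩
  obtain ⟨F, hF⟩ := E.exists_faceSystem hKcl hKcv hKint hKpr hK (hfin.subset subset_union_left)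
  obtain ⟨G, hG⟩ := E.exists_faceSystem hLcl hLcv hLint hLpr hL (hfin.subset subset_union_right)
  have h13 : T5Cond1 K L → Theorem5Cases K L := hF.cases_of_t5Cond1 hG
  exact ⟨⟨fun h => h32 (h13 h), h21⟩, fun h => h13 (h21 h), h32⟩

end BallChar
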